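/- arXiv:math/0012077 — 5 statements merged into one kernel-verified Lean document; each statement's English description precedes it below -/
import Mathlib

section
/- Let n ≥ 2 and let f : (0,∞) → ℝ be a C¹ function that is strictly monotone (either strictly increasing or strictly decreasing), such that x ↦ f(‖x‖) is locally integrable on ℝⁿ. Let Ω ⊂ ℝⁿ be a nonempty bounded open set whose boundary ∂Ω is a C¹ hypersurface, in the sense that for every p ∈ ∂Ω there exist an open neighborhood U of p and a C¹ function φ : U → ℝ with nonvanishing gradient on U such that Ω ∩ U = {x ∈ U : φ(x) < 0}. If there is a constant c such that ∫_Ω f(‖x−y‖) dy = c for every x ∈ ∂Ω, then Ω is an open ball: there exist z ∈ ℝⁿ and R > 0 with Ω = {x ∈ ℝⁿ : ‖x−z‖ < R}. -/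
open MeasureTheory Metric
open scoped RealInnerProductSpace


noncomputable section

/-- Exit time from `Ω` in the direction `e`, starting at `x`. -/
def exitT {n : ℕ} (Ω : Set (EuclideanSpace ℝ (Fin n))) (e x : EuclideanSpace ℝ (Fin n)) : ℝ :=
  sInf {s : ℝ | 0 ≤ s ∧ x + s • e ∉ Ω}

section basic
variable {n : ℕ} {Ω : Set (EuclideanSpace ℝ (Fin n))} {e x : EuclideanSpace ℝ (Fin n)}

theorem exitT_set_nonempty (hb : Bornology.IsBounded Ω) (he : ‖e‖ = 1)
    (x : EuclideanSpace ℝ (Fin n)) :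
    {s : ℝ | 0 ≤ s ∧ x + s • e ∉ Ω}.Nonempty := by
  obtain ⟨R, hR⟩ := hb.exists_norm_le
  refine ⟨|R| + ‖x‖ + 1, by positivity, fun h => ?_⟩
  have h1 := hR _ h
  have h2 : ‖(|R| + ‖x‖ + 1) • e‖ = |R| + ‖x‖ + 1 := by
    rw [norm_smul, he, mul_one, Real.norm_of_nonneg (by positivity)]
  have h3 := norm_sub_le (x + (|R| + ‖x‖ + 1) • e) x
  rw [add_sub_cancel_left, h2] at h3
  have := le_abs_self R
  linarith

theorem exitT_bddBelow (Ω : Set (EuclideanSpace ℝ (Fin n))) (e x : EuclideanSpace ℝ (Fin n)) :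
    BddBelow {s : ℝ | 0 ≤ s ∧ x + s • e ∉ Ω} := ⟨0, fun _ hs => hs.1⟩

theorem exitT_mem (ho : IsOpen Ω) (hb : Bornology.IsBounded Ω) (he : ‖e‖ = 1)
    (x : EuclideanSpace ℝ (Fin n)) :
    0 ≤ exitT Ω e x ∧ x + exitT Ω e x • e ∉ Ω := by
  have hcl : IsClosed {s : ℝ | 0 ≤ s ∧ x + s • e ∉ Ω} := by
    apply IsClosed.and
    · exact isClosed_le continuous_const continuous_id
    · exact (ho.isClosed_compl).preimage (by fun_prop : Continuous fun s : ℝ => x + s • e)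
  exact hcl.csInf_mem (exitT_set_nonempty hb he x) (exitT_bddBelow Ω e x)

theorem mem_of_lt_exitT {s : ℝ} (h0 : 0 ≤ s) (h : s < exitT Ω e x) : x + s • e ∈ Ω := by
  by_contra hc
  exact absurd (csInf_le (exitT_bddBelow Ω e x) (show s ∈ _ from ⟨h0, hc⟩)) (not_le.2 h)

theorem exitT_eq {b : ℝ} (hb0 : 0 ≤ b) (hb : x + b • e ∉ Ω)
    (h : ∀ s, 0 ≤ s → s < b → x + s • e ∈ Ω) : exitT Ω e x = b := by
  apply le_antisymm
  · exact csInf_le (exitT_bddBelow Ω e x) ⟨hb0, hb⟩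
  · refine le_csInf ⟨b, hb0, hb⟩ fun s hs => ?_
    by_contra hc
    exact hs.2 (h s hs.1 (not_le.1 hc))

theorem exitT_pos (ho : IsOpen Ω) (hb : Bornology.IsBounded Ω) (he : ‖e‖ = 1) (hx : x ∈ Ω) :
    0 < exitT Ω e x := by
  have h := exitT_mem ho hb he x
  rcases h.1.lt_or_eq with h1 | h1
  · exact h1
  · rw [← h1] at h
    simp at h
    exact absurd hx h

theorem mem_seg {s : ℝ} (h1 : -exitT Ω (-e) x < s) (h2 : s < exitT Ω e x) :
    x + s • e ∈ Ω := by
  rcases le_total 0 s with h | h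
  · exact mem_of_lt_exitT h h2
  · have := mem_of_lt_exitT (Ω := Ω) (e := -e) (x := x) (s := -s) (by linarith) (by linarith)
    simpa using this

theorem exitT_shift (ho : IsOpen Ω) (hb : Bornology.IsBounded Ω) (he : ‖e‖ = 1) (hx : x ∈ Ω)
    {s : ℝ} (h1 : -exitT Ω (-e) x < s) (h2 : s < exitT Ω e x) :
    exitT Ω e (x + s • e) = exitT Ω e x - s := by
  apply exitT_eq (by linarith)
  · have := (exitT_mem ho hb he x).2
    rwa [add_assoc, ← add_smul, add_sub_cancel]
  · intro t ht0 ht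
    rw [add_assoc, ← add_smul]
    exact mem_seg (by linarith) (by linarith)

theorem exitT_shift' (ho : IsOpen Ω) (hb : Bornology.IsBounded Ω) (he : ‖e‖ = 1) (hx : x ∈ Ω)
    {s : ℝ} (h1 : -exitT Ω (-e) x < s) (h2 : s < exitT Ω e x) :
    exitT Ω (-e) (x + s • e) = exitT Ω (-e) x + s := by
  have := exitT_shift (e := -e) (s := -s) ho hb (by rwa [norm_neg]) hx
    (by rw [neg_neg]; linarith) (by linarith)
  simpa using this

theorem exitT_frontier (ho : IsOpen Ω) (hb : Bornology.IsBounded Ω) (he : ‖e‖ = 1) (hx : x ∈ Ω) :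
    x + exitT Ω e x • e ∈ frontier Ω := by
  rw [ho.frontier_eq]
  refine ⟨?_, (exitT_mem ho hb he x).2⟩
  have hpos := exitT_pos ho hb he hx
  have h1 : exitT Ω e x ∈ closure (Set.Ico 0 (exitT Ω e x)) := by
    rw [closure_Ico hpos.ne]; exact ⟨hpos.le, le_rfl⟩
  have hc : Continuous fun s : ℝ => x + s • e := by fun_prop
  exact map_mem_closure (f := fun s : ℝ => x + s • e) hc h1 fun s hs => mem_of_lt_exitT hs.1 hs.2

theorem measurable_exitT (ho : IsOpen Ω) (hb : Bornology.IsBounded Ω) (he : ‖e‖ = 1) :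
    Measurable (exitT Ω e) := by
  apply measurable_of_Ioi
  intro t
  rcases lt_or_ge t 0 with h | h
  · have : exitT Ω e ⁻¹' Set.Ioi t = Set.univ := by
      ext x
      simpa using h.trans_le (exitT_mem ho hb he x).1
    rw [this]; exact MeasurableSet.univ
  · apply IsOpen.measurableSet
    have : exitT Ω e ⁻¹' Set.Ioi t = {x | ∀ s ∈ Set.Icc 0 t, x + s • e ∈ Ω} := by
      ext x
      constructor
      · intro hx s hs
        exact mem_of_lt_exitT hs.1 (hs.2.trans_lt hx)
      · intro hx
        by_contra hc
        have hm := exitT_mem ho hb he x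
        exact hm.2 (hx _ ⟨hm.1, not_lt.1 hc⟩)
    rw [this, isOpen_iff_mem_nhds]
    intro x hx
    refine isCompact_Icc.eventually_forall_of_forall_eventually (x₀ := x) fun s hs => ?_
    have hc : Continuous fun p : EuclideanSpace ℝ (Fin n) × ℝ => p.1 + p.2 • e := by fun_prop
    exact (ho.preimage hc).mem_nhds (hx s hs)

end basic
end


noncomputable section

/-- Length of the chord of `Ω` through `x` in the direction `e`. -/
def chordLen {n : ℕ} (Ω : Set (EuclideanSpace ℝ (Fin n))) (e x : EuclideanSpace ℝ (Fin n)) : ℝ :=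
  exitT Ω e x + exitT Ω (-e) x

/-- Pairs `(s, x)` with `x + s e` on the open chord through `x`. -/
def chordSet {n : ℕ} (Ω : Set (EuclideanSpace ℝ (Fin n))) (e : EuclideanSpace ℝ (Fin n)) :
    Set (ℝ × EuclideanSpace ℝ (Fin n)) :=
  {p | p.2 ∈ Ω ∧ -exitT Ω (-e) p.2 < p.1 ∧ p.1 < exitT Ω e p.2}

/-- The involution `(s, x) ↦ (-s, x + s e)`. -/
def chordInv {n : ℕ} (e : EuclideanSpace ℝ (Fin n)) (p : ℝ × EuclideanSpace ℝ (Fin n)) :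
    ℝ × EuclideanSpace ℝ (Fin n) := (-p.1, p.2 + p.1 • e)

section avg
variable {n : ℕ} {Ω : Set (EuclideanSpace ℝ (Fin n))} {e x : EuclideanSpace ℝ (Fin n)}

theorem norm_neg_one (he : ‖e‖ = 1) : ‖-e‖ = 1 := by rwa [norm_neg]

theorem measurable_chordLen (ho : IsOpen Ω) (hb : Bornology.IsBounded Ω) (he : ‖e‖ = 1) :
    Measurable (chordLen Ω e) :=
  (measurable_exitT ho hb he).add (measurable_exitT ho hb (norm_neg_one he))

theorem chordLen_pos (ho : IsOpen Ω) (hb : Bornology.IsBounded Ω) (he : ‖e‖ = 1) (hx : x ∈ Ω) :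
    0 < chordLen Ω e x :=
  add_pos (exitT_pos ho hb he hx) (exitT_pos ho hb (norm_neg_one he) hx)

theorem chordLen_nonneg (ho : IsOpen Ω) (hb : Bornology.IsBounded Ω) (he : ‖e‖ = 1)
    (x : EuclideanSpace ℝ (Fin n)) : 0 ≤ chordLen Ω e x :=
  add_nonneg (exitT_mem ho hb he x).1 (exitT_mem ho hb (norm_neg_one he) x).1

theorem measurableSet_chordSet (ho : IsOpen Ω) (hb : Bornology.IsBounded Ω) (he : ‖e‖ = 1) :
    MeasurableSet (chordSet Ω e) := by
  have h1 := measurable_exitT ho hb he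
  have h2 := measurable_exitT ho hb (norm_neg_one he)
  refine (measurable_snd ho.measurableSet).inter (MeasurableSet.inter ?_ ?_)
  · exact measurableSet_lt (h2.comp measurable_snd).neg measurable_fst
  · exact measurableSet_lt measurable_fst (h1.comp measurable_snd)

theorem chordInv_preserving (e : EuclideanSpace ℝ (Fin n)) :
    MeasurePreserving (chordInv e) (volume.prod volume) (volume.prod volume) := by
  refine MeasurePreserving.skew_product (f := fun s : ℝ => -s)
    (g := fun (s : ℝ) (z : EuclideanSpace ℝ (Fin n)) => z + s • e)
    (Measure.measurePreserving_neg volume) ?_ ?_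
  · have hc : Continuous (Function.uncurry fun (s : ℝ) (z : EuclideanSpace ℝ (Fin n)) =>
      z + s • e) := by
      unfold Function.uncurry; fun_prop
    exact hc.measurable
  · exact Filter.Eventually.of_forall fun s => map_add_right_eq_self volume (s • e)

theorem chordInv_chordInv (p : ℝ × EuclideanSpace ℝ (Fin n)) :
    chordInv e (chordInv e p) = p := by
  simp [chordInv]

theorem chordInv_mem (ho : IsOpen Ω) (hb : Bornology.IsBounded Ω) (he : ‖e‖ = 1)
    {p : ℝ × EuclideanSpace ℝ (Fin n)} (hp : p ∈ chordSet Ω e) : chordInv e p ∈ chordSet Ω e := by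
  obtain ⟨h1, h2, h3⟩ := hp
  refine ⟨mem_seg h2 h3, ?_, ?_⟩
  · simp only [chordInv]
    rw [exitT_shift' ho hb he h1 h2 h3]
    have := exitT_pos ho hb (norm_neg_one he) h1
    linarith
  · simp only [chordInv]
    rw [exitT_shift ho hb he h1 h2 h3]
    have := exitT_pos ho hb he h1
    linarith

theorem chordInv_mem_iff (ho : IsOpen Ω) (hb : Bornology.IsBounded Ω) (he : ‖e‖ = 1)
    {p : ℝ × EuclideanSpace ℝ (Fin n)} : chordInv e p ∈ chordSet Ω e ↔ p ∈ chordSet Ω e :=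
  ⟨fun h => by simpa [chordInv_chordInv] using chordInv_mem ho hb he h, chordInv_mem ho hb he⟩

theorem chordLen_shift (ho : IsOpen Ω) (hb : Bornology.IsBounded Ω) (he : ‖e‖ = 1)
    {p : ℝ × EuclideanSpace ℝ (Fin n)} (hp : p ∈ chordSet Ω e) :
    chordLen Ω e (p.2 + p.1 • e) = chordLen Ω e p.2 := by
  obtain ⟨h1, h2, h3⟩ := hp
  unfold chordLen
  rw [exitT_shift ho hb he h1 h2 h3, exitT_shift' ho hb he h1 h2 h3]
  ring

theorem avg_lintegral (ho : IsOpen Ω) (hb : Bornology.IsBounded Ω) (he : ‖e‖ = 1)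
    {H : EuclideanSpace ℝ (Fin n) → ENNReal} (hH : Measurable H) :
    ∫⁻ p, (chordSet Ω e).indicator
      (fun p => ENNReal.ofReal (chordLen Ω e p.2)⁻¹ * H (p.2 + p.1 • e)) p ∂(volume.prod volume)
      = ∫⁻ z in Ω, H z := by
  have hM := measurableSet_chordSet ho hb he
  have hL := measurable_chordLen ho hb he
  have hadd : Measurable fun p : ℝ × EuclideanSpace ℝ (Fin n) => p.2 + p.1 • e :=
    (by fun_prop : Continuous fun p : ℝ × EuclideanSpace ℝ (Fin n) => p.2 + p.1 • e).measurable
  have hm : Measurable ((chordSet Ω e).indicator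
      (fun p => ENNReal.ofReal (chordLen Ω e p.2)⁻¹ * H (p.2 + p.1 • e))) := by
    refine Measurable.indicator ?_ hM
    exact ((hL.comp measurable_snd).inv.ennreal_ofReal).mul (hH.comp hadd)
  rw [← (chordInv_preserving e).lintegral_comp hm]
  have h1 : ∀ p, (chordSet Ω e).indicator
      (fun p => ENNReal.ofReal (chordLen Ω e p.2)⁻¹ * H (p.2 + p.1 • e)) (chordInv e p)
      = (chordSet Ω e).indicator (fun p => ENNReal.ofReal (chordLen Ω e p.2)⁻¹ * H p.2) p := by
    intro p
    by_cases hp : p ∈ chordSet Ω e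
    · rw [Set.indicator_of_mem hp, Set.indicator_of_mem (chordInv_mem ho hb he hp)]
      simp only [chordInv]
      rw [chordLen_shift ho hb he hp]
      simp
    · rw [Set.indicator_of_notMem hp, Set.indicator_of_notMem
        (fun h => hp ((chordInv_mem_iff ho hb he).1 h))]
  simp_rw [h1]
  have hm2 : Measurable ((chordSet Ω e).indicator
      (fun p => ENNReal.ofReal (chordLen Ω e p.2)⁻¹ * H p.2)) := by
    refine Measurable.indicator ?_ hM
    exact ((hL.comp measurable_snd).inv.ennreal_ofReal).mul (hH.comp measurable_snd)
  rw [lintegral_prod_symm _ hm2.aemeasurable, ← lintegral_indicator ho.measurableSet]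
  congr 1
  ext z
  by_cases hz : z ∈ Ω
  · rw [Set.indicator_of_mem hz]
    have h2 : ∀ s, (chordSet Ω e).indicator
        (fun p => ENNReal.ofReal (chordLen Ω e p.2)⁻¹ * H p.2) (s, z)
        = (Set.Ioo (-exitT Ω (-e) z) (exitT Ω e z)).indicator
          (fun _ => ENNReal.ofReal (chordLen Ω e z)⁻¹ * H z) s := by
      intro s
      simp [Set.indicator, chordSet, hz]
    simp_rw [h2]
    rw [lintegral_indicator measurableSet_Ioo, setLIntegral_const, Real.volume_Ioo, sub_neg_eq_add]
    change _ * ENNReal.ofReal (chordLen Ω e z) = _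
    have hp := chordLen_pos ho hb he hz
    rw [mul_right_comm, ← ENNReal.ofReal_mul (inv_nonneg.2 hp.le), inv_mul_cancel₀ hp.ne']
    simp
  · rw [Set.indicator_of_notMem hz]
    have h2 : ∀ s, (chordSet Ω e).indicator
        (fun p => ENNReal.ofReal (chordLen Ω e p.2)⁻¹ * H p.2) (s, z) = 0 := by
      intro s
      simp [Set.indicator, chordSet, hz]
    simp [h2]

/-- the averaging integrand -/
def avgFun (Ω : Set (EuclideanSpace ℝ (Fin n))) (e : EuclideanSpace ℝ (Fin n))
    (h : EuclideanSpace ℝ (Fin n) → ℝ) (p : ℝ × EuclideanSpace ℝ (Fin n)) : ℝ :=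
  (chordSet Ω e).indicator (fun p => (chordLen Ω e p.2)⁻¹ * h (p.2 + p.1 • e)) p

theorem measurable_avgFun (ho : IsOpen Ω) (hb : Bornology.IsBounded Ω) (he : ‖e‖ = 1)
    {h : EuclideanSpace ℝ (Fin n) → ℝ} (hh : Measurable h) : Measurable (avgFun Ω e h) := by
  have hM := measurableSet_chordSet ho hb he
  have hL := measurable_chordLen ho hb he
  have hadd : Measurable fun p : ℝ × EuclideanSpace ℝ (Fin n) => p.2 + p.1 • e :=
    (by fun_prop : Continuous fun p : ℝ × EuclideanSpace ℝ (Fin n) => p.2 + p.1 • e).measurable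
  refine Measurable.indicator ?_ hM
  exact ((hL.comp measurable_snd).inv).mul (hh.comp hadd)

theorem avg_integral (ho : IsOpen Ω) (hb : Bornology.IsBounded Ω) (he : ‖e‖ = 1)
    {h : EuclideanSpace ℝ (Fin n) → ℝ} (hh : Measurable h) (hi : IntegrableOn h Ω) :
    Integrable (avgFun Ω e h) (volume.prod volume) ∧
    ∫ p, avgFun Ω e h p ∂(volume.prod volume) = ∫ z in Ω, h z := by
  have hM := measurableSet_chordSet ho hb he
  have hL := measurable_chordLen ho hb he
  have hm := measurable_avgFun ho hb he hh
  have h1 : ∀ p, avgFun Ω e h (chordInv e p)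
      = (chordSet Ω e).indicator (fun p => (chordLen Ω e p.2)⁻¹ * h p.2) p := by
    intro p
    unfold avgFun
    by_cases hp : p ∈ chordSet Ω e
    · rw [Set.indicator_of_mem hp, Set.indicator_of_mem (chordInv_mem ho hb he hp)]
      simp only [chordInv]
      rw [chordLen_shift ho hb he hp]
      simp
    · rw [Set.indicator_of_notMem hp, Set.indicator_of_notMem
        (fun h => hp ((chordInv_mem_iff ho hb he).1 h))]
  have hIntg : Integrable (avgFun Ω e h) (volume.prod volume) := by
    refine ⟨hm.aestronglyMeasurable, ?_⟩
    have h2 := avg_lintegral ho hb he (H := fun z => ‖h z‖ₑ) hh.enorm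
    have h3 : ∫⁻ p, ‖avgFun Ω e h p‖ₑ ∂(volume.prod volume) = ∫⁻ z in Ω, ‖h z‖ₑ := by
      rw [← h2]
      congr 1
      ext p
      unfold avgFun
      by_cases hp : p ∈ chordSet Ω e
      · rw [Set.indicator_of_mem hp, Set.indicator_of_mem hp, enorm_mul,
          Real.enorm_of_nonneg (inv_nonneg.2 (chordLen_nonneg ho hb he _))]
      · rw [Set.indicator_of_notMem hp, Set.indicator_of_notMem hp, enorm_zero]
    unfold HasFiniteIntegral
    rw [h3]
    exact hi.2
  refine ⟨hIntg, ?_⟩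
  have hpres := chordInv_preserving (n := n) e
  have hint2 : Integrable (fun p => avgFun Ω e h (chordInv e p)) (volume.prod volume) :=
    hpres.integrable_comp_of_integrable hIntg
  have e1 : ∫ p, avgFun Ω e h p ∂(volume.prod volume)
      = ∫ p, avgFun Ω e h (chordInv e p) ∂(volume.prod volume) := by
    conv_lhs => rw [← hpres.map_eq]
    rw [integral_map hpres.measurable.aemeasurable]
    exact hm.aestronglyMeasurable
  rw [e1, integral_prod_symm _ hint2, ← integral_indicator ho.measurableSet]
  congr 1
  ext z
  simp_rw [h1]
  by_cases hz : z ∈ Ω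
  · rw [Set.indicator_of_mem hz]
    have h2 : ∀ s, (chordSet Ω e).indicator
        (fun p => (chordLen Ω e p.2)⁻¹ * h p.2) (s, z)
        = (Set.Ioo (-exitT Ω (-e) z) (exitT Ω e z)).indicator
          (fun _ => (chordLen Ω e z)⁻¹ * h z) s := by
      intro s
      simp [Set.indicator, chordSet, hz]
    simp_rw [h2]
    have hp := chordLen_pos ho hb he hz
    rw [integral_indicator measurableSet_Ioo, setIntegral_const, measureReal_def, Real.volume_Ioo,
      sub_neg_eq_add]
    change (ENNReal.ofReal (chordLen Ω e z)).toReal • _ = _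
    rw [ENNReal.toReal_ofReal hp.le, smul_eq_mul, mul_inv_cancel_left₀ hp.ne']
  · rw [Set.indicator_of_notMem hz]
    have h2 : ∀ s, (chordSet Ω e).indicator
        (fun p => (chordLen Ω e p.2)⁻¹ * h p.2) (s, z) = 0 := by
      intro s
      simp [Set.indicator, chordSet, hz]
    simp [h2]

end avg
end


noncomputable section
section tube
variable {n : ℕ} {Ω : Set (EuclideanSpace ℝ (Fin n))} {e x : EuclideanSpace ℝ (Fin n)}

theorem tube_local (ho : IsOpen Ω) (hb : Bornology.IsBounded Ω) (he : ‖e‖ = 1)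
    (p : EuclideanSpace ℝ (Fin n))
    (hp : ∃ U : Set (EuclideanSpace ℝ (Fin n)), IsOpen U ∧ p ∈ U ∧
      ∃ φ : EuclideanSpace ℝ (Fin n) → ℝ, ContDiffOn ℝ 1 φ U ∧
        (∀ x ∈ U, gradient φ x ≠ 0) ∧ Ω ∩ U = {x ∈ U | φ x < 0}) :
    ∃ r > 0, ∃ C : ℝ, ∃ t₀ > 0, ∀ t, 0 < t → t ≤ t₀ →
      volume ({x ∈ Ω | exitT Ω e x ≤ t} ∩ ball p r) ≤ ENNReal.ofReal (C * t) := by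
  obtain ⟨U, hU, hpU, φ, hφ, hgrad, hΩU⟩ := hp
  set v := gradient φ p with hv
  have hv0 : v ≠ 0 := hgrad p hpU
  set g := ‖v‖ with hg
  have hg0 : 0 < g := norm_pos_iff.2 hv0
  have hstr : HasStrictFDerivAt φ (fderiv ℝ φ p) p :=
    (hφ.contDiffAt (hU.mem_nhds hpU)).hasStrictFDerivAt one_ne_zero
  have hfd : ∀ w, fderiv ℝ φ p w = ⟪v, w⟫ := by
    intro w
    rw [hv, gradient, InnerProductSpace.toDual_symm_apply]
  have hev := (hstr.isLittleO.def (half_pos hg0))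
  obtain ⟨r₁, hr₁, hr₁b⟩ := Metric.eventually_nhds_iff_ball.1 hev
  obtain ⟨r₂, hr₂, hr₂b⟩ := Metric.isOpen_iff.1 hU p hpU
  set r := min r₁ r₂ with hr
  have hr0 : 0 < r := lt_min hr₁ hr₂
  have key : ∀ a ∈ ball p r, ∀ b ∈ ball p r, |φ a - φ b - ⟪v, a - b⟫| ≤ g / 2 * ‖a - b‖ := by
    intro a ha b hb'
    have := hr₁b (a, b) (by
      rw [← ball_prod_same]
      exact ⟨ball_subset_ball (min_le_left _ _) ha, ball_subset_ball (min_le_left _ _) hb'⟩)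
    simpa [hfd] using this
  have hrU : ball p r ⊆ U := (ball_subset_ball (min_le_right _ _)).trans hr₂b
  set ν := g⁻¹ • v with hν
  have hν1 : ‖ν‖ = 1 := by
    rw [hν, norm_smul, norm_inv, Real.norm_of_nonneg hg0.le, ← hg, inv_mul_cancel₀ hg0.ne']
  have hvν : ⟪v, ν⟫ = g := by
    rw [hν, real_inner_smul_right, real_inner_self_eq_norm_sq, ← hg]
    field_simp
  refine ⟨r / 2, by positivity, (volume (ball p r)).toReal * (12 / r), r / 12, by positivity, ?_⟩
  intro t ht0 ht
  set S := {x ∈ Ω | exitT Ω e x ≤ t} ∩ ball p (r / 2) with hS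
  have hSm : MeasurableSet S := by
    refine MeasurableSet.inter ?_ measurableSet_ball
    exact ho.measurableSet.inter ((measurable_exitT ho hb he) measurableSet_Iic)
  have hSball : ∀ x ∈ S, x ∈ ball p r := fun x hx => ball_subset_ball (by linarith) hx.2
  have hneg : ∀ x ∈ S, φ x < 0 := by
    intro x hx
    have : x ∈ Ω ∩ U := ⟨hx.1.1, hrU (hSball x hx)⟩
    rw [hΩU] at this
    exact this.2
  have hlow : ∀ x ∈ S, -(3 / 2 * g * t) ≤ φ x := by
    intro x hx
    have hm := exitT_mem ho hb he x
    have hst : exitT Ω e x ≤ t := hx.1.2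
    set s := exitT Ω e x with hs
    have hns : ‖s • e‖ = s := by rw [norm_smul, he, mul_one, Real.norm_of_nonneg hm.1]
    have hxb : x + s • e ∈ ball p r := by
      have h1 : dist x p < r / 2 := hx.2
      rw [mem_ball]
      have h2 : dist (x + s • e) x = s := by rw [dist_eq_norm, add_sub_cancel_left, hns]
      have := dist_triangle (x + s • e) x p
      linarith
    have h0 : 0 ≤ φ (x + s • e) := by
      by_contra hc
      have : x + s • e ∈ Ω ∩ U := by
        rw [hΩU]; exact ⟨hrU hxb, not_le.1 hc⟩
      exact hm.2 this.1
    have h1 := key _ hxb _ (hSball x hx)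
    rw [add_sub_cancel_left, hns] at h1
    have h2 : ⟪v, s • e⟫ ≤ g * s := by
      have := real_inner_le_norm v (s • e)
      rwa [hns] at this
    have h3 := (abs_le.1 h1).2
    have h4 : g * s ≤ g * t := by gcongr
    linarith
  -- the translates are disjoint
  set K := ⌊r / (6 * t)⌋₊ with hK
  have hKle : (K : ℝ) * (6 * t) ≤ r := by
    have := Nat.floor_le (show 0 ≤ r / (6 * t) by positivity)
    rwa [le_div_iff₀ (by positivity)] at this
  have hKge : r / (12 * t) ≤ K := by
    have h1 := (Nat.lt_floor_add_one (r / (6 * t))).le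
    have h2 : 1 ≤ r / (12 * t) := by
      rw [le_div_iff₀ (by positivity)]; linarith
    have h3 : r / (6 * t) = 2 * (r / (12 * t)) := by field_simp; norm_num
    rw [← hK] at h1
    linarith
  let A : ℕ → Set (EuclideanSpace ℝ (Fin n)) := fun k => (fun y => y - (3 * t * k) • ν) ⁻¹' S
  have hA : ∀ k, volume (A k) = volume S := by
    intro k
    simp only [A, sub_eq_add_neg]
    exact measure_preimage_add_right volume _ S
  have hAm : ∀ k, MeasurableSet (A k) := fun k => (measurable_sub_const _) hSm
  have hlt : ∀ k l : ℕ, k < l → Disjoint (A k) (A l) := by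
    intro k l hkl
    rw [Set.disjoint_left]
    intro y hk hl
    have hk' : y - (3 * t * k) • ν ∈ S := hk
    have hl' : y - (3 * t * l) • ν ∈ S := hl
    have h1 := key _ (hSball _ hk') _ (hSball _ hl')
    have h2 : y - (3 * t * k) • ν - (y - (3 * t * l) • ν) = (3 * t * (l - k)) • ν := by
      module
    have hlk : (1 : ℝ) ≤ (l : ℝ) - k := by
      have : ((k + 1 : ℕ) : ℝ) ≤ l := by exact_mod_cast hkl
      push_cast at this; linarith
    have h5 : 0 ≤ 3 * t * ((l : ℝ) - k) := by positivity
    rw [h2, real_inner_smul_right, hvν, norm_smul, hν1, mul_one, Real.norm_of_nonneg h5] at h1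
    have h3 := (abs_le.1 h1).1
    have h6 := hneg _ hk'
    have h7 := hlow _ hl'
    have h8 : g * t * 1 ≤ g * t * ((l : ℝ) - k) := by gcongr
    nlinarith
  have hdisj : Set.PairwiseDisjoint (↑(Finset.range K)) A := by
    intro k _ l _ hkl
    rcases lt_or_gt_of_ne hkl with h | h
    · exact hlt k l h
    · exact (hlt l k h).symm
  have hsub : (⋃ k ∈ Finset.range K, A k) ⊆ ball p r := by
    intro y hy
    simp only [Set.mem_iUnion, Finset.mem_range] at hy
    obtain ⟨k, hk, hyk⟩ := hy
    have hyk' : y - (3 * t * k) • ν ∈ S := hyk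
    have h1 : dist (y - (3 * t * k) • ν) p < r / 2 := hyk'.2
    have h2 : dist y (y - (3 * t * k) • ν) = 3 * t * k := by
      rw [dist_eq_norm, sub_sub_cancel, norm_smul, hν1, mul_one, Real.norm_of_nonneg (by positivity)]
    have h3 := dist_triangle y (y - (3 * t * k) • ν) p
    have h4 : (k : ℝ) * (3 * t) ≤ K * (3 * t) := by gcongr
    rw [mem_ball]
    linarith
  have hsum := measure_mono (μ := volume) hsub
  rw [measure_biUnion_finset hdisj (fun k _ => hAm k)] at hsum
  simp only [hA, Finset.sum_const, Finset.card_range, nsmul_eq_mul] at hsum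
  have hfin : volume (ball p r) ≠ ⊤ := measure_ball_lt_top.ne
  have hSfin : volume S ≠ ⊤ :=
    ne_top_of_le_ne_top hfin (measure_mono fun x hx => hSball x hx)
  have hreal : (K : ℝ) * (volume S).toReal ≤ (volume (ball p r)).toReal := by
    have := ENNReal.toReal_mono hfin hsum
    simpa using this
  rw [ENNReal.le_ofReal_iff_toReal_le hSfin (by positivity)]
  have h9 : r / (12 * t) * (volume S).toReal ≤ (volume (ball p r)).toReal :=
    le_trans (by gcongr) hreal
  have h10 : (volume S).toReal = (12 / r * t) * (r / (12 * t) * (volume S).toReal) := by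
    field_simp
  rw [h10]
  calc _ ≤ (12 / r * t) * (volume (ball p r)).toReal := by gcongr
    _ = _ := by ring

theorem tube (ho : IsOpen Ω) (hb : Bornology.IsBounded Ω) (he : ‖e‖ = 1)
    (hbdry : ∀ p ∈ frontier Ω, ∃ U : Set (EuclideanSpace ℝ (Fin n)), IsOpen U ∧ p ∈ U ∧
      ∃ φ : EuclideanSpace ℝ (Fin n) → ℝ, ContDiffOn ℝ 1 φ U ∧
        (∀ x ∈ U, gradient φ x ≠ 0) ∧ Ω ∩ U = {x ∈ U | φ x < 0}) :
    ∃ C : ℝ, ∃ t₀ > 0, ∀ t, 0 < t → t ≤ t₀ →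
      volume {x ∈ Ω | exitT Ω e x ≤ t} ≤ ENNReal.ofReal (C * t) := by
  have hcomp : IsCompact (frontier Ω) :=
    Metric.isCompact_of_isClosed_isBounded isClosed_frontier
      (hb.closure.subset frontier_subset_closure)
  have hloc : ∀ p ∈ frontier Ω, ∃ r > 0, ∃ C : ℝ, ∃ t₀ > 0, ∀ t, 0 < t → t ≤ t₀ →
      volume ({x ∈ Ω | exitT Ω e x ≤ t} ∩ ball p r) ≤ ENNReal.ofReal (C * t) :=
    fun p hp => tube_local ho hb he p (hbdry p hp)
  -- induction over compact set
  have key : ∃ V : Set (EuclideanSpace ℝ (Fin n)), (IsOpen V ∧ frontier Ω ⊆ V) ∧ ∃ C : ℝ,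
      ∃ t₀ > 0, ∀ t, 0 < t → t ≤ t₀ →
      volume ({x ∈ Ω | exitT Ω e x ≤ t} ∩ V) ≤ ENNReal.ofReal (C * t) := by
    refine hcomp.induction_on (p := fun s => ∃ V : Set (EuclideanSpace ℝ (Fin n)),
      (IsOpen V ∧ s ⊆ V) ∧ ∃ C : ℝ, ∃ t₀ > 0, ∀ t, 0 < t → t ≤ t₀ →
      volume ({x ∈ Ω | exitT Ω e x ≤ t} ∩ V) ≤ ENNReal.ofReal (C * t)) ?_ ?_ ?_ ?_
    · exact ⟨∅, ⟨isOpen_empty, le_rfl⟩, 0, 1, one_pos, fun t _ _ => by simp⟩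
    · rintro s s' hs ⟨V, ⟨h1, h2⟩, h3⟩
      exact ⟨V, ⟨h1, hs.trans h2⟩, h3⟩
    · rintro s s' ⟨V, ⟨h1, h2⟩, C, t₀, ht₀, h3⟩ ⟨V', ⟨h1', h2'⟩, C', t₀', ht₀', h3'⟩
      refine ⟨V ∪ V', ⟨h1.union h1', Set.union_subset_union h2 h2'⟩, |C| + |C'|, min t₀ t₀',
        lt_min ht₀ ht₀', fun t ht htt => ?_⟩
      rw [Set.inter_union_distrib_left]
      refine (measure_union_le _ _).trans ?_
      rw [add_mul, ENNReal.ofReal_add (by positivity) (by positivity)]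
      refine add_le_add ((h3 t ht (htt.trans (min_le_left _ _))).trans ?_)
        ((h3' t ht (htt.trans (min_le_right _ _))).trans ?_)
      · apply ENNReal.ofReal_le_ofReal; gcongr; exact le_abs_self C
      · apply ENNReal.ofReal_le_ofReal; gcongr; exact le_abs_self C'
    · intro p hp
      obtain ⟨r, hr, h⟩ := hloc p hp
      exact ⟨ball p r, mem_nhdsWithin_of_mem_nhds (ball_mem_nhds p hr), ball p r,
        ⟨isOpen_ball, le_rfl⟩, h⟩
  obtain ⟨V, ⟨hVo, hV⟩, C, t₀, ht₀, h⟩ := key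
  obtain ⟨δ, hδ, hδV⟩ := hcomp.exists_thickening_subset_open hVo hV
  refine ⟨C, min t₀ (δ / 2), lt_min ht₀ (by positivity), fun t ht htt => ?_⟩
  refine (measure_mono ?_).trans (h t ht (htt.trans (min_le_left _ _)))
  intro x hx
  refine ⟨hx, hδV ?_⟩
  rw [mem_thickening_iff]
  refine ⟨_, exitT_frontier ho hb he hx.1, ?_⟩
  have h1 : exitT Ω e x ≤ t := hx.2
  rw [dist_eq_norm, sub_add_cancel_left, norm_neg, norm_smul, he, mul_one,
    Real.norm_of_nonneg (exitT_mem ho hb he x).1]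
  have := htt.trans (min_le_right _ _)
  linarith

theorem integrable_inv_len (ho : IsOpen Ω) (hb : Bornology.IsBounded Ω) (he : ‖e‖ = 1)
    (hbdry : ∀ p ∈ frontier Ω, ∃ U : Set (EuclideanSpace ℝ (Fin n)), IsOpen U ∧ p ∈ U ∧
      ∃ φ : EuclideanSpace ℝ (Fin n) → ℝ, ContDiffOn ℝ 1 φ U ∧
        (∀ x ∈ U, gradient φ x ≠ 0) ∧ Ω ∩ U = {x ∈ U | φ x < 0}) :
    IntegrableOn (fun x => (chordLen Ω e x)⁻¹) Ω := by
  obtain ⟨C, t₀, ht₀, hC⟩ := tube ho hb he hbdry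
  have hL := measurable_chordLen ho hb he
  have hE := measurable_exitT ho hb he
  have hM := measurableSet_chordSet ho hb he
  -- bound for the truncated integral
  have hbound : ∀ t, 0 < t → t ≤ t₀ →
      ∫⁻ z in Ω ∩ {z | t ≤ chordLen Ω e z}, ENNReal.ofReal (chordLen Ω e z)⁻¹
        ≤ ENNReal.ofReal C := by
    intro t ht htt
    have hSm : MeasurableSet {x | exitT Ω e x ≤ t} := hE measurableSet_Iic
    have h1 := avg_lintegral ho hb he
      (H := {x | exitT Ω e x ≤ t}.indicator (fun _ => (1 : ENNReal)))
      (measurable_const.indicator hSm)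
    have h2 : ∫⁻ z in Ω, {x | exitT Ω e x ≤ t}.indicator (fun _ => (1 : ENNReal)) z
        = volume {x ∈ Ω | exitT Ω e x ≤ t} := by
      rw [lintegral_indicator hSm, setLIntegral_one, Measure.restrict_apply hSm, Set.inter_comm]
      rfl
    rw [h2] at h1
    have hadd : Measurable fun p : ℝ × EuclideanSpace ℝ (Fin n) => p.2 + p.1 • e :=
      (by fun_prop : Continuous fun p : ℝ × EuclideanSpace ℝ (Fin n) => p.2 + p.1 • e).measurable
    rw [lintegral_prod_symm _ (by
      refine (Measurable.indicator ?_ hM).aemeasurable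
      exact ((hL.comp measurable_snd).inv.ennreal_ofReal).mul
        ((measurable_const.indicator hSm).comp hadd))] at h1
    have h3 : ENNReal.ofReal t *
        ∫⁻ z in Ω ∩ {z | t ≤ chordLen Ω e z}, ENNReal.ofReal (chordLen Ω e z)⁻¹
        ≤ volume {x ∈ Ω | exitT Ω e x ≤ t} := by
      have hLi : Measurable fun z => ENNReal.ofReal (chordLen Ω e z)⁻¹ := hL.inv.ennreal_ofReal
      rw [← h1, ← lintegral_const_mul _ hLi, ← lintegral_indicator
        (ho.measurableSet.inter (measurableSet_le measurable_const hL))]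
      apply lintegral_mono
      intro z
      by_cases hz : z ∈ Ω ∩ {z | t ≤ chordLen Ω e z}
      · rw [Set.indicator_of_mem hz]
        have hz2 : t ≤ exitT Ω e z + exitT Ω (-e) z := hz.2
        calc _ = ∫⁻ s, (Set.Ioo (exitT Ω e z - t) (exitT Ω e z)).indicator
              (fun _ => ENNReal.ofReal (chordLen Ω e z)⁻¹) s := by
              rw [lintegral_indicator measurableSet_Ioo, setLIntegral_const, Real.volume_Ioo,
                sub_sub_cancel, mul_comm]
          _ ≤ _ := by
              apply lintegral_mono
              intro s
              by_cases hs : s ∈ Set.Ioo (exitT Ω e z - t) (exitT Ω e z)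
              · have hms : (s, z) ∈ chordSet Ω e := ⟨hz.1, by
                  have := hs.1
                  change -exitT Ω (-e) z < s
                  linarith, hs.2⟩
                have : z + s • e ∈ {x | exitT Ω e x ≤ t} := by
                  change exitT Ω e (z + s • e) ≤ t
                  rw [exitT_shift ho hb he hms.1 hms.2.1 hms.2.2]
                  have := hs.1
                  linarith
                rw [Set.indicator_of_mem hs]
                simp only [Set.indicator_of_mem hms]
                rw [Set.indicator_of_mem this, mul_one]
              · rw [Set.indicator_of_notMem hs]
                exact zero_le
      · rw [Set.indicator_of_notMem hz]
        exact zero_le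
    have h4 := h3.trans (hC t ht htt)
    rw [mul_comm C t, ENNReal.ofReal_mul ht.le] at h4
    rwa [ENNReal.mul_le_mul_iff_right (by simpa using ht) ENNReal.ofReal_ne_top] at h4
  refine ⟨hL.inv.aestronglyMeasurable, ?_⟩
  unfold HasFiniteIntegral
  have hmono : Monotone fun k : ℕ => Ω ∩ {z | t₀ / (k + 1) ≤ chordLen Ω e z} := by
    intro k l hkl z hz
    refine ⟨hz.1, (le_trans ?_ hz.2 : t₀ / (l + 1) ≤ chordLen Ω e z)⟩
    have : (k : ℝ) ≤ l := by exact_mod_cast hkl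
    gcongr
  have hun : Ω = ⋃ k : ℕ, Ω ∩ {z | t₀ / (k + 1) ≤ chordLen Ω e z} := by
    ext z
    simp only [Set.mem_iUnion]
    refine ⟨fun hz => ?_, fun ⟨k, hk⟩ => hk.1⟩
    have hp := chordLen_pos ho hb he hz
    obtain ⟨k, hk⟩ := exists_nat_ge (t₀ / chordLen Ω e z)
    refine ⟨k, hz, ?_⟩
    change t₀ / (k + 1) ≤ chordLen Ω e z
    rw [div_le_iff₀ hp] at hk
    rw [div_le_iff₀ (by positivity)]
    nlinarith
  have hle : ∫⁻ z in Ω, ‖(chordLen Ω e z)⁻¹‖ₑ ≤ ENNReal.ofReal C := by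
    simp_rw [fun z => Real.enorm_of_nonneg (inv_nonneg.2 (chordLen_nonneg ho hb he z))]
    have hres : (volume : Measure (EuclideanSpace ℝ (Fin n))).restrict Ω
        = volume.restrict (⋃ k : ℕ, Ω ∩ {z | t₀ / (k + 1) ≤ chordLen Ω e z}) :=
      congrArg _ hun
    rw [hres, setLIntegral_iUnion_of_directed _ (hmono.directed_le)]
    refine iSup_le fun k => ?_
    refine hbound _ (by positivity) ?_
    exact div_le_self ht₀.le (by linarith [Nat.cast_nonneg (α := ℝ) k])
  exact hle.trans_lt ENNReal.ofReal_lt_top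

end tube
end


noncomputable section

/-- Interaction of two intervals `(a, b)` and a second one. -/
def inter4 (κ : ℝ → ℝ) (a b a' b' : ℝ) : ℝ :=
  (∫ t in (b - b')..(b - a'), κ t) - ∫ t in (a - b')..(a - a'), κ t

theorem inter4_swap {κ : ℝ → ℝ} (hκ : Continuous κ) (hev : ∀ t, κ (-t) = κ t) (a b a' b' : ℝ) :
    inter4 κ a' b' a b = - inter4 κ a b a' b' := by
  have hi : ∀ p q, IntervalIntegrable κ volume p q := fun p q => hκ.intervalIntegrable p q
  have hneg : ∀ p q, ∫ t in p..q, κ t = ∫ t in (-q)..(-p), κ t := by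
    intro p q
    rw [← intervalIntegral.integral_comp_neg]
    simp [hev]
  unfold inter4
  rw [hneg (b' - b), hneg (a' - b)]
  simp only [neg_sub]
  have h1 := intervalIntegral.integral_add_adjacent_intervals (hi (a - b') (b - b'))
    (hi (b - b') (b - a'))
  have h2 := intervalIntegral.integral_add_adjacent_intervals (hi (a - b') (a - a'))
    (hi (a - a') (b - a'))
  linarith

theorem odd_integral_neg {η : ℝ → ℝ} (hη : Continuous η) (hodd : ∀ t, η (-t) = - η t)
    (hneg : ∀ t, 0 < t → η t < 0) {p q : ℝ} (hpq : p < q) (hs : 0 < p + q) :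
    ∫ t in p..q, η t < 0 := by
  have hbase : ∀ p q : ℝ, 0 ≤ p → p < q → ∫ t in p..q, η t < 0 := by
    intro p q hp hpq
    have := intervalIntegral.intervalIntegral_pos_of_pos_on (f := fun t => - η t) (a := p) (b := q)
      (hη.neg.intervalIntegrable p q) (fun t ht => by
        have := hneg t (hp.trans_lt ht.1); linarith) hpq
    rw [intervalIntegral.integral_neg] at this
    linarith
  rcases le_or_gt 0 p with hp | hp
  · exact hbase p q hp hpq
  · have h0 : ∫ t in p..(-p), η t = 0 := by
      have h1 : ∫ t in p..(-p), η (-t) = ∫ t in p..(-p), η t := by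
        rw [intervalIntegral.integral_comp_neg]; simp
      simp_rw [hodd] at h1
      rw [intervalIntegral.integral_neg] at h1
      linarith
    have h2 := intervalIntegral.integral_add_adjacent_intervals
      (hη.intervalIntegrable (μ := volume) p (-p)) (hη.intervalIntegrable (μ := volume) (-p) q)
    have h3 := hbase (-p) q (by linarith) (by linarith)
    linarith

theorem inter4_neg {κ : ℝ → ℝ} (hκ : Continuous κ) (hev : ∀ t, κ (-t) = κ t)
    (hdec : ∀ s t, |s| < |t| → κ t < κ s) {a b a' b' : ℝ} (hab : a < b) (hab' : a' < b')
    (hc : a' + b' < a + b) : inter4 κ a b a' b' < 0 := by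
  have hi : ∀ p q, IntervalIntegrable κ volume p q := fun p q => hκ.intervalIntegrable p q
  have e1 : inter4 κ a b a' b'
      = ∫ m in (a - (a' + b') / 2)..(b - (a' + b') / 2),
          (κ (m + (b' - a') / 2) - κ (m - (b' - a') / 2)) := by
    rw [intervalIntegral.integral_sub, intervalIntegral.integral_comp_add_right,
      intervalIntegral.integral_comp_sub_right]
    · unfold inter4
      have r1 : a - (a' + b') / 2 + (b' - a') / 2 = a - a' := by ring
      have r2 : b - (a' + b') / 2 + (b' - a') / 2 = b - a' := by ring
      have r3 : a - (a' + b') / 2 - (b' - a') / 2 = a - b' := by ring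
      have r4 : b - (a' + b') / 2 - (b' - a') / 2 = b - b' := by ring
      rw [r1, r2, r3, r4]
      have h1 := intervalIntegral.integral_add_adjacent_intervals (hi (a - b') (b - b'))
        (hi (b - b') (b - a'))
      have h2 := intervalIntegral.integral_add_adjacent_intervals (hi (a - b') (a - a'))
        (hi (a - a') (b - a'))
      linarith
    · exact (by fun_prop : Continuous fun m => κ (m + (b' - a') / 2)).intervalIntegrable _ _
    · exact (by fun_prop : Continuous fun m => κ (m - (b' - a') / 2)).intervalIntegrable _ _
  rw [e1]
  refine odd_integral_neg (by fun_prop) ?_ ?_ (by linarith) (by linarith)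
  · intro t
    have h1 : -t + (b' - a') / 2 = -(t - (b' - a') / 2) := by ring
    have h2 : -t - (b' - a') / 2 = -(t + (b' - a') / 2) := by ring
    rw [h1, h2, hev, hev]; ring
  · intro t ht
    have : κ (t + (b' - a') / 2) < κ (t - (b' - a') / 2) := by
      apply hdec
      rw [← sq_lt_sq]
      nlinarith
    linarith

theorem inter4_sign {κ : ℝ → ℝ} (hκ : Continuous κ) (hev : ∀ t, κ (-t) = κ t)
    (hdec : ∀ s t, |s| < |t| → κ t < κ s) {a b a' b' : ℝ} (hab : a < b) (hab' : a' < b')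
    (hc : a + b ≠ a' + b') : ((a + b) / 2 - (a' + b') / 2) * inter4 κ a b a' b' < 0 := by
  rcases lt_or_gt_of_ne hc with h | h
  · have := inter4_neg hκ hev hdec hab' hab h
    rw [inter4_swap hκ hev] at this
    exact mul_neg_of_neg_of_pos (by linarith) (by linarith)
  · exact mul_neg_of_pos_of_neg (by linarith) (inter4_neg hκ hev hdec hab hab' h)

section link
variable {n : ℕ} {Ω : Set (EuclideanSpace ℝ (Fin n))} {e x : EuclideanSpace ℝ (Fin n)}

/-- difference of kernels at the two chord ends -/
def kerDiff (f : ℝ → ℝ) (Ω : Set (EuclideanSpace ℝ (Fin n))) (e x w : EuclideanSpace ℝ (Fin n)) :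
    ℝ :=
  f ‖x + exitT Ω e x • e - w‖ - f ‖x + exitT Ω (-e) x • (-e) - w‖

/-- averaged interaction -/
def gInt (f : ℝ → ℝ) (Ω : Set (EuclideanSpace ℝ (Fin n))) (e x z : EuclideanSpace ℝ (Fin n)) : ℝ :=
  ∫ s, avgFun Ω e (kerDiff f Ω e x) (s, z)

/-- squared distance to the line -/
def perpSq (e w : EuclideanSpace ℝ (Fin n)) : ℝ := ‖w‖ ^ 2 - ⟪w, e⟫ ^ 2

theorem perpSq_eq (he : ‖e‖ = 1) (w : EuclideanSpace ℝ (Fin n)) :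
    perpSq e w = ‖w - ⟪w, e⟫ • e‖ ^ 2 := by
  rw [norm_sub_sq_real, real_inner_smul_right, norm_smul, he, mul_one, Real.norm_eq_abs, sq_abs,
    perpSq]
  ring

theorem norm_line (he : ‖e‖ = 1) (w : EuclideanSpace ℝ (Fin n)) (τ : ℝ) :
    ‖w + τ • e‖ = √(perpSq e w + (⟪w, e⟫ + τ) ^ 2) := by
  rw [← Real.sqrt_sq (norm_nonneg (w + τ • e))]
  congr 1
  rw [norm_add_sq_real, real_inner_smul_right, norm_smul, he, mul_one, Real.norm_eq_abs, sq_abs,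
    perpSq]
  ring

/-- chord endpoints and midpoint coordinates -/
def chordB (Ω : Set (EuclideanSpace ℝ (Fin n))) (e x : EuclideanSpace ℝ (Fin n)) : ℝ :=
  ⟪x, e⟫ + exitT Ω e x

def chordA (Ω : Set (EuclideanSpace ℝ (Fin n))) (e x : EuclideanSpace ℝ (Fin n)) : ℝ :=
  ⟪x, e⟫ - exitT Ω (-e) x

def chordMid (Ω : Set (EuclideanSpace ℝ (Fin n))) (e x : EuclideanSpace ℝ (Fin n)) : ℝ :=
  (chordA Ω e x + chordB Ω e x) / 2

/-- kernel on a parallel line -/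
def lineKer (f : ℝ → ℝ) (r t : ℝ) : ℝ := f √(r + t ^ 2)

theorem lineKer_cont {f : ℝ → ℝ} (hf : ContinuousOn f (Set.Ioi 0)) {r : ℝ} (hr : 0 < r) :
    Continuous (lineKer f r) := by
  unfold lineKer
  refine hf.comp_continuous (by fun_prop) fun t => ?_
  exact Real.sqrt_pos.2 (by positivity)

theorem lineKer_even (f : ℝ → ℝ) (r t : ℝ) : lineKer f r (-t) = lineKer f r t := by
  simp [lineKer]

theorem lineKer_dec {f : ℝ → ℝ} (hf : StrictAntiOn f (Set.Ioi 0)) {r : ℝ} (hr : 0 < r)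
    (s t : ℝ) (h : |s| < |t|) : lineKer f r t < lineKer f r s := by
  refine hf (Real.sqrt_pos.2 (by positivity)) (Real.sqrt_pos.2 (by positivity)) ?_
  apply Real.sqrt_lt_sqrt (by positivity)
  have := sq_lt_sq.2 h
  linarith

theorem gInt_eq {f : ℝ → ℝ} (hf : ContinuousOn f (Set.Ioi 0)) (ho : IsOpen Ω)
    (hb : Bornology.IsBounded Ω) (he : ‖e‖ = 1) {z : EuclideanSpace ℝ (Fin n)} (hz : z ∈ Ω)
    (hr : 0 < perpSq e (x - z)) :
    gInt f Ω e x z = (chordLen Ω e z)⁻¹ *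
      inter4 (lineKer f (perpSq e (x - z))) (chordA Ω e x) (chordB Ω e x)
        (chordA Ω e z) (chordB Ω e z) := by
  have hk := lineKer_cont hf hr
  set κ := lineKer f (perpSq e (x - z)) with hκ
  have h1 : ∀ s, kerDiff f Ω e x (z + s • e)
      = κ (chordB Ω e x - ⟪z, e⟫ - s) - κ (chordA Ω e x - ⟪z, e⟫ - s) := by
    intro s
    unfold kerDiff
    have r1 : x + exitT Ω e x • e - (z + s • e) = (x - z) + (exitT Ω e x - s) • e := by module
    have r2 : x + exitT Ω (-e) x • (-e) - (z + s • e)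
        = (x - z) + (-exitT Ω (-e) x - s) • e := by module
    rw [r1, r2, norm_line he, norm_line he, inner_sub_left]
    simp only [hκ, lineKer, chordA, chordB]
    congr 4 <;> ring
  have h2 : ∀ s, avgFun Ω e (kerDiff f Ω e x) (s, z)
      = (Set.Ioo (-exitT Ω (-e) z) (exitT Ω e z)).indicator (fun s => (chordLen Ω e z)⁻¹ *
        (κ (chordB Ω e x - ⟪z, e⟫ - s) - κ (chordA Ω e x - ⟪z, e⟫ - s))) s := by
    intro s
    simp only [avgFun, Set.indicator, chordSet, Set.mem_ofPred_eq, hz, true_and, Set.mem_Ioo, h1]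
  have hle : -exitT Ω (-e) z ≤ exitT Ω e z := by
    have := chordLen_nonneg ho hb he z
    unfold chordLen at this
    linarith
  unfold gInt
  simp_rw [h2]
  rw [integral_indicator measurableSet_Ioo, integral_const_mul, ← integral_Ioc_eq_integral_Ioo,
    ← intervalIntegral.integral_of_le hle, intervalIntegral.integral_sub,
    intervalIntegral.integral_comp_sub_left, intervalIntegral.integral_comp_sub_left]
  · unfold inter4
    have r : ∀ y : ℝ, y - ⟪z, e⟫ - exitT Ω e z = y - chordB Ω e z := fun y => by
      unfold chordB; ring
    have r' : ∀ y : ℝ, y - ⟪z, e⟫ - -exitT Ω (-e) z = y - chordA Ω e z := fun y => by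
      unfold chordA; ring
    rw [r, r, r', r']
  · exact (by fun_prop : Continuous fun s => κ (chordB Ω e x - ⟪z, e⟫ - s)).intervalIntegrable _ _
  · exact (by fun_prop : Continuous fun s => κ (chordA Ω e x - ⟪z, e⟫ - s)).intervalIntegrable _ _

theorem perpSq_neg (w : EuclideanSpace ℝ (Fin n)) : perpSq e (-w) = perpSq e w := by
  simp [perpSq]

theorem perp_null (hn : 2 ≤ n) (he : ‖e‖ = 1) :
    volume {w : EuclideanSpace ℝ (Fin n) | perpSq e w = 0} = 0 := by
  have hs : (Submodule.span ℝ {e} : Submodule ℝ (EuclideanSpace ℝ (Fin n))) ≠ ⊤ := by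
    intro h
    have h1 := finrank_span_le_card (R := ℝ) ({e} : Set (EuclideanSpace ℝ (Fin n)))
    rw [h, finrank_top, finrank_euclideanSpace_fin] at h1
    simp at h1
    omega
  refine measure_mono_null ?_ (Measure.addHaar_submodule volume _ hs)
  intro w hw
  have hw' : perpSq e w = 0 := hw
  rw [perpSq_eq he] at hw'
  have : w - ⟪w, e⟫ • e = 0 := by simpa using hw'
  rw [sub_eq_zero] at this
  rw [this]
  exact Submodule.smul_mem _ _ (Submodule.mem_span_singleton_self e)

theorem measurable_perpSq (e : EuclideanSpace ℝ (Fin n)) : Measurable (perpSq e) := by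
  have : Continuous (perpSq e) := by unfold perpSq; fun_prop
  exact this.measurable

theorem perp_ae (hn : 2 ≤ n) (he : ‖e‖ = 1) :
    ∀ᵐ p : EuclideanSpace ℝ (Fin n) × EuclideanSpace ℝ (Fin n) ∂((volume.restrict Ω).prod
      (volume.restrict Ω)), 0 < perpSq e (p.1 - p.2) := by
  have hne : ∀ᵐ p : EuclideanSpace ℝ (Fin n) × EuclideanSpace ℝ (Fin n) ∂((volume.restrict Ω).prod
      (volume.restrict Ω)), perpSq e (p.1 - p.2) ≠ 0 := by
    have hms : MeasurableSet {p : EuclideanSpace ℝ (Fin n) × EuclideanSpace ℝ (Fin n) |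
        perpSq e (p.1 - p.2) = 0} :=
      ((measurable_perpSq e).comp (measurable_fst.sub measurable_snd)) (measurableSet_singleton 0)
    rw [ae_iff]
    simp only [ne_eq, not_not]
    rw [Measure.measure_prod_null hms]
    refine Filter.Eventually.of_forall fun x => ?_
    have h1 := (Measure.measurePreserving_sub_left (volume : Measure (EuclideanSpace ℝ (Fin n))) x
      ).measure_preimage (s := {w | perpSq e w = 0})
      ((measurable_perpSq e) (measurableSet_singleton 0)).nullMeasurableSet
    rw [perp_null hn he] at h1
    exact Measure.absolutelyContinuous_of_le Measure.restrict_le_self h1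
  filter_upwards [hne] with p hp
  refine lt_of_le_of_ne ?_ hp.symm
  rw [perpSq_eq he]
  positivity

end link
end


noncomputable section
section main
variable {n : ℕ} {Ω : Set (EuclideanSpace ℝ (Fin n))} {e x : EuclideanSpace ℝ (Fin n)}

theorem ker_int {f : ℝ → ℝ}
    (hloc : LocallyIntegrable (fun x : EuclideanSpace ℝ (Fin n) => f ‖x‖) volume)
    {R : ℝ} (hΩ : Ω ⊆ closedBall 0 R) {q : EuclideanSpace ℝ (Fin n)} (hq : ‖q‖ ≤ R) :
    IntegrableOn (fun z => f ‖q - z‖) Ω ∧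
      ∫ z in Ω, |f ‖q - z‖| ≤ ∫ w in closedBall (0 : EuclideanSpace ℝ (Fin n)) (2 * R), |f ‖w‖| := by
  have hI : IntegrableOn (fun w : EuclideanSpace ℝ (Fin n) => f ‖w‖) (closedBall 0 (2 * R)) :=
    hloc.integrableOn_isCompact (isCompact_closedBall _ _)
  have hmp := Measure.measurePreserving_sub_left (volume : Measure (EuclideanSpace ℝ (Fin n))) q
  have hemb : MeasurableEmbedding fun z : EuclideanSpace ℝ (Fin n) => q - z :=
    (MeasurableEquiv.subLeft q).measurableEmbedding
  have hsub : Ω ⊆ (fun z => q - z) ⁻¹' (closedBall 0 (2 * R)) := by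
    intro z hz
    have h1 := hΩ hz
    rw [mem_closedBall_zero_iff] at h1
    rw [Set.mem_preimage, mem_closedBall_zero_iff]
    have := norm_sub_le q z
    linarith
  have h2 : IntegrableOn (fun z => f ‖q - z‖) ((fun z => q - z) ⁻¹' (closedBall 0 (2 * R))) :=
    (hmp.integrableOn_comp_preimage hemb).2 hI
  refine ⟨h2.mono_set hsub, ?_⟩
  rw [← hmp.setIntegral_preimage_emb hemb (fun w => |f ‖w‖|)]
  exact setIntegral_mono_set h2.abs (Filter.Eventually.of_forall fun _ => abs_nonneg _)
    (Filter.Eventually.of_forall hsub)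

theorem exit_norm_le (ho : IsOpen Ω) (hb : Bornology.IsBounded Ω) (he : ‖e‖ = 1) {R : ℝ}
    (hΩ : Ω ⊆ closedBall 0 R) (hx : x ∈ Ω) : ‖x + exitT Ω e x • e‖ ≤ R := by
  have h1 := frontier_subset_closure (exitT_frontier ho hb he hx)
  have := closure_minimal hΩ isClosed_closedBall h1
  rwa [mem_closedBall_zero_iff] at this

theorem chordMid_abs_le (ho : IsOpen Ω) (hb : Bornology.IsBounded Ω) (he : ‖e‖ = 1) {R : ℝ}
    (hΩ : Ω ⊆ closedBall 0 R) (hx : x ∈ Ω) : |chordMid Ω e x| ≤ R := by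
  have h1 := exit_norm_le ho hb he hΩ hx
  have h2 := exit_norm_le ho hb (norm_neg_one he) hΩ hx
  have e1 : chordB Ω e x = ⟪x + exitT Ω e x • e, e⟫ := by
    rw [inner_add_left, real_inner_smul_left, real_inner_self_eq_norm_sq, he, chordB]; ring
  have e2 : chordA Ω e x = ⟪x + exitT Ω (-e) x • (-e), e⟫ := by
    rw [inner_add_left, real_inner_smul_left, inner_neg_left, real_inner_self_eq_norm_sq, he,
      chordA]; ring
  have h3 := abs_real_inner_le_norm (x + exitT Ω e x • e) e
  have h4 := abs_real_inner_le_norm (x + exitT Ω (-e) x • (-e)) e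
  rw [he, mul_one] at h3 h4
  rw [← e1] at h3
  rw [← e2] at h4
  unfold chordMid
  have h5 := abs_le.1 (h3.trans h1)
  have h6 := abs_le.1 (h4.trans h2)
  rw [abs_le]
  constructor <;> linarith [h5.1, h5.2, h6.1, h6.2]

theorem measurable_chordMid (ho : IsOpen Ω) (hb : Bornology.IsBounded Ω) (he : ‖e‖ = 1) :
    Measurable (chordMid Ω e) := by
  have h1 := measurable_exitT ho hb he
  have h2 := measurable_exitT ho hb (norm_neg_one he)
  have h3 : Measurable fun x : EuclideanSpace ℝ (Fin n) => ⟪x, e⟫ :=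
    (by fun_prop : Continuous fun x : EuclideanSpace ℝ (Fin n) => ⟪x, e⟫).measurable
  exact ((h3.sub h2).add (h3.add h1)).div_const 2

theorem measurable_kerDiff {f : ℝ → ℝ} (hfm : Measurable f) (ho : IsOpen Ω)
    (hb : Bornology.IsBounded Ω) (he : ‖e‖ = 1) :
    Measurable fun p : EuclideanSpace ℝ (Fin n) × EuclideanSpace ℝ (Fin n) =>
      kerDiff f Ω e p.1 p.2 := by
  have h1 := measurable_exitT ho hb he
  have h2 := measurable_exitT ho hb (norm_neg_one he)
  unfold kerDiff
  refine Measurable.sub ?_ ?_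
  · refine hfm.comp (Measurable.norm ?_)
    exact (measurable_fst.add ((h1.comp measurable_fst).smul_const e)).sub measurable_snd
  · refine hfm.comp (Measurable.norm ?_)
    exact (measurable_fst.add ((h2.comp measurable_fst).smul_const (-e))).sub measurable_snd

set_option maxHeartbeats 1000000 in
theorem measurable_gInt {f : ℝ → ℝ} (hfm : Measurable f) (ho : IsOpen Ω)
    (hb : Bornology.IsBounded Ω) (he : ‖e‖ = 1) :
    Measurable fun p : EuclideanSpace ℝ (Fin n) × EuclideanSpace ℝ (Fin n) =>
      gInt f Ω e p.1 p.2 := by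
  have hk := measurable_kerDiff hfm ho hb he
  have hL := measurable_chordLen ho hb he
  have hM := measurableSet_chordSet ho hb he
  unfold gInt
  refine StronglyMeasurable.measurable ?_
  refine StronglyMeasurable.integral_prod_right (f := fun
    (p : EuclideanSpace ℝ (Fin n) × EuclideanSpace ℝ (Fin n)) (s : ℝ) =>
      avgFun Ω e (kerDiff f Ω e p.1) (s, p.2)) ?_
  refine Measurable.stronglyMeasurable ?_
  have hq : Measurable fun q : (EuclideanSpace ℝ (Fin n) × EuclideanSpace ℝ (Fin n)) × ℝ =>
      (q.2, q.1.2) := measurable_snd.prodMk (measurable_snd.comp measurable_fst)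
  have hadd : Measurable fun q : (EuclideanSpace ℝ (Fin n) × EuclideanSpace ℝ (Fin n)) × ℝ =>
      (q.1.1, q.1.2 + q.2 • e) :=
    (by fun_prop : Continuous fun q : (EuclideanSpace ℝ (Fin n) × EuclideanSpace ℝ (Fin n)) × ℝ =>
      (q.1.1, q.1.2 + q.2 • e)).measurable
  have : Measurable (((fun q : (EuclideanSpace ℝ (Fin n) × EuclideanSpace ℝ (Fin n)) × ℝ =>
      (q.2, q.1.2)) ⁻¹' (chordSet Ω e)).indicator (fun q => (chordLen Ω e q.1.2)⁻¹ *
      kerDiff f Ω e q.1.1 (q.1.2 + q.2 • e))) := by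
    refine Measurable.indicator ?_ (hq hM)
    have h1 : Measurable fun q : (EuclideanSpace ℝ (Fin n) × EuclideanSpace ℝ (Fin n)) × ℝ =>
        chordLen Ω e q.1.2 := Measurable.comp (g := chordLen Ω e) hL
          (measurable_snd.comp measurable_fst)
    have h2 : Measurable fun q : (EuclideanSpace ℝ (Fin n) × EuclideanSpace ℝ (Fin n)) × ℝ =>
        kerDiff f Ω e q.1.1 (q.1.2 + q.2 • e) := by
      have h3 := hk.comp hadd
      simp only [Function.comp_def] at h3
      exact h3
    exact Measurable.mul (Measurable.inv h1) h2
  exact this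

set_option maxHeartbeats 1000000 in
theorem mid_ae_const (hn : 2 ≤ n) {f : ℝ → ℝ} (hfm : Measurable f)
    (hfc : ContinuousOn f (Set.Ioi 0)) (hanti : StrictAntiOn f (Set.Ioi 0))
    (hloc : LocallyIntegrable (fun x : EuclideanSpace ℝ (Fin n) => f ‖x‖) volume)
    (hne : Ω.Nonempty) (hb : Bornology.IsBounded Ω) (ho : IsOpen Ω)
    (hbdry : ∀ p ∈ frontier Ω, ∃ U : Set (EuclideanSpace ℝ (Fin n)), IsOpen U ∧ p ∈ U ∧
      ∃ φ : EuclideanSpace ℝ (Fin n) → ℝ, ContDiffOn ℝ 1 φ U ∧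
        (∀ x ∈ U, gradient φ x ≠ 0) ∧ Ω ∩ U = {x ∈ U | φ x < 0})
    (c : ℝ) (hc : ∀ x ∈ frontier Ω, (∫ y in Ω, f ‖x - y‖) = c) (he : ‖e‖ = 1) :
    ∃ l : ℝ, ∀ᵐ z ∂(volume.restrict Ω), chordMid Ω e z = l := by
  obtain ⟨R, hR⟩ := hb.exists_norm_le
  have hΩ : Ω ⊆ closedBall 0 R := fun z hz => by simpa using hR z hz
  have hinv := integrable_inv_len ho hb he hbdry
  have hmk := measurable_kerDiff (e := e) hfm ho hb he
  have hmg := measurable_gInt (e := e) hfm ho hb he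
  have hmm := measurable_chordMid (e := e) ho hb he
  have hmL := measurable_chordLen (e := e) ho hb he
  set C := ∫ w in closedBall (0 : EuclideanSpace ℝ (Fin n)) (2 * R), |f ‖w‖| with hC
  have hmk1 : ∀ x, Measurable (kerDiff f Ω e x) := fun x => by
    have h3 := hmk.comp (measurable_prodMk_left (x := x))
    simp only [Function.comp_def] at h3
    exact h3
  -- facts at a fixed point
  have hk0 : ∀ x ∈ Ω, IntegrableOn (kerDiff f Ω e x) Ω ∧ ∫ z in Ω, kerDiff f Ω e x z = 0 ∧
      ∫ z in Ω, |kerDiff f Ω e x z| ≤ 2 * C := by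
    intro x hx
    obtain ⟨i1, b1⟩ := ker_int hloc hΩ (exit_norm_le ho hb he hΩ hx)
    obtain ⟨i2, b2⟩ := ker_int hloc hΩ (exit_norm_le ho hb (norm_neg_one he) hΩ hx)
    have hi : IntegrableOn (kerDiff f Ω e x) Ω := i1.sub i2
    refine ⟨hi, ?_, ?_⟩
    · unfold kerDiff
      rw [integral_sub i1 i2, hc _ (exitT_frontier ho hb he hx),
        hc _ (exitT_frontier ho hb (norm_neg_one he) hx), sub_self]
    · calc ∫ z in Ω, |kerDiff f Ω e x z|
          ≤ ∫ z in Ω, (|f ‖x + exitT Ω e x • e - z‖| + |f ‖x + exitT Ω (-e) x • (-e) - z‖|) :=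
            integral_mono hi.abs (i1.abs.add i2.abs) fun z => abs_sub _ _
        _ = _ := integral_add i1.abs i2.abs
        _ ≤ 2 * C := by linarith
  have hG : ∀ x ∈ Ω, IntegrableOn (gInt f Ω e x) Ω ∧ ∫ z in Ω, gInt f Ω e x z = 0 ∧
      ∫ z in Ω, ‖gInt f Ω e x z‖ ≤ 2 * C := by
    intro x hx
    obtain ⟨h1, h2, h3⟩ := hk0 x hx
    obtain ⟨a1, a2⟩ := avg_integral ho hb he (hmk1 x) h1
    obtain ⟨a3, a4⟩ := avg_integral ho hb he (hmk1 x).abs h1.abs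
    have hgi : Integrable (gInt f Ω e x) := a1.integral_prod_right
    have hzero : ∀ z, z ∉ Ω → gInt f Ω e x z = 0 := by
      intro z hz
      have : ∀ s, avgFun Ω e (kerDiff f Ω e x) (s, z) = 0 := fun s => by
        simp [avgFun, Set.indicator, chordSet, hz]
      simp [gInt, this]
    refine ⟨hgi.integrableOn, ?_, ?_⟩
    · rw [setIntegral_eq_integral_of_forall_compl_eq_zero hzero, ← h2, ← a2,
        integral_prod_symm _ a1]
      rfl
    · refine le_trans ?_ h3
      rw [← a4, integral_prod_symm _ a3, setIntegral_eq_integral_of_forall_compl_eq_zero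
        (fun z hz => by rw [hzero z hz, norm_zero])]
      refine integral_mono hgi.norm a3.integral_prod_right fun z => ?_
      refine (norm_integral_le_integral_norm _).trans (le_of_eq ?_)
      congr 1
      ext s
      unfold avgFun
      by_cases hp : (s, z) ∈ chordSet Ω e
      · rw [Set.indicator_of_mem hp, Set.indicator_of_mem hp, norm_mul,
          Real.norm_of_nonneg (inv_nonneg.2 (chordLen_nonneg ho hb he _)), Real.norm_eq_abs]
      · rw [Set.indicator_of_notMem hp, Set.indicator_of_notMem hp, norm_zero]
  -- the double integral
  set μ := (volume : Measure (EuclideanSpace ℝ (Fin n))).restrict Ω with hμ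
  let w : EuclideanSpace ℝ (Fin n) → ℝ := fun x => chordMid Ω e x * (chordLen Ω e x)⁻¹
  have hmw : Measurable w := hmm.mul hmL.inv
  let Ψ : EuclideanSpace ℝ (Fin n) × EuclideanSpace ℝ (Fin n) → ℝ :=
    fun p => w p.1 * gInt f Ω e p.1 p.2
  have hmΨ : Measurable Ψ := (hmw.comp measurable_fst).mul hmg
  have haeΩ : ∀ᵐ x ∂μ, x ∈ Ω := ae_restrict_mem ho.measurableSet
  have hΨi : Integrable Ψ (μ.prod μ) := by
    rw [integrable_prod_iff hmΨ.aestronglyMeasurable]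
    constructor
    · filter_upwards [haeΩ] with x hx
      exact (hG x hx).1.const_mul (w x)
    · refine Integrable.mono' (g := fun x => (chordLen Ω e x)⁻¹ * (R * (2 * C)))
        (hinv.mul_const _) ?_ ?_
      · exact (StronglyMeasurable.integral_prod_right
          (f := fun x y => ‖Ψ (x, y)‖) hmΨ.norm.stronglyMeasurable).aestronglyMeasurable
      · filter_upwards [haeΩ] with x hx
        rw [Real.norm_of_nonneg (integral_nonneg fun _ => norm_nonneg _)]
        have hl := chordLen_pos ho hb he hx
        have hmb := chordMid_abs_le ho hb he hΩ hx
        have h3 := (hG x hx).2.2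
        calc ∫ y, ‖Ψ (x, y)‖ ∂μ = ‖w x‖ * ∫ y, ‖gInt f Ω e x y‖ ∂μ := by
              rw [← integral_const_mul]
              simp [Ψ]
          _ ≤ (R * (chordLen Ω e x)⁻¹) * (2 * C) := by
              have : ‖w x‖ ≤ R * (chordLen Ω e x)⁻¹ := by
                simp only [w]
                rw [norm_mul, Real.norm_eq_abs, Real.norm_of_nonneg (inv_nonneg.2 hl.le)]
                gcongr
              have h0 : 0 ≤ ∫ y, ‖gInt f Ω e x y‖ ∂μ := integral_nonneg fun _ => norm_nonneg _
              refine mul_le_mul this h3 h0 ((norm_nonneg _).trans this)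
          _ = _ := by ring
  have hΨ0 : ∫ p, Ψ p ∂(μ.prod μ) = 0 := by
    rw [integral_prod _ hΨi]
    refine integral_eq_zero_of_ae ?_
    filter_upwards [haeΩ] with x hx
    simp only [Ψ, Pi.zero_apply]
    rw [integral_const_mul, (hG x hx).2.1, mul_zero]
  have hΨs : Integrable (fun p => Ψ p.swap) (μ.prod μ) := hΨi.swap
  have hΨs0 : ∫ p, Ψ p.swap ∂(μ.prod μ) = 0 := by
    rw [integral_prod_swap, hΨ0]
  have haeP : ∀ᵐ p ∂(μ.prod μ), p.1 ∈ Ω ∧ p.2 ∈ Ω := by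
    have : μ.prod μ = (volume.prod volume).restrict (Ω ×ˢ Ω) := Measure.prod_restrict Ω Ω
    rw [this]
    exact ae_restrict_mem (ho.measurableSet.prod ho.measurableSet)
  have hsign : ∀ᵐ p ∂(μ.prod μ), Ψ p + Ψ p.swap ≤ 0 ∧
      (Ψ p + Ψ p.swap = 0 → chordMid Ω e p.1 = chordMid Ω e p.2) := by
    filter_upwards [haeP, perp_ae (Ω := Ω) hn he] with p hp hr
    obtain ⟨x, z⟩ := p
    obtain ⟨hx, hz⟩ := hp
    simp only at hx hz hr
    have hr' : 0 < perpSq e (z - x) := by rw [← neg_sub, perpSq_neg]; exact hr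
    have g1 := gInt_eq (x := x) hfc ho hb he hz hr
    have g2 := gInt_eq (x := z) hfc ho hb he hx hr'
    have hrr : perpSq e (z - x) = perpSq e (x - z) := by rw [← neg_sub, perpSq_neg]
    have hk := lineKer_cont hfc hr
    rw [hrr, inter4_swap hk (lineKer_even f _)] at g2
    have hlx := chordLen_pos ho hb he hx
    have hlz := chordLen_pos ho hb he hz
    have hxx : chordA Ω e x < chordB Ω e x := by
      unfold chordLen at hlx; unfold chordA chordB; linarith
    have hzz : chordA Ω e z < chordB Ω e z := by
      unfold chordLen at hlz; unfold chordA chordB; linarith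
    set q := inter4 (lineKer f (perpSq e (x - z))) (chordA Ω e x) (chordB Ω e x)
        (chordA Ω e z) (chordB Ω e z) with hq
    have hsum : Ψ (x, z) + Ψ (z, x) = ((chordLen Ω e x)⁻¹ * (chordLen Ω e z)⁻¹) *
        ((chordMid Ω e x - chordMid Ω e z) * q) := by
      simp only [Ψ, w, g1, g2]; ring
    have hpos : 0 < (chordLen Ω e x)⁻¹ * (chordLen Ω e z)⁻¹ := by positivity
    have hneg : chordMid Ω e x ≠ chordMid Ω e z → (chordMid Ω e x - chordMid Ω e z) * q < 0 := by
      intro hne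
      refine inter4_sign hk (lineKer_even f _) (lineKer_dec hanti hr) hxx hzz ?_
      intro h
      apply hne
      unfold chordMid
      rw [h]
    simp only [Prod.swap_prod_mk]
    rw [hsum]
    by_cases hm : chordMid Ω e x = chordMid Ω e z
    · simp [hm]
    · have h1 := mul_neg_of_pos_of_neg hpos (hneg hm)
      exact ⟨h1.le, fun h => absurd h h1.ne⟩
  have hae0 : ∀ᵐ p ∂(μ.prod μ), Ψ p + Ψ p.swap = 0 := by
    have hi : Integrable (fun p => -(Ψ p + Ψ p.swap)) (μ.prod μ) := (hΨi.add hΨs).neg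
    have h0 : ∫ p, -(Ψ p + Ψ p.swap) ∂(μ.prod μ) = 0 := by
      rw [integral_neg, integral_add hΨi hΨs, hΨ0, hΨs0]; simp
    have := (integral_eq_zero_iff_of_nonneg_ae (by
      filter_upwards [hsign] with p hp
      simp only [Pi.zero_apply]
      linarith [hp.1]) hi).1 h0
    filter_upwards [this] with p hp
    simp only [Pi.zero_apply] at hp
    linarith
  have hfinal : ∀ᵐ p ∂(μ.prod μ), chordMid Ω e p.1 = chordMid Ω e p.2 := by
    filter_upwards [hsign, hae0] with p h1 h2 using h1.2 h2
  have h2 := Measure.ae_ae_of_ae_prod hfinal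
  have hμ0 : μ ≠ 0 := by
    rw [hμ, ne_eq, Measure.restrict_eq_zero]
    exact (ho.measure_pos volume hne).ne'
  have : (ae μ).NeBot := ae_neBot.2 hμ0
  obtain ⟨x, hx⟩ := h2.exists
  exact ⟨chordMid Ω e x, by filter_upwards [hx] with z hz using hz.symm⟩

end main
end


noncomputable section
section final
variable {n : ℕ} {Ω : Set (EuclideanSpace ℝ (Fin n))} {e x : EuclideanSpace ℝ (Fin n)}

theorem avg_inner (ho : IsOpen Ω) (hb : Bornology.IsBounded Ω) (he : ‖e‖ = 1)
    {z : EuclideanSpace ℝ (Fin n)} (hz : z ∈ Ω) :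
    ∫ s, avgFun Ω e (fun w => ⟪w, e⟫) (s, z) = chordMid Ω e z := by
  have hpos := chordLen_pos ho hb he hz
  have h2 : ∀ s, avgFun Ω e (fun w => ⟪w, e⟫) (s, z)
      = (Set.Ioo (-exitT Ω (-e) z) (exitT Ω e z)).indicator (fun s => (chordLen Ω e z)⁻¹ *
        (⟪z, e⟫ + s)) s := by
    intro s
    have h1 : ⟪z + s • e, e⟫ = ⟪z, e⟫ + s := by
      rw [inner_add_left, real_inner_smul_left, real_inner_self_eq_norm_sq, he]; ring
    simp only [avgFun, Set.indicator, chordSet, Set.mem_ofPred_eq, hz, true_and, Set.mem_Ioo, h1]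
  have hle : -exitT Ω (-e) z ≤ exitT Ω e z := by
    unfold chordLen at hpos
    linarith
  simp_rw [h2]
  rw [integral_indicator measurableSet_Ioo, integral_const_mul, ← integral_Ioc_eq_integral_Ioo,
    ← intervalIntegral.integral_of_le hle, intervalIntegral.integral_add (by simp) (by simp),
    intervalIntegral.integral_const, integral_id, inv_mul_eq_iff_eq_mul₀ hpos.ne']
  simp only [chordLen, chordMid, chordA, chordB, smul_eq_mul]
  ring

theorem center_eq (ho : IsOpen Ω) (hb : Bornology.IsBounded Ω) (he : ‖e‖ = 1) {l : ℝ}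
    (hl : ∀ᵐ z ∂(volume.restrict Ω), chordMid Ω e z = l) :
    ∫ z in Ω, ⟪z, e⟫ = volume.real Ω * l := by
  have hcont : Continuous fun w : EuclideanSpace ℝ (Fin n) => ⟪w, e⟫ := by fun_prop
  have hIntg : IntegrableOn (fun w : EuclideanSpace ℝ (Fin n) => ⟪w, e⟫) Ω :=
    (hcont.continuousOn.integrableOn_compact hb.isCompact_closure).mono_set subset_closure
  obtain ⟨a1, a2⟩ := avg_integral ho hb he hcont.measurable hIntg
  have hzero : ∀ z, z ∉ Ω → ∫ s, avgFun Ω e (fun w => ⟪w, e⟫) (s, z) = 0 := by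
    intro z hz
    have : ∀ s, avgFun Ω e (fun w => ⟪w, e⟫) (s, z) = 0 := fun s => by
      simp [avgFun, Set.indicator, chordSet, hz]
    simp [this]
  rw [← a2, integral_prod_symm _ a1, ← setIntegral_eq_integral_of_forall_compl_eq_zero hzero]
  have : ∀ᵐ z ∂(volume.restrict Ω), ∫ s, avgFun Ω e (fun w => ⟪w, e⟫) (s, z) = l := by
    filter_upwards [hl, ae_restrict_mem ho.measurableSet] with z h1 h2
    rw [avg_inner ho hb he h2, h1]
  rw [integral_congr_ae this, setIntegral_const, smul_eq_mul]

theorem geom_step (ho : IsOpen Ω) (hb : Bornology.IsBounded Ω) {z0 : EuclideanSpace ℝ (Fin n)}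
    (hmid : ∀ e : EuclideanSpace ℝ (Fin n), ‖e‖ = 1 →
      ∀ᵐ w ∂(volume.restrict Ω), chordMid Ω e w = ⟪z0, e⟫)
    {y : EuclideanSpace ℝ (Fin n)} (hx : x ∈ Ω) (hy : ‖y - z0‖ < ‖x - z0‖) : y ∈ closure Ω := by
  have hxy : x - y ≠ 0 := by
    intro h
    rw [sub_eq_zero] at h
    rw [h] at hy
    exact lt_irrefl _ hy
  have hpos : 0 < ‖x - y‖ := norm_pos_iff.2 hxy
  set e := (‖x - y‖)⁻¹ • (x - y) with hedef
  have he : ‖e‖ = 1 := by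
    rw [hedef, norm_smul, norm_inv, norm_norm, inv_mul_cancel₀ hpos.ne']
  have hre : ‖x - y‖ • e = x - y := by
    rw [hedef, smul_smul, mul_inv_cancel₀ hpos.ne', one_smul]
  have hx2 : ‖x - y‖ < 2 * ⟪x - z0, e⟫ := by
    have h1 : ⟪x - z0, x - y⟫ = ‖x - y‖ * ⟪x - z0, e⟫ := by
      rw [← real_inner_smul_right, hre]
    have h2 : ‖y - z0‖ ^ 2 = ‖x - z0‖ ^ 2 - 2 * ⟪x - z0, x - y⟫ + ‖x - y‖ ^ 2 := by
      rw [← norm_sub_sq_real]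
      congr 2
      abel
    have h3 : ‖y - z0‖ ^ 2 < ‖x - z0‖ ^ 2 := by gcongr
    have h4 : ‖x - y‖ * ‖x - y‖ < ‖x - y‖ * (2 * ⟪x - z0, e⟫) := by
      rw [h1] at h2; nlinarith
    exact lt_of_mul_lt_mul_left h4 hpos.le
  rw [Metric.mem_closure_iff]
  intro ε hε
  set W := Ω ∩ (ball x ε ∩ {w | ‖x - y‖ < 2 * ⟪w - z0, e⟫}) with hW
  have hWo : IsOpen W := ho.inter (isOpen_ball.inter (isOpen_lt (by fun_prop) (by fun_prop)))
  have hWne : W.Nonempty := ⟨x, hx, mem_ball_self hε, hx2⟩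
  have hae := ae_restrict_of_ae_restrict_of_subset (Set.inter_subset_left : W ⊆ Ω) (hmid e he)
  have hμ0 : (volume : Measure (EuclideanSpace ℝ (Fin n))).restrict W ≠ 0 := by
    rw [ne_eq, Measure.restrict_eq_zero]
    exact (hWo.measure_pos volume hWne).ne'
  have : (ae ((volume : Measure (EuclideanSpace ℝ (Fin n))).restrict W)).NeBot := ae_neBot.2 hμ0
  obtain ⟨w, h1, hwΩ, hwb, hw2⟩ := (hae.and (ae_restrict_mem hWo.measurableSet)).exists
  have hβ := exitT_pos ho hb he hwΩ
  have hlt : ‖x - y‖ < exitT Ω (-e) w := by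
    simp only [chordMid, chordA, chordB] at h1
    have hw3 : ‖x - y‖ < 2 * ⟪w - z0, e⟫ := hw2
    rw [inner_sub_left] at hw3
    linarith
  refine ⟨w + ‖x - y‖ • (-e), mem_of_lt_exitT hpos.le hlt, ?_⟩
  rw [smul_neg, hre, dist_eq_norm]
  have : y - (w + -(x - y)) = x - w := by abel
  rw [this, ← dist_eq_norm, dist_comm]
  exact hwb

theorem is_ball (hn : 2 ≤ n) (hne : Ω.Nonempty) (ho : IsOpen Ω) (hb : Bornology.IsBounded Ω)
    (hbdry : ∀ p ∈ frontier Ω, ∃ U : Set (EuclideanSpace ℝ (Fin n)), IsOpen U ∧ p ∈ U ∧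
      ∃ φ : EuclideanSpace ℝ (Fin n) → ℝ, ContDiffOn ℝ 1 φ U ∧
        (∀ x ∈ U, gradient φ x ≠ 0) ∧ Ω ∩ U = {x ∈ U | φ x < 0})
    {z0 : EuclideanSpace ℝ (Fin n)}
    (hstep : ∀ x ∈ Ω, ∀ y, ‖y - z0‖ < ‖x - z0‖ → y ∈ closure Ω) :
    ∃ (z : EuclideanSpace ℝ (Fin n)) (R : ℝ), 0 < R ∧ Ω = ball z R := by
  -- moving outward
  have hout : ∀ x ∈ Ω, ∃ y ∈ Ω, ‖x - z0‖ < ‖y - z0‖ := by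
    intro x hx
    obtain ⟨ε, hε, hball⟩ := Metric.isOpen_iff.1 ho x hx
    by_cases h : x - z0 = 0
    · have : Nontrivial (EuclideanSpace ℝ (Fin n)) := by
        have : Nonempty (Fin n) := ⟨⟨0, by omega⟩⟩
        infer_instance
      obtain ⟨v, hv⟩ := exists_norm_eq (EuclideanSpace ℝ (Fin n)) (half_pos hε).le
      refine ⟨x + v, hball ?_, ?_⟩
      · rw [mem_ball, dist_eq_norm, add_sub_cancel_left, hv]; linarith
      · rw [add_sub_right_comm, h, zero_add, hv, norm_zero]; linarith
    · have hp : 0 < ‖x - z0‖ := norm_pos_iff.2 h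
      set t := ε / 2 / ‖x - z0‖ with ht
      have htp : 0 < t := by positivity
      refine ⟨x + t • (x - z0), hball ?_, ?_⟩
      · rw [mem_ball, dist_eq_norm, add_sub_cancel_left, norm_smul, Real.norm_of_nonneg htp.le, ht,
          div_mul_cancel₀ _ hp.ne']
        linarith
      · have : x + t • (x - z0) - z0 = (1 + t) • (x - z0) := by module
        rw [this, norm_smul, Real.norm_of_nonneg (by positivity)]
        nlinarith
  obtain ⟨R0, hR0⟩ := hb.exists_norm_le
  set S := Set.image (fun x => ‖x - z0‖) Ω with hS
  have hSne : S.Nonempty := hne.image _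
  have hSb : BddAbove S := by
    refine ⟨R0 + ‖z0‖, ?_⟩
    rintro _ ⟨x, hx, rfl⟩
    exact (norm_sub_le _ _).trans (by linarith [hR0 x hx])
  have hlt : ∀ x ∈ Ω, ‖x - z0‖ < sSup S := by
    intro x hx
    obtain ⟨y, hy, hxy⟩ := hout x hx
    exact hxy.trans_le (le_csSup hSb ⟨y, hy, rfl⟩)
  have hcl : ball z0 (sSup S) ⊆ closure Ω := by
    intro y hy
    rw [mem_ball, dist_eq_norm] at hy
    obtain ⟨_, ⟨x, hx, rfl⟩, h⟩ := exists_lt_of_lt_csSup hSne hy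
    exact hstep x hx y h
  refine ⟨z0, sSup S, ?_, ?_⟩
  · obtain ⟨x, hx⟩ := hne
    exact (norm_nonneg _).trans_lt (hlt x hx)
  apply Set.Subset.antisymm
  · intro x hx
    rw [mem_ball, dist_eq_norm]
    exact hlt x hx
  · intro p hp
    by_contra hpΩ
    have hpf : p ∈ frontier Ω := by
      rw [ho.frontier_eq]; exact ⟨hcl hp, hpΩ⟩
    obtain ⟨U, hU, hpU, φ, hφ, hgrad, heq⟩ := hbdry p hpf
    -- the set where φ is positive near p is empty
    have hle : ∀ q ∈ U ∩ ball z0 (sSup S), φ q ≤ 0 := by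
      rintro q ⟨hqU, hqb⟩
      by_contra hq
      push Not at hq
      have hcont : ContinuousAt φ q := hφ.continuousOn.continuousAt (hU.mem_nhds hqU)
      have hnear : ∀ᶠ y in nhds q, 0 < φ y ∧ y ∈ U :=
        (hcont.eventually (lt_mem_nhds hq)).and (hU.mem_nhds hqU)
      obtain ⟨y, hyΩ, hy0, hyU⟩ :=
        (mem_closure_iff_frequently.1 (hcl hqb)).and_eventually hnear |>.exists
      have : y ∈ {x ∈ U | φ x < 0} := by rw [← heq]; exact ⟨hyΩ, hyU⟩
      exact lt_asymm hy0 this.2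
    have hφp : 0 ≤ φ p := by
      by_contra h
      push Not at h
      have : p ∈ Ω ∩ U := by rw [heq]; exact ⟨hpU, h⟩
      exact hpΩ this.1
    have hmax : IsLocalMax φ p := by
      filter_upwards [hU.mem_nhds hpU, isOpen_ball.mem_nhds hp] with q h1 h2
      exact (hle q ⟨h1, h2⟩).trans hφp
    apply hgrad p hpU
    unfold gradient
    rw [hmax.fderiv_eq_zero, map_zero]

theorem ball_anti (hn : 2 ≤ n) {f : ℝ → ℝ} (hfm : Measurable f)
    (hfc : ContinuousOn f (Set.Ioi 0)) (hanti : StrictAntiOn f (Set.Ioi 0))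
    (hloc : LocallyIntegrable (fun x : EuclideanSpace ℝ (Fin n) => f ‖x‖) volume)
    (hne : Ω.Nonempty) (hb : Bornology.IsBounded Ω) (ho : IsOpen Ω)
    (hbdry : ∀ p ∈ frontier Ω, ∃ U : Set (EuclideanSpace ℝ (Fin n)), IsOpen U ∧ p ∈ U ∧
      ∃ φ : EuclideanSpace ℝ (Fin n) → ℝ, ContDiffOn ℝ 1 φ U ∧
        (∀ x ∈ U, gradient φ x ≠ 0) ∧ Ω ∩ U = {x ∈ U | φ x < 0})
    (c : ℝ) (hc : ∀ x ∈ frontier Ω, (∫ y in Ω, f ‖x - y‖) = c) :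
    ∃ (z : EuclideanSpace ℝ (Fin n)) (R : ℝ), 0 < R ∧ Ω = ball z R := by
  have hvol : 0 < volume.real Ω :=
    ENNReal.toReal_pos (ho.measure_pos volume hne).ne' hb.measure_lt_top.ne
  set z0 : EuclideanSpace ℝ (Fin n) := (volume.real Ω)⁻¹ • ∫ z in Ω, z with hz0
  have hIntg : IntegrableOn (fun w : EuclideanSpace ℝ (Fin n) => w) Ω :=
    (continuous_id.continuousOn.integrableOn_compact hb.isCompact_closure).mono_set subset_closure
  refine is_ball hn hne ho hb hbdry (z0 := z0) fun x hx y hy => geom_step ho hb ?_ hx hy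
  intro e he
  obtain ⟨l, hl⟩ := mid_ae_const hn hfm hfc hanti hloc hne hb ho hbdry c hc he
  have h1 := center_eq ho hb he hl
  have h2 : ⟪z0, e⟫ = l := by
    have h3 : ∫ z in Ω, ⟪z, e⟫ = ⟪∫ z in Ω, z, e⟫ := by
      rw [real_inner_comm, ← integral_inner hIntg e]
      simp_rw [real_inner_comm]
    rw [hz0, real_inner_smul_left, ← h3, h1, inv_mul_cancel_left₀ hvol.ne']
  rw [h2]
  exact hl

theorem ball_main (hn : 2 ≤ n) {f : ℝ → ℝ}
    (hfc : ContinuousOn f (Set.Ioi 0)) (hanti : StrictAntiOn f (Set.Ioi 0))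
    (hloc : LocallyIntegrable (fun x : EuclideanSpace ℝ (Fin n) => f ‖x‖) volume)
    (hne : Ω.Nonempty) (hb : Bornology.IsBounded Ω) (ho : IsOpen Ω)
    (hbdry : ∀ p ∈ frontier Ω, ∃ U : Set (EuclideanSpace ℝ (Fin n)), IsOpen U ∧ p ∈ U ∧
      ∃ φ : EuclideanSpace ℝ (Fin n) → ℝ, ContDiffOn ℝ 1 φ U ∧
        (∀ x ∈ U, gradient φ x ≠ 0) ∧ Ω ∩ U = {x ∈ U | φ x < 0})
    (c : ℝ) (hc : ∀ x ∈ frontier Ω, (∫ y in Ω, f ‖x - y‖) = c) :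
    ∃ (z : EuclideanSpace ℝ (Fin n)) (R : ℝ), 0 < R ∧ Ω = ball z R := by
  have : Nonempty (Fin n) := ⟨⟨0, by omega⟩⟩
  set g := (Set.Ioi (0 : ℝ)).indicator f with hg
  have hgf : ∀ t, 0 < t → g t = f t := fun t ht => Set.indicator_of_mem ht f
  have hgm : Measurable g := by
    classical
    rw [hg, ← Set.piecewise_eq_indicator]
    exact hfc.measurable_piecewise continuousOn_const measurableSet_Ioi
  refine ball_anti hn hgm (hfc.congr fun t ht => hgf t ht) ?_ ?_ hne hb ho hbdry c ?_
  · intro a ha b hb' hab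
    rw [hgf a ha, hgf b hb']
    exact hanti ha hb' hab
  · have hae : (fun x : EuclideanSpace ℝ (Fin n) => f ‖x‖) =ᵐ[volume] fun x => g ‖x‖ := by
      filter_upwards [compl_mem_ae_iff.2 (measure_singleton (0 : EuclideanSpace ℝ (Fin n)))] with x hx
      exact (hgf _ (norm_pos_iff.2 hx)).symm
    intro x
    obtain ⟨s, hs, hi⟩ := hloc x
    exact ⟨s, hs, hi.congr (ae_restrict_of_ae hae)⟩
  · intro x hx
    rw [← hc x hx]
    refine integral_congr_ae (ae_restrict_of_ae ?_)
    filter_upwards [compl_mem_ae_iff.2 (measure_singleton x)] with y hy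
    refine hgf _ (norm_pos_iff.2 (sub_ne_zero.2 ?_))
    exact fun h => hy h.symm

end final
end

theorem stmt_0 {n : ℕ} (hn : 2 ≤ n) (f : ℝ → ℝ)
    (hf1 : ContDiffOn ℝ 1 f (Set.Ioi 0))
    (hmono : StrictMonoOn f (Set.Ioi 0) ∨ StrictAntiOn f (Set.Ioi 0))
    (hloc : LocallyIntegrable (fun x : EuclideanSpace ℝ (Fin n) => f ‖x‖) volume)
    (Ω : Set (EuclideanSpace ℝ (Fin n))) (hne : Ω.Nonempty)
    (hbdd : Bornology.IsBounded Ω) (hopen : IsOpen Ω)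
    (hbdry : ∀ p ∈ frontier Ω, ∃ U : Set (EuclideanSpace ℝ (Fin n)), IsOpen U ∧ p ∈ U ∧
      ∃ φ : EuclideanSpace ℝ (Fin n) → ℝ, ContDiffOn ℝ 1 φ U ∧
        (∀ x ∈ U, gradient φ x ≠ 0) ∧ Ω ∩ U = {x ∈ U | φ x < 0})
    (c : ℝ) (hc : ∀ x ∈ frontier Ω, (∫ y in Ω, f ‖x - y‖) = c) :
    ∃ (z : EuclideanSpace ℝ (Fin n)) (R : ℝ), 0 < R ∧ Ω = ball z R := by
  rcases hmono with h | h
  · refine ball_main hn (f := fun t => -f t) hf1.continuousOn.neg ?_ hloc.neg hne hbdd hopen hbdry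
      (-c) ?_
    · intro a ha b hb hab
      exact neg_lt_neg (h ha hb hab)
    · intro x hx
      rw [integral_neg, hc x hx]
  · exact ball_main hn hf1.continuousOn h hloc hne hbdd hopen hbdry c hc
end

section
/- Let n ≥ 2, let B = {x ∈ ℝⁿ : ‖x‖ < R} be the open ball of radius R > 0 centered at 0, and let V : ℝⁿ → ℝⁿ be a C¹ vector field admitting a global flow T; write B_t = T(t,·)(B). Suppose that the point 0 is the mass center of B_t for all t in some neighborhood of 0, i.e. ∫_{B_t} x_i dx = 0 for every coordinate i = 1,…,n and all such t, and suppose the function v(x) = ⟨V(x), x⟩ restricted to the sphere ∂B = {x : ‖x‖ = R} is a first-order spherical harmonic, i.e. there exists b ∈ ℝⁿ with ⟨V(x), x⟩ = ⟨b, x⟩ for all x ∈ ∂B. Then v = 0 on ∂B, i.e. ⟨V(x), x⟩ = 0 for all x with ‖x‖ = R. -/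
open MeasureTheory Metric
open scoped RealInnerProductSpace

/-- `g` is a positive definite radial kernel: continuous, depends only on the norm, and
for every smooth compactly supported complex test function `μ` the integral
`∬ g(x−y) μ(x) conj(μ(y))` is real and nonnegative. -/
def IsPosDefRadialKernel {n : ℕ} (g : EuclideanSpace ℝ (Fin n) → ℝ) : Prop :=
  Continuous g ∧
  (∀ x y, ‖x‖ = ‖y‖ → g x = g y) ∧
  ∀ μ : EuclideanSpace ℝ (Fin n) → ℂ, ContDiff ℝ (⊤ : ℕ∞) μ → HasCompactSupport μ →
    (∫ x, ∫ y, (g (x - y) : ℂ) * μ x * (starRingEnd ℂ) (μ y)).im = 0 ∧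
    0 ≤ (∫ x, ∫ y, (g (x - y) : ℂ) * μ x * (starRingEnd ℂ) (μ y)).re

/-- `T` is a global flow of the vector field `V`. -/
def IsGlobalFlow {n : ℕ} (V : EuclideanSpace ℝ (Fin n) → EuclideanSpace ℝ (Fin n))
    (T : ℝ → EuclideanSpace ℝ (Fin n) → EuclideanSpace ℝ (Fin n)) : Prop :=
  (∀ x, T 0 x = x) ∧ ∀ t x, HasDerivAt (fun s => T s x) (V (T t x)) t

lemma flow_rev {n : ℕ} {V : EuclideanSpace ℝ (Fin n) → EuclideanSpace ℝ (Fin n)}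
    {T : ℝ → EuclideanSpace ℝ (Fin n) → EuclideanSpace ℝ (Fin n)} (hT : IsGlobalFlow V T) :
    IsGlobalFlow (fun x => - V x) (fun t => T (-t)) := by
  refine ⟨fun x => by simp [hT.1], fun t x => ?_⟩
  have h := (hT.2 (-t) x).scomp t (hasDerivAt_neg t)
  simpa [Function.comp_def] using h

lemma lip_ball {n : ℕ} {V : EuclideanSpace ℝ (Fin n) → EuclideanSpace ℝ (Fin n)}
    (hV : ContDiff ℝ 1 V) (r : ℝ) :
    ∃ K, LipschitzOnWith K V (closedBall 0 r) :=
  hV.locallyLipschitz.locallyLipschitzOn.exists_lipschitzOnWith_of_compact (isCompact_closedBall 0 r)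

lemma flow_inv {n : ℕ} {V : EuclideanSpace ℝ (Fin n) → EuclideanSpace ℝ (Fin n)}
    {T : ℝ → EuclideanSpace ℝ (Fin n) → EuclideanSpace ℝ (Fin n)} (hV : ContDiff ℝ 1 V)
    (hT : IsGlobalFlow V T) {a : ℝ} (ha : 0 ≤ a) (x : EuclideanSpace ℝ (Fin n)) :
    T a (T (-a) x) = x := by
  have hf : ∀ t, HasDerivAt (fun s => T s (T (-a) x)) (V (T t (T (-a) x))) t := fun t => hT.2 t _
  have hg : ∀ t, HasDerivAt (fun s => T (s - a) x) (V (T (t - a) x)) t := fun t =>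
    (hT.2 (t - a) x).comp_sub_const t a
  have hfc : Continuous (fun s => T s (T (-a) x)) :=
    continuous_iff_continuousAt.2 fun t => (hf t).continuousAt
  have hgc : Continuous (fun s => T (s - a) x) :=
    continuous_iff_continuousAt.2 fun t => (hg t).continuousAt
  obtain ⟨r1, h1⟩ := (isCompact_Icc (a := (0:ℝ)) (b := a)).exists_bound_of_continuousOn
    hfc.continuousOn
  obtain ⟨r2, h2⟩ := (isCompact_Icc (a := (0:ℝ)) (b := a)).exists_bound_of_continuousOn
    hgc.continuousOn
  obtain ⟨K, hK⟩ := lip_ball hV (max r1 r2)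
  have := dist_le_of_trajectories_ODE_of_mem (v := fun _ => V) (s := fun _ => closedBall 0 (max r1 r2))
    (K := K) (a := 0) (b := a) (δ := 0) (fun t _ => hK) hfc.continuousOn
    (fun t _ => (hf t).hasDerivWithinAt)
    (fun t ht => by
      simpa using Or.inl (h1 t (Set.Ico_subset_Icc_self ht))) hgc.continuousOn
    (fun t _ => (hg t).hasDerivWithinAt)
    (fun t ht => by
      simpa using Or.inr (h2 t (Set.Ico_subset_Icc_self ht)))
    (by simp [hT.1]) a ⟨ha, le_rfl⟩
  simpa [hT.1] using this

lemma flow_stay {n : ℕ} {V : EuclideanSpace ℝ (Fin n) → EuclideanSpace ℝ (Fin n)}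
    {T : ℝ → EuclideanSpace ℝ (Fin n) → EuclideanSpace ℝ (Fin n)}
    (hT : IsGlobalFlow V T) {R M t : ℝ} (hM : ∀ y, ‖y‖ ≤ 3 * R → ‖V y‖ < M) (hM0 : 0 < M)
    (htR : M * t ≤ R) {x : EuclideanSpace ℝ (Fin n)} (hx : ‖x‖ ≤ 2 * R) {s : ℝ}
    (hs : s ∈ Set.Icc 0 t) : ‖T s x - x‖ ≤ M * s := by
  have hd : ∀ s, HasDerivAt (fun s => T s x - x) (V (T s x)) s := fun s => (hT.2 s x).sub_const x
  refine image_norm_le_of_norm_deriv_right_lt_deriv_boundary (a := 0) (b := t)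
    (f := fun s => T s x - x) (f' := fun s => V (T s x)) (B := fun s => M * s) (B' := fun _ => M)
    (fun s _ => (hd s).continuousAt.continuousWithinAt) (fun s _ => (hd s).hasDerivWithinAt)
    (by simp [hT.1]) (fun s => by simpa using (hasDerivAt_id s).const_mul M) ?_ hs
  intro s hs h
  apply hM
  have h1 : ‖T s x‖ ≤ ‖T s x - x‖ + ‖x‖ := by simpa using norm_add_le (T s x - x) x
  have h2 : M * s ≤ M * t := by gcongr; exact hs.2.le
  linarith

lemma flow_lip {n : ℕ} {V : EuclideanSpace ℝ (Fin n) → EuclideanSpace ℝ (Fin n)}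
    {T : ℝ → EuclideanSpace ℝ (Fin n) → EuclideanSpace ℝ (Fin n)} (hV : ContDiff ℝ 1 V)
    (hT : IsGlobalFlow V T) {R M t : ℝ} (hM : ∀ y, ‖y‖ ≤ 3 * R → ‖V y‖ < M) (hM0 : 0 < M)
    (ht0 : 0 ≤ t) (htR : M * t ≤ R) :
    ContinuousOn (T t) (closedBall 0 (2 * R)) := by
  obtain ⟨K, hK⟩ := lip_ball hV (3 * R)
  have hmem : ∀ x ∈ closedBall (0 : EuclideanSpace ℝ (Fin n)) (2 * R), ∀ s ∈ Set.Ico 0 t,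
      T s x ∈ closedBall (0 : EuclideanSpace ℝ (Fin n)) (3 * R) := by
    intro x hx s hs
    simp only [mem_closedBall, dist_zero_right] at hx ⊢
    have h := flow_stay hT hM hM0 htR hx (Set.Ico_subset_Icc_self hs)
    have h1 : ‖T s x‖ ≤ ‖T s x - x‖ + ‖x‖ := by simpa using norm_add_le (T s x - x) x
    have h2 : M * s ≤ M * t := by gcongr; exact hs.2.le
    linarith
  have : LipschitzOnWith (Real.toNNReal (Real.exp (K * t))) (T t) (closedBall 0 (2 * R)) := by
    refine LipschitzOnWith.of_dist_le_mul fun x hx y hy => ?_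
    have := dist_le_of_trajectories_ODE_of_mem (v := fun _ => V)
      (s := fun _ => closedBall 0 (3 * R)) (f := fun s => T s x) (g := fun s => T s y)
      (K := K) (a := 0) (b := t) (δ := dist x y) (fun t _ => hK)
      (fun s _ => (hT.2 s x).continuousAt.continuousWithinAt)
      (fun s _ => (hT.2 s x).hasDerivWithinAt) (hmem x hx)
      (fun s _ => (hT.2 s y).continuousAt.continuousWithinAt)
      (fun s _ => (hT.2 s y).hasDerivWithinAt) (hmem y hy)
      (by simp [hT.1]) t ⟨ht0, le_rfl⟩
    rw [Real.coe_toNNReal _ (Real.exp_pos _).le, mul_comm]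
    simpa using this
  exact this.continuousOn

/-- first order expansion; here `T` is the flow of `V` -/
lemma flow_exp {n : ℕ} {V : EuclideanSpace ℝ (Fin n) → EuclideanSpace ℝ (Fin n)}
    {T : ℝ → EuclideanSpace ℝ (Fin n) → EuclideanSpace ℝ (Fin n)} (hV : Continuous V)
    (hT : IsGlobalFlow V T) {R M : ℝ} (hR : 0 < R)
    (hM : ∀ y, ‖y‖ ≤ 3 * R → ‖V y‖ < M) (hM0 : 0 < M) (b : EuclideanSpace ℝ (Fin n))
    (hb : ∀ x ∈ sphere (0 : EuclideanSpace ℝ (Fin n)) R, ⟪V x, x⟫ = ⟪b, x⟫) {η : ℝ} (hη : 0 < η) :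
    ∃ δ > 0, ∃ t0 > 0, ∀ t, 0 ≤ t → t ≤ t0 → ∀ x, |‖x‖ - R| ≤ δ →
      |‖T t x‖ ^ 2 - ‖x‖ ^ 2 - 2 * t * ⟪b, x⟫| ≤ 2 * η * t := by
  have hopen : IsOpen {y | |⟪V y, y⟫ - ⟪b, y⟫| < η / 2} :=
    isOpen_lt (by fun_prop) continuous_const
  obtain ⟨d, hd, hsub⟩ := (isCompact_sphere (0 : EuclideanSpace ℝ (Fin n)) R
    ).exists_thickening_subset_open hopen (by
      intro y hy
      simp only [Set.mem_ofPred_eq, hb y hy, sub_self, abs_zero]; positivity)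
  have hshell : ∀ y : EuclideanSpace ℝ (Fin n), y ≠ 0 → |‖y‖ - R| < d →
      |⟪V y, y⟫ - ⟪b, y⟫| < η / 2 := by
    intro y hy0 hy
    refine hsub (mem_thickening_iff.2 ⟨(R / ‖y‖) • y, ?_, ?_⟩)
    · simp [norm_smul, abs_of_pos hR, hy0]
    · have hn : 0 < ‖y‖ := norm_pos_iff.2 hy0
      have : y - (R / ‖y‖) • y = ((‖y‖ - R) / ‖y‖) • y := by
        rw [sub_div, sub_smul, div_self hn.ne', one_smul]
      rw [dist_eq_norm, this, norm_smul, norm_div, norm_norm, div_mul_cancel₀ _ hn.ne']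
      exact hy
  refine ⟨min (d / 3) (R / 3), by positivity,
    min (min (d / 3) (R / 3) / M) (η / (2 * (‖b‖ + 1) * M)), by positivity, ?_⟩
  intro t ht ht0 x hx
  have hx1 := hx.trans (min_le_left _ _)
  have hx2 := hx.trans (min_le_right _ _)
  have ht1 : M * t ≤ min (d / 3) (R / 3) := by
    have := ht0.trans (min_le_left _ _)
    rw [le_div_iff₀ hM0] at this; linarith
  have ht2 : (‖b‖ + 1) * (M * t) ≤ η / 2 := by
    have := ht0.trans (min_le_right _ _)
    rw [le_div_iff₀ (by positivity)] at this; linarith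
  have ht3 := ht1.trans (min_le_left _ _)
  have ht4 := ht1.trans (min_le_right _ _)
  rw [abs_le] at hx1 hx2
  have key : ∀ s ∈ Set.Icc 0 t, |⟪V (T s x), T s x⟫ - ⟪b, x⟫| ≤ η := by
    intro s hs
    have h := flow_stay hT hM hM0 (by linarith : M * t ≤ R) (by linarith : ‖x‖ ≤ 2 * R) hs
    have h2 : M * s ≤ M * t := by gcongr; exact hs.2
    have h3 := (abs_norm_sub_norm_le (T s x) x).trans (h.trans h2)
    rw [abs_le] at h3
    have h4 := hshell (T s x) (by rw [← norm_pos_iff]; linarith) (by rw [abs_lt]; constructor <;> linarith)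
    have h5 : |⟪b, T s x - x⟫| ≤ η / 2 := by
      refine (abs_real_inner_le_norm _ _).trans (le_trans ?_ ht2)
      gcongr
      · linarith
      · exact h.trans h2
    rw [inner_sub_right] at h5
    rw [abs_le] at h5 ⊢
    rw [abs_lt] at h4
    constructor <;> linarith
  have hder : ∀ s ∈ Set.Icc 0 t, HasDerivWithinAt (fun s => ‖T s x‖ ^ 2 - 2 * s * ⟪b, x⟫)
      (2 * ⟪T s x, V (T s x)⟫ - 2 * ⟪b, x⟫) (Set.Icc 0 t) s := by
    intro s _
    have h1 := (hT.2 s x).norm_sq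
    have h2 := ((hasDerivAt_id s).const_mul 2).mul_const ⟪b, x⟫
    simp only [id, mul_one] at h2
    exact (h1.sub h2).hasDerivWithinAt
  have := (convex_Icc 0 t).norm_image_sub_le_of_norm_hasDerivWithin_le (C := 2 * η) hder (by
    intro s hs
    rw [← mul_sub, norm_mul, real_inner_comm]
    simpa using key s hs) (Set.left_mem_Icc.2 ht) (Set.right_mem_Icc.2 ht)
  simp only [hT.1, Real.norm_eq_abs, sub_zero, abs_of_nonneg ht] at this
  convert this using 2
  ring

lemma pow_sub_le (n : ℕ) (A : ℝ) (hA : 0 ≤ A) : ∃ C ≥ 0, ∀ a b : ℝ, 0 ≤ b → b ≤ a → a ≤ A →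
    a ^ n - b ^ n ≤ C * (a - b) := by
  induction n with
  | zero => exact ⟨0, le_rfl, by simp⟩
  | succ n ih =>
    obtain ⟨C, hC, h⟩ := ih
    refine ⟨A * C + A ^ n, by positivity, fun a b hb hab haA => ?_⟩
    have h1 := h a b hb hab haA
    have h2 : b ^ n ≤ A ^ n := by gcongr; linarith
    have h3 : a * (a ^ n - b ^ n) ≤ a * (C * (a - b)) :=
      mul_le_mul_of_nonneg_left h1 (by linarith)
    have h4 : a * (C * (a - b)) ≤ A * (C * (a - b)) :=
      mul_le_mul_of_nonneg_right haA (mul_nonneg hC (by linarith))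
    have h5 : b ^ n * (a - b) ≤ A ^ n * (a - b) :=
      mul_le_mul_of_nonneg_right h2 (by linarith)
    rw [pow_succ, pow_succ]
    nlinarith

lemma meas_step {n : ℕ} {R u η c : ℝ} (hη : 0 ≤ η)
    (hu : 0 ≤ u)
    (b : EuclideanSpace ℝ (Fin n)) (A P : Set (EuclideanSpace ℝ (Fin n)))
    (hA : MeasurableSet A) (hP : MeasurableSet P)
    (h0 : ∫ x in A, ⟪b, x⟫ = 0)
    (h1 : ∫ x in ball (0 : EuclideanSpace ℝ (Fin n)) R, ⟪b, x⟫ = 0)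
    (hs1 : ∀ x ∈ A, ‖x‖ ≤ R + u) (hs2 : ∀ x, ‖x‖ < R - u → x ∈ A)
    (ha1 : ∀ x ∈ A, R ≤ ‖x‖ → -η ≤ ⟪b, x⟫) (ha2 : ∀ x, x ∉ A → ‖x‖ < R → ⟪b, x⟫ ≤ η)
    (hPA : ∀ x ∈ P, x ∈ A ∧ R ≤ ‖x‖ ∧ c ≤ ⟪b, x⟫) :
    c * volume.real P ≤ η * volume.real
      (closedBall (0 : EuclideanSpace ℝ (Fin n)) (R + u) \ ball 0 (R - u)) := by
  set Q := closedBall (0 : EuclideanSpace ℝ (Fin n)) (R + u) \ ball 0 (R - u) with hQ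
  have hQm : MeasurableSet Q := measurableSet_closedBall.diff measurableSet_ball
  have hAsub : A ⊆ closedBall (0 : EuclideanSpace ℝ (Fin n)) (R + u) := fun x hx => by
    simpa using hs1 x hx
  have hint : IntegrableOn (fun x : EuclideanSpace ℝ (Fin n) => ⟪b, x⟫)
      (closedBall (0 : EuclideanSpace ℝ (Fin n)) (R + u)) volume :=
    (by fun_prop : Continuous fun x : EuclideanSpace ℝ (Fin n) => ⟪b, x⟫).continuousOn.integrableOn_compact
      (isCompact_closedBall _ _)
  have hintA := hint.mono_set hAsub
  have hintB := hint.mono_set (ball_subset_closedBall.trans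
    (closedBall_subset_closedBall (by linarith)) : ball (0 : EuclideanSpace ℝ (Fin n)) R ⊆ _)
  have hfin : volume (closedBall (0 : EuclideanSpace ℝ (Fin n)) (R + u)) ≠ ⊤ :=
    measure_closedBall_lt_top.ne
  have hPfin : volume P ≠ ⊤ :=
    measure_ne_top_of_subset (fun x hx => hAsub (hPA x hx).1) hfin
  have hQfin : volume Q ≠ ⊤ := measure_ne_top_of_subset Set.sdiff_subset hfin
  have hintP : Integrable (P.indicator fun _ => c) volume :=
    (integrable_indicator_iff hP).2 (integrableOn_const hPfin)
  have hintQ : Integrable (Q.indicator fun _ => η) volume :=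
    (integrable_indicator_iff hQm).2 (integrableOn_const hQfin)
  have hiA := (integrable_indicator_iff hA).2 hintA
  have hiB := (integrable_indicator_iff measurableSet_ball).2 hintB
  have hle := integral_mono (hintP.sub hintQ) (hiA.sub hiB) (by
    intro x
    simp only [Pi.sub_apply]
    have hQx : x ∈ Q ↔ ‖x‖ ≤ R + u ∧ R - u ≤ ‖x‖ := by simp [hQ]
    by_cases hxA : x ∈ A
    · by_cases hxB : ‖x‖ < R
      · have hxP : x ∉ P := fun h => absurd (hPA x h).2.1 (not_le.2 hxB)
        have : (0:ℝ) ≤ Q.indicator (fun _ => η) x := Set.indicator_nonneg (fun _ _ => hη) x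
        simp only [Set.indicator_of_notMem hxP, Set.indicator_of_mem hxA,
          Set.indicator_of_mem (mem_ball_zero_iff.2 hxB)]
        linarith
      · have hxQ : x ∈ Q := hQx.2 ⟨hs1 x hxA, by linarith⟩
        have hxB' : x ∉ ball (0 : EuclideanSpace ℝ (Fin n)) R := by simpa using hxB
        simp only [Set.indicator_of_mem hxQ, Set.indicator_of_mem hxA,
          Set.indicator_of_notMem hxB']
        by_cases hxP : x ∈ P
        · simp only [Set.indicator_of_mem hxP]
          linarith [(hPA x hxP).2.2]
        · simp only [Set.indicator_of_notMem hxP]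
          linarith [ha1 x hxA (not_lt.1 hxB)]
    · have hxP : x ∉ P := fun h => hxA (hPA x h).1
      simp only [Set.indicator_of_notMem hxP, Set.indicator_of_notMem hxA]
      by_cases hxB : ‖x‖ < R
      · have hxQ : x ∈ Q := hQx.2 ⟨by linarith, by
          by_contra h
          exact hxA (hs2 x (not_le.1 h))⟩
        simp only [Set.indicator_of_mem hxQ, Set.indicator_of_mem (mem_ball_zero_iff.2 hxB)]
        linarith [ha2 x hxA hxB]
      · have hxB' : x ∉ ball (0 : EuclideanSpace ℝ (Fin n)) R := by simpa using hxB
        have : (0:ℝ) ≤ Q.indicator (fun _ => η) x := Set.indicator_nonneg (fun _ _ => hη) x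
        simp only [Set.indicator_of_notMem hxB']
        linarith)
  simp only [Pi.sub_apply] at hle
  rw [integral_sub hintP hintQ, integral_sub hiA hiB, integral_indicator hA,
    integral_indicator measurableSet_ball, h0, h1, integral_indicator hP, integral_indicator hQm,
    setIntegral_const, setIntegral_const, smul_eq_mul, smul_eq_mul] at hle
  linarith

lemma vol_shell {n : ℕ} {R : ℝ} (hR : 0 < R) : ∃ C ≥ 0, ∀ u, 0 ≤ u → u < R →
    volume.real (closedBall (0 : EuclideanSpace ℝ (Fin n)) (R + u) \ ball 0 (R - u)) ≤ C * u := by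
  obtain ⟨C, hC, h⟩ := pow_sub_le n (2 * R) (by positivity)
  refine ⟨C * 2 * volume.real (ball (0 : EuclideanSpace ℝ (Fin n)) 1), by positivity, ?_⟩
  intro u hu huR
  rw [measureReal_sdiff (ball_subset_closedBall.trans
    (closedBall_subset_closedBall (by linarith))) measurableSet_ball measure_closedBall_lt_top.ne,
    Measure.addHaar_real_closedBall _ _ (by linarith)]
  have hb : volume.real (ball (0 : EuclideanSpace ℝ (Fin n)) (R - u)) ≥ 
      (R - u) ^ n * volume.real (ball (0 : EuclideanSpace ℝ (Fin n)) 1) := by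
    rw [measureReal_def, Measure.addHaar_ball_of_pos _ _ (by linarith), ENNReal.toReal_mul,
      ENNReal.toReal_ofReal (pow_nonneg (by linarith) _), finrank_euclideanSpace_fin]
    exact le_rfl
  have h1 := mul_le_mul_of_nonneg_right (h (R + u) (R - u) (by linarith) (by linarith) (by linarith))
    (measureReal_nonneg (μ := volume) (s := ball (0 : EuclideanSpace ℝ (Fin n)) 1))
  simp only [finrank_euclideanSpace_fin]
  linarith

lemma vol_cone {n : ℕ} (hn : 1 ≤ n) {R : ℝ} (hR : 0 < R) {b : EuclideanSpace ℝ (Fin n)}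
    (hb : b ≠ 0) : ∃ w > 0, ∀ τ > 0, ∃ P : Set (EuclideanSpace ℝ (Fin n)), MeasurableSet P ∧
      τ * w ≤ volume.real P ∧
      ∀ x ∈ P, R ≤ ‖x‖ ∧ ‖x‖ < (1 + τ) * R ∧ ‖b‖ * R / 2 ≤ ⟪b, x⟫ := by
  set W : Set (EuclideanSpace ℝ (Fin n)) := {x | ‖x‖ < R ∧ ‖b‖ / 2 * ‖x‖ < ⟪b, x⟫} with hW
  have hbn : 0 < ‖b‖ := norm_pos_iff.2 hb
  have hWo : IsOpen W := by
    have h1 : IsOpen {x : EuclideanSpace ℝ (Fin n) | ‖x‖ < R} :=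
      isOpen_lt (by fun_prop) (by fun_prop)
    have h2 : IsOpen {x : EuclideanSpace ℝ (Fin n) | ‖b‖ / 2 * ‖x‖ < ⟪b, x⟫} :=
      isOpen_lt (by fun_prop) (by fun_prop)
    exact h1.inter h2
  have hWne : W.Nonempty := by
    refine ⟨(R / (2 * ‖b‖)) • b, ?_, ?_⟩
    · rw [norm_smul, Real.norm_of_nonneg (by positivity)]
      field_simp; norm_num
    · rw [norm_smul, Real.norm_of_nonneg (by positivity), inner_smul_right,
        real_inner_self_eq_norm_sq]
      field_simp; norm_num
  have hWfin : volume W ≠ ⊤ := measure_ne_top_of_subset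
    (fun x hx => mem_ball_zero_iff.2 hx.1 : W ⊆ ball 0 R) measure_ball_lt_top.ne
  have hWpos : 0 < volume.real W := ENNReal.toReal_pos (hWo.measure_pos _ hWne).ne' hWfin
  refine ⟨volume.real W, hWpos, fun τ hτ => ?_⟩
  open Pointwise in
  refine ⟨((1 + τ) • W) \ W, ?_, ?_, ?_⟩
  · exact (hWo.smul₀ (by positivity)).measurableSet.diff hWo.measurableSet
  · have h1 := le_measureReal_sdiff (μ := volume) (s₂ := W) (s₁ := (1 + τ) • W) hWfin
    have h2 : volume.real ((1 + τ) • W) = (1 + τ) ^ n * volume.real W := by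
      rw [measureReal_def, Measure.addHaar_smul, ENNReal.toReal_mul,
        ENNReal.toReal_ofReal (abs_nonneg _), finrank_euclideanSpace_fin, abs_of_pos (by positivity)]
      rfl
    have h3 : 1 + τ ≤ (1 + τ) ^ n := le_self_pow₀ (by linarith) (by omega)
    nlinarith
  · rintro x ⟨⟨y, ⟨hy1, hy2⟩, rfl⟩, hxW⟩
    have hτ1 : 0 < 1 + τ := by linarith
    have hnx : ‖(1 + τ) • y‖ = (1 + τ) * ‖y‖ := by
      rw [norm_smul, Real.norm_of_nonneg hτ1.le]
    have hin : ‖b‖ / 2 * ‖(1 + τ) • y‖ < ⟪b, (1 + τ) • y⟫ := by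
      rw [hnx, inner_smul_right]
      nlinarith
    simp only at hxW ⊢
    have hR1 : R ≤ ‖(1 + τ) • y‖ := by
      by_contra h
      exact hxW ⟨not_le.1 h, hin⟩
    refine ⟨hR1, ?_, ?_⟩
    · rw [hnx]; gcongr
    · nlinarith

lemma int_inner {n : ℕ} {A : Set (EuclideanSpace ℝ (Fin n))} {r : ℝ} (hA : A ⊆ closedBall 0 r)
    (h : ∀ i : Fin n, ∫ x in A, x i = 0) (b : EuclideanSpace ℝ (Fin n)) :
    ∫ x in A, ⟪b, x⟫ = 0 := by
  have hi : ∀ i : Fin n, IntegrableOn (fun x : EuclideanSpace ℝ (Fin n) => b i * x i) A volume :=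
    fun i => ((by fun_prop : Continuous fun x : EuclideanSpace ℝ (Fin n) =>
      b i * x i).continuousOn.integrableOn_compact (isCompact_closedBall 0 r)).mono_set hA
  have : ∀ x : EuclideanSpace ℝ (Fin n), ⟪b, x⟫ = ∑ i, b i * x i := fun x => by
    simp [PiLp.inner_apply, mul_comm]
  simp only [this]
  rw [integral_finsetSum _ (fun i _ => hi i)]
  refine Finset.sum_eq_zero fun i _ => ?_
  rw [integral_const_mul, h i, mul_zero]

theorem stmt_3 {n : ℕ} (hn : 2 ≤ n) (R : ℝ) (hR : 0 < R)
    (V : EuclideanSpace ℝ (Fin n) → EuclideanSpace ℝ (Fin n))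
    (T : ℝ → EuclideanSpace ℝ (Fin n) → EuclideanSpace ℝ (Fin n))
    (hV : ContDiff ℝ 1 V) (hT : IsGlobalFlow V T)
    (hcm : ∃ ε > (0 : ℝ), ∀ t : ℝ, |t| < ε → ∀ i : Fin n,
      (∫ x in T t '' ball (0 : EuclideanSpace ℝ (Fin n)) R, x i) = 0)
    (hharm : ∃ b : EuclideanSpace ℝ (Fin n),
      ∀ x ∈ sphere (0 : EuclideanSpace ℝ (Fin n)) R, ⟪V x, x⟫ = ⟪b, x⟫) :
    ∀ x : EuclideanSpace ℝ (Fin n), ‖x‖ = R → ⟪V x, x⟫ = 0 := by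
  obtain ⟨ε, hε, hcm⟩ := hcm
  obtain ⟨b, hb⟩ := hharm
  suffices hb0 : b = 0 by
    intro x hx
    rw [hb x (by simpa using hx), hb0, inner_zero_left]
  by_contra hb0
  have hβ : 0 < ‖b‖ := norm_pos_iff.2 hb0
  have hT' := flow_rev hT
  obtain ⟨M0, hM0⟩ := (isCompact_closedBall (0 : EuclideanSpace ℝ (Fin n)) (3 * R)
    ).exists_bound_of_continuousOn hV.continuous.continuousOn
  obtain ⟨M, hMpos, hM⟩ : ∃ M > 0, ∀ y, ‖y‖ ≤ 3 * R → ‖V y‖ < M :=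
    ⟨|M0| + 1, by positivity, fun y hy => by
      have := hM0 y (by simpa using hy)
      linarith [le_abs_self M0]⟩
  have hM' : ∀ y, ‖y‖ ≤ 3 * R → ‖- V y‖ < M := fun y hy => by simpa using hM y hy
  obtain ⟨w, hw, hcone⟩ := vol_cone (n := n) (by omega) hR hb0
  obtain ⟨C, hC, hshell⟩ := vol_shell (n := n) hR
  obtain ⟨κ, hκ⟩ : ∃ κ, κ = ‖b‖ / (6 * R) := ⟨_, rfl⟩
  have hκ0 : 0 < κ := by rw [hκ]; positivity
  obtain ⟨c, hc⟩ : ∃ c, c = ‖b‖ * R / 2 := ⟨_, rfl⟩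
  have hc0 : 0 < c := by rw [hc]; positivity
  obtain ⟨η, hη0, hη1, hη2⟩ : ∃ η > 0, η ≤ ‖b‖ * R / 4 ∧ η * (C * M) < c * κ * w := by
    refine ⟨min (‖b‖ * R / 4) (c * κ * w / (C * M + 1)), by positivity, min_le_left _ _, ?_⟩
    have h1 := min_le_right (‖b‖ * R / 4) (c * κ * w / (C * M + 1))
    have h2 : 0 < min (‖b‖ * R / 4) (c * κ * w / (C * M + 1)) := by positivity
    rw [le_div_iff₀ (by positivity)] at h1
    linarith
  obtain ⟨δ, hδ, t0, ht0, hexp⟩ := flow_exp (V := fun x => - V x) (T := fun t => T (-t))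
    hV.continuous.neg hT' hR hM' hMpos (-b) (fun x hx => by simp [hb x hx]) hη0
  obtain ⟨t, ht, ht1, ht2, ht3, ht4, ht5, ht6⟩ : ∃ t > 0, t < ε ∧ t ≤ t0 ∧ M * t ≤ R / 2 ∧ M * t ≤ δ ∧
      κ * t ≤ 1 ∧ κ * R * t ≤ δ := by
    refine ⟨min (min (ε / 2) t0) (min (R / 2 / M) (min (δ / M) (min (1 / κ) (δ / (κ * R))))), by positivity,
      ?_, ?_, ?_, ?_, ?_, ?_⟩
    · exact ((min_le_left _ _).trans (min_le_left _ _)).trans_lt (by linarith)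
    · exact (min_le_left _ _).trans (min_le_right _ _)
    · rw [← le_div_iff₀' hMpos]; exact (min_le_right _ _).trans (min_le_left _ _)
    · rw [← le_div_iff₀' hMpos]
      exact (min_le_right _ _).trans ((min_le_right _ _).trans (min_le_left _ _))
    · rw [← le_div_iff₀' hκ0]
      exact (min_le_right _ _).trans ((min_le_right _ _).trans ((min_le_right _ _).trans (min_le_left _ _)))
    · rw [← le_div_iff₀' (by positivity)]
      exact (min_le_right _ _).trans ((min_le_right _ _).trans ((min_le_right _ _).trans
        (min_le_right _ _)))
  have htm : t ∈ Set.Icc 0 t := ⟨ht.le, le_rfl⟩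
  have hMt : 0 < M * t := by positivity
  -- characterisation of the image
  have hfwd : ∀ x, ‖x‖ ≤ 2 * R → ‖T t x - x‖ ≤ M * t := fun x hx =>
    flow_stay hT hM hMpos (by linarith) hx htm
  have hbwd : ∀ x, ‖x‖ ≤ 2 * R → ‖T (-t) x - x‖ ≤ M * t := fun x hx =>
    flow_stay hT' hM' hMpos (by linarith) hx htm
  have hmem1 : ∀ x ∈ T t '' ball (0 : EuclideanSpace ℝ (Fin n)) R,
      ‖x‖ ≤ R + M * t ∧ ‖T (-t) x‖ < R := by
    rintro _ ⟨y, hy, rfl⟩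
    rw [mem_ball_zero_iff] at hy
    have h1 := hfwd y (by linarith)
    have h2 : ‖T t y‖ ≤ ‖T t y - y‖ + ‖y‖ := by simpa using norm_add_le (T t y - y) y
    have h3 : T (-t) (T t y) = y := by
      simpa using flow_inv (V := fun x => - V x) hV.neg hT' ht.le y
    exact ⟨by linarith, by rwa [h3]⟩
  have hmem2 : ∀ x, ‖T (-t) x‖ < R → x ∈ T t '' ball (0 : EuclideanSpace ℝ (Fin n)) R :=
    fun x hx => ⟨T (-t) x, by simpa using hx, flow_inv hV hT ht.le x⟩
  have hopen : IsOpen (T t '' ball (0 : EuclideanSpace ℝ (Fin n)) R) := by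
    have hc := (flow_lip (V := fun x => - V x) (T := fun t => T (-t)) hV.neg hT' hM' hMpos ht.le
      (by linarith)).mono ball_subset_closedBall
    have := hc.isOpen_inter_preimage isOpen_ball
      (isOpen_ball (x := (0 : EuclideanSpace ℝ (Fin n))) (ε := R))
    convert this using 1
    ext x
    constructor
    · intro hx
      have := hmem1 x hx
      exact ⟨by rw [mem_ball_zero_iff]; linarith [this.1], by simpa using this.2⟩
    · rintro ⟨_, hx⟩
      exact hmem2 x (by simpa using hx)
  have hI0 : ∫ x in T t '' ball (0 : EuclideanSpace ℝ (Fin n)) R, ⟪b, x⟫ = 0 :=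
    int_inner (r := R + M * t) (fun x hx => by simpa using (hmem1 x hx).1)
      (hcm t (by rwa [abs_of_pos ht])) b
  have hI1 : ∫ x in ball (0 : EuclideanSpace ℝ (Fin n)) R, ⟪b, x⟫ = 0 := by
    refine int_inner ball_subset_closedBall (fun i => ?_) b
    have h := hcm 0 (by simpa using hε) i
    have h2 : T 0 = id := funext hT.1
    rwa [h2, Set.image_id] at h
  have hexp' : ∀ x, |‖x‖ - R| ≤ M * t →
      ‖x‖ ^ 2 - 2 * t * ⟪b, x⟫ - 2 * η * t ≤ ‖T (-t) x‖ ^ 2 ∧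
      ‖T (-t) x‖ ^ 2 ≤ ‖x‖ ^ 2 - 2 * t * ⟪b, x⟫ + 2 * η * t := by
    intro x hx
    have := hexp t ht.le ht2 x (hx.trans ht4)
    rw [abs_le, inner_neg_left] at this
    constructor <;> linarith [this.1, this.2]
  have hexp2 : ∀ x, |‖x‖ - R| ≤ δ →
      ‖T (-t) x‖ ^ 2 ≤ ‖x‖ ^ 2 - 2 * t * ⟪b, x⟫ + 2 * η * t := by
    intro x hx
    have := hexp t ht.le ht2 x hx
    rw [abs_le, inner_neg_left] at this
    linarith [this.1, this.2]
  obtain ⟨P, hPm, hPw, hP⟩ := hcone (κ * t) (by positivity)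
  have hfinal := meas_step (u := M * t) hη0.le hMt.le b _ P hopen.measurableSet hPm hI0 hI1 (c := c)
    (fun x hx => (hmem1 x hx).1)
    (by
      intro x hx
      apply hmem2
      have h1 := hbwd x (by linarith)
      have h2 : ‖T (-t) x‖ ≤ ‖T (-t) x - x‖ + ‖x‖ := by simpa using norm_add_le (T (-t) x - x) x
      linarith)
    (by
      intro x hx hxR
      have h1 := hmem1 x hx
      have h2 := (hexp' x (by rw [abs_le]; constructor <;> linarith [h1.1])).1
      have h3 : ‖T (-t) x‖ ^ 2 < R ^ 2 := by gcongr; exact h1.2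
      have h4 : R ^ 2 ≤ ‖x‖ ^ 2 := by gcongr
      have h5 : 0 < t * (⟪b, x⟫ + η) := by linarith
      linarith [pos_of_mul_pos_right h5 ht.le])
    (by
      intro x hx hxR
      have h1 : R ≤ ‖T (-t) x‖ := not_lt.1 fun h => hx (hmem2 x h)
      have h0 : ‖T (-t) x‖ ≤ ‖T (-t) x - x‖ + ‖x‖ := by simpa using norm_add_le (T (-t) x - x) x
      have h0' := hbwd x (by linarith)
      have h2 := (hexp' x (by rw [abs_le]; constructor <;> linarith)).2
      have h3 : R ^ 2 ≤ ‖T (-t) x‖ ^ 2 := by gcongr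
      have h4 : ‖x‖ ^ 2 < R ^ 2 := by gcongr
      have h5 : 0 < t * (η - ⟪b, x⟫) := by linarith
      linarith [pos_of_mul_pos_right h5 ht.le])
    (by
      intro x hx
      obtain ⟨h1, h2, h3⟩ := hP x hx
      refine ⟨hmem2 x ?_, h1, by rw [hc]; exact h3⟩
      have h4 := hexp2 x (by rw [abs_le]; constructor <;> linarith)
      have h5 : ‖x‖ ^ 2 < ((1 + κ * t) * R) ^ 2 := by gcongr
      have h6 : κ * R = ‖b‖ / 6 := by rw [hκ]; field_simp
      have h7 : ((1 + κ * t) * R) ^ 2 ≤ R ^ 2 + ‖b‖ * R * t / 2 := by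
        have : R ^ 2 + ‖b‖ * R * t / 2 = R ^ 2 + 3 * (κ * R) * R * t := by rw [h6]; ring
        rw [this]
        nlinarith [mul_nonneg (mul_nonneg hκ0.le ht.le) (sq_nonneg R),
          mul_le_mul_of_nonneg_right ht5 (mul_nonneg (mul_nonneg hκ0.le ht.le) (sq_nonneg R))]
      have h8 : t * (‖b‖ * R / 2) ≤ t * ⟪b, x⟫ := by gcongr
      have h9 : η * t ≤ ‖b‖ * R / 4 * t := by gcongr
      have h10 : ‖T (-t) x‖ ^ 2 < R ^ 2 := by linarith
      exact lt_of_pow_lt_pow_left₀ 2 hR.le h10)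
  have hs := hshell (M * t) hMt.le (by linarith)
  have e1 : c * (κ * t * w) ≤ η * (C * (M * t)) :=
    (mul_le_mul_of_nonneg_left hPw hc0.le).trans (hfinal.trans
      (mul_le_mul_of_nonneg_left hs hη0.le))
  have e2 : η * (C * M) * t < c * κ * w * t := by gcongr
  linarith
end

section
/- Let n ≥ 2 and let g : ℝⁿ → ℝ be a positive definite radial kernel which is not identically zero. Let Ω ⊂ ℝⁿ be a nonempty bounded open set with F[Ω] = 0. Then there exists λ > 0 such that χ̂_Ω(ξ) = 0 for all ξ ∈ ℝⁿ with ‖ξ‖ = λ (i.e. Ω fails the Pompeiu property). -/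
open MeasureTheory Metric
open scoped RealInnerProductSpace

open scoped ContDiff FourierTransform Topology

namespace PompeiuAux

lemma posdef_real {n : ℕ} {g : EuclideanSpace ℝ (Fin n) → ℝ} (hg : IsPosDefRadialKernel g)
    {f : EuclideanSpace ℝ (Fin n) → ℝ} (hf : ContDiff ℝ ∞ f) (hc : HasCompactSupport f) :
    0 ≤ ∫ x, ∫ y, g (x - y) * f x * f y := by
  have h := (hg.2.2 (fun x => (f x : ℂ)) (Complex.ofRealCLM.contDiff.comp hf)
    (hc.comp_left (g := fun r : ℝ => (r : ℂ)) (by simp))).2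
  have e : (∫ x, ∫ y, (g (x - y) : ℂ) * (f x : ℂ) * (starRingEnd ℂ) (f y : ℂ))
      = ((∫ x, ∫ y, g (x - y) * f x * f y : ℝ) : ℂ) := by
    refine Eq.trans ?_ integral_complex_ofReal
    congr 1; ext x
    refine Eq.trans ?_ integral_complex_ofReal
    congr 1; ext y
    simp
  rw [e] at h
  simpa using h

variable {n : ℕ}

lemma integrable_cc {p f h : EuclideanSpace ℝ (Fin n) → ℝ} (hp : Continuous p) (hf : Continuous f)
    (hh : Continuous h) (cf : HasCompactSupport f) (ch : HasCompactSupport h) :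
    Integrable (fun z : EuclideanSpace ℝ (Fin n) × EuclideanSpace ℝ (Fin n) => p (z.1 - z.2) * f z.1 * h z.2) (volume.prod volume) := by
  refine Continuous.integrable_of_hasCompactSupport (by fun_prop) ?_
  refine HasCompactSupport.intro (K := tsupport f ×ˢ tsupport h) (cf.isCompact.prod ch.isCompact) ?_
  intro z hz
  rw [Set.mem_prod, not_and_or] at hz
  rcases hz with hz | hz
  · simp [image_eq_zero_of_notMem_tsupport hz]
  · simp [image_eq_zero_of_notMem_tsupport hz]

lemma lin4 {X : Type*} [MeasurableSpace X] {μ : Measure X} {A B C D : X → ℝ}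
    (hA : Integrable A μ) (hB : Integrable B μ) (hC : Integrable C μ) (hD : Integrable D μ)
    (s : ℝ) : ∫ z, A z ∂μ - s * ∫ z, B z ∂μ - s * ∫ z, C z ∂μ + ∫ z, D z ∂μ
      = ∫ z, (A z - s * B z - s * C z + D z) ∂μ := by
  have h1 : Integrable (fun z => A z - s * B z) μ := hA.sub (hB.const_mul s)
  have h2 : Integrable (fun z => A z - s * B z - s * C z) μ := h1.sub (hC.const_mul s)
  rw [integral_add h2 hD, integral_sub h1 (hC.const_mul s), integral_sub hA (hB.const_mul s),
    integral_const_mul, integral_const_mul]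

lemma even_of {g : EuclideanSpace ℝ (Fin n) → ℝ} (hg : IsPosDefRadialKernel g) (x : EuclideanSpace ℝ (Fin n)) : g (-x) = g x :=
  hg.2.1 _ _ (by simp)

lemma shift_eq (g b : EuclideanSpace ℝ (Fin n) → ℝ) (c d : EuclideanSpace ℝ (Fin n)) :
    ∫ x, ∫ y, g (x - y) * b (x - c) * b (y - d) = ∫ x, ∫ y, g (x - y + (c - d)) * b x * b y := by
  rw [← integral_add_right_eq_self _ c]
  congr 1; ext x
  rw [← integral_add_right_eq_self _ d]
  congr 1; ext y
  simp only [add_sub_cancel_right]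
  congr 3
  abel_nf

lemma bounded_aux {g : EuclideanSpace ℝ (Fin n) → ℝ} (hg : IsPosDefRadialKernel g) (a : EuclideanSpace ℝ (Fin n)) (s : ℝ) (hs : s ^ 2 = 1) :
    s * g a ≤ g 0 := by
  by_contra! hlt
  obtain ⟨m, hm1, hm3⟩ := exists_between hlt
  obtain ⟨m', hm', hm2⟩ := exists_between hm3
  have hgc := hg.1
  have h1 : ∀ᶠ w in 𝓝 (0 : EuclideanSpace ℝ (Fin n)), g w < m ∧ m' < s * g (w + a) ∧ m' < s * g (w - a) := by
    refine Filter.Eventually.and ?_ (Filter.Eventually.and ?_ ?_)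
    · exact hgc.continuousAt.eventually_lt continuousAt_const hm1
    · refine ContinuousAt.eventually_lt continuousAt_const (by fun_prop) ?_
      simpa using hm2
    · refine ContinuousAt.eventually_lt continuousAt_const (by fun_prop) ?_
      simpa [even_of hg] using hm2
  obtain ⟨ε, hε, hb⟩ := Metric.eventually_nhds_iff_ball.1 h1
  let φ : ContDiffBump (0 : EuclideanSpace ℝ (Fin n)) := ⟨ε / 4, ε / 2, by positivity, by linarith⟩
  set b : EuclideanSpace ℝ (Fin n) → ℝ := φ.normed volume with hbdef
  have bc : Continuous b := φ.continuous_normed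
  have bs : HasCompactSupport b := φ.hasCompactSupport_normed
  have bd : ContDiff ℝ ∞ b := φ.contDiff_normed
  have b0 : ∀ x, 0 ≤ b x := φ.nonneg_normed
  have b1 : ∫ x, b x = 1 := φ.integral_normed
  have bsup : ∀ x, b x ≠ 0 → ‖x‖ < ε / 2 := by
    intro x hx
    have : x ∈ Function.support b := hx
    rw [hbdef, φ.support_normed_eq] at this
    simpa [φ] using this
  let f : EuclideanSpace ℝ (Fin n) → ℝ := fun x => b x - s * b (x - a)
  have bsa : HasCompactSupport (fun x => b (x - a)) :=
    bs.comp_homeomorph (Homeomorph.subRight a)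
  have fs : HasCompactSupport f := by
    refine bs.sub (HasCompactSupport.mul_left (f := fun _ => s) bsa)
  have fd : ContDiff ℝ ∞ f := by
    have : ContDiff ℝ ∞ (fun x => b (x - a)) := bd.comp (contDiff_id.sub contDiff_const)
    exact bd.sub (contDiff_const.mul this)
  have hpos := posdef_real hg fd fs
  have key : ∫ x, ∫ y, g (x - y) * f x * f y =
      ∫ x, ∫ y, (2 * g (x - y) - s * g (x - y - a) - s * g (x - y + a)) * b x * b y := by
    have i1 := integrable_cc hgc bc bc bs bs
    have i2 := integrable_cc hgc bc (h := fun x => b (x - a)) (by fun_prop) bs bsa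
    have i3 := integrable_cc hgc (f := fun x => b (x - a)) (by fun_prop) bc bsa bs
    have i4 := integrable_cc hgc (f := fun x => b (x - a)) (h := fun x => b (x - a))
      (by fun_prop) (by fun_prop) bsa bsa
    have j1 := integrable_cc (p := fun w => g (w - a)) (by fun_prop) bc bc bs bs
    have j2 := integrable_cc (p := fun w => g (w + a)) (by fun_prop) bc bc bs bs
    have e1 : ∫ x, ∫ y, g (x - y) * f x * f y =
      (∫ x, ∫ y, g (x - y) * b x * b y) - s * (∫ x, ∫ y, g (x - y) * b x * b (y - a))
       - s * (∫ x, ∫ y, g (x - y) * b (x - a) * b y)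
       + (∫ x, ∫ y, g (x - y) * b (x - a) * b (y - a)) := by
      rw [← integral_prod _ i1, ← integral_prod _ i2, ← integral_prod _ i3, ← integral_prod _ i4,
        lin4 i1 i2 i3 i4,
        ← integral_prod _ (integrable_cc hgc fd.continuous fd.continuous fs fs)]
      congr 1; ext z
      simp only [f]
      linear_combination (g (z.1 - z.2) * b (z.1 - a) * b (z.2 - a)) * hs
    have e2 := shift_eq g b 0 a
    have e3 := shift_eq g b a 0
    have e4 := shift_eq g b a a
    simp only [sub_zero, zero_sub, sub_self, add_zero, ← sub_eq_add_neg] at e2 e3 e4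
    rw [e1, e2, e3, e4, ← integral_prod _ i1, ← integral_prod _ j1, ← integral_prod _ j2,
        lin4 i1 j1 j2 i1,
        ← integral_prod _ (integrable_cc 
          (p := fun w => 2 * g w - s * g (w - a) - s * g (w + a)) (by fun_prop) bc bc bs bs)]
    congr 1; ext z
    ring
  rw [key] at hpos
  set p : EuclideanSpace ℝ (Fin n) → ℝ := fun w => 2 * g w - s * g (w - a) - s * g (w + a) with hp
  obtain ⟨κ, hκ, hpk⟩ : ∃ κ : ℝ, κ < 0 ∧ ∀ w ∈ ball (0 : EuclideanSpace ℝ (Fin n)) ε, p w ≤ κ := by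
    refine ⟨2 * (m - m'), by linarith, fun w hw => ?_⟩
    obtain ⟨h1, h2, h3⟩ := hb w hw
    simp only [hp]
    linarith
  have pc : Continuous p := by fun_prop
  have i1 := integrable_cc pc bc bc bs bs
  have i2 := integrable_cc (p := fun _ => κ) continuous_const bc bc bs bs
  have hle : ∫ x, ∫ y, p (x - y) * b x * b y ≤ ∫ x, ∫ y, κ * b x * b y := by
    rw [← integral_prod _ i1, ← integral_prod _ i2]
    refine integral_mono i1 i2 fun z => ?_
    by_cases hx : b z.1 = 0
    · simp [hx]
    by_cases hy : b z.2 = 0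
    · simp [hy]
    have : p (z.1 - z.2) ≤ κ := by
      refine hpk _ ?_
      rw [mem_ball_zero_iff]
      have := norm_sub_le z.1 z.2
      linarith [bsup _ hx, bsup _ hy]
    exact mul_le_mul_of_nonneg_right (mul_le_mul_of_nonneg_right this (b0 _)) (b0 _)
  have : ∫ x, ∫ y, κ * b x * b y = κ := by
    simp_rw [integral_const_mul, b1, mul_one, integral_const_mul, b1, mul_one]
  linarith

lemma bounded_of {g : EuclideanSpace ℝ (Fin n) → ℝ} (hg : IsPosDefRadialKernel g) (a : EuclideanSpace ℝ (Fin n)) : |g a| ≤ g 0 := by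
  have h1 := bounded_aux hg a 1 (by norm_num)
  have h2 := bounded_aux hg a (-1) (by norm_num)
  exact abs_le.2 ⟨by linarith, by linarith⟩

lemma integrable_bd {g f h : EuclideanSpace ℝ (Fin n) → ℝ} (hgc : Continuous g) {M : ℝ} (hM : ∀ x, |g x| ≤ M)
    (hf : Integrable f) (hh : Integrable h) :
    Integrable (fun z : EuclideanSpace ℝ (Fin n) × EuclideanSpace ℝ (Fin n) => g (z.1 - z.2) * f z.1 * h z.2) (volume.prod volume) := by
  have h1 := hf.mul_prod hh
  have h2 := h1.bdd_mul (f := fun z : EuclideanSpace ℝ (Fin n) × EuclideanSpace ℝ (Fin n) => g (z.1 - z.2)) (c := M)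
    (by apply Continuous.aestronglyMeasurable; fun_prop) (Filter.Eventually.of_forall fun z => hM _)
  refine h2.congr (Filter.Eventually.of_forall fun z => ?_)
  simp only; ring

lemma q_bound {g f h : EuclideanSpace ℝ (Fin n) → ℝ} (hgc : Continuous g) {M : ℝ} (hM : ∀ x, |g x| ≤ M)
    (hf : Integrable f) (hh : Integrable h) :
    |∫ z : EuclideanSpace ℝ (Fin n) × EuclideanSpace ℝ (Fin n), g (z.1 - z.2) * f z.1 * h z.2 ∂(volume.prod volume)| ≤
      M * ((∫ x, |f x|) * ∫ x, |h x|) := by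
  rw [← integral_prod_mul, ← integral_const_mul]
  refine (abs_integral_le_integral_abs).trans ?_
  refine integral_mono (integrable_bd hgc hM hf hh).abs
    ((hf.abs.mul_prod hh.abs).const_mul M) fun z => ?_
  simp only [abs_mul]
  rw [mul_assoc]
  exact mul_le_mul_of_nonneg_right (hM _) (by positivity)

lemma q_nonneg {g : EuclideanSpace ℝ (Fin n) → ℝ} (hg : IsPosDefRadialKernel g) {f : EuclideanSpace ℝ (Fin n) → ℝ} (hf : Integrable f) :
    0 ≤ ∫ z : EuclideanSpace ℝ (Fin n) × EuclideanSpace ℝ (Fin n), g (z.1 - z.2) * f z.1 * f z.2 ∂(volume.prod volume) := by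
  have hM := bounded_of hg
  have hM0 : 0 ≤ g 0 := (abs_nonneg _).trans (hM 0)
  have hgc := hg.1
  set N := ∫ x, |f x| with hN
  have hN0 : 0 ≤ N := integral_nonneg fun x => abs_nonneg _
  have key : ∀ ε : ℝ, 0 < ε → 
      -(g 0 * (ε * N) + g 0 * ((N + ε) * ε)) ≤
        ∫ z : EuclideanSpace ℝ (Fin n) × EuclideanSpace ℝ (Fin n), g (z.1 - z.2) * f z.1 * f z.2 ∂(volume.prod volume) := by
    intro ε hε
    obtain ⟨k, kc, kd, hk⟩ := (memLp_one_iff_integrable.2 hf).exist_eLpNorm_sub_le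
      ENNReal.one_ne_top le_rfl hε
    have ki : Integrable k := kd.continuous.integrable_of_hasCompactSupport kc
    have di : Integrable (f - k) := hf.sub ki
    have hd : ∫ x, |(f - k) x| ≤ ε := by
      rw [eLpNorm_one_eq_lintegral_enorm] at hk
      have := integral_norm_eq_lintegral_enorm di.aestronglyMeasurable
      simp only [Real.norm_eq_abs] at this
      rw [this]
      exact ENNReal.toReal_le_of_le_ofReal hε.le hk
    have hkN : ∫ x, |k x| ≤ N + ε := by
      have : ∫ x, |k x| ≤ ∫ x, (|f x| + |(f - k) x|) := by
        refine integral_mono ki.abs (hf.abs.add di.abs) fun x => ?_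
        have := abs_sub_abs_le_abs_sub (k x) (f x)
        rw [abs_sub_comm] at this
        simp only [Pi.sub_apply]
        linarith
      rw [integral_add hf.abs di.abs] at this
      linarith
    have a1 := integrable_bd hgc hM ki ki
    have a2 := integrable_bd hgc hM di hf
    have a3 := integrable_bd hgc hM ki di
    have e : ∫ z : EuclideanSpace ℝ (Fin n) × EuclideanSpace ℝ (Fin n), g (z.1 - z.2) * f z.1 * f z.2 ∂(volume.prod volume)
        = ∫ z : EuclideanSpace ℝ (Fin n) × EuclideanSpace ℝ (Fin n), g (z.1 - z.2) * k z.1 * k z.2 ∂(volume.prod volume)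
        + ∫ z : EuclideanSpace ℝ (Fin n) × EuclideanSpace ℝ (Fin n), g (z.1 - z.2) * (f - k) z.1 * f z.2 ∂(volume.prod volume)
        + ∫ z : EuclideanSpace ℝ (Fin n) × EuclideanSpace ℝ (Fin n), g (z.1 - z.2) * k z.1 * (f - k) z.2 ∂(volume.prod volume) := by
      have i1 : Integrable (fun z : EuclideanSpace ℝ (Fin n) × EuclideanSpace ℝ (Fin n) => g (z.1 - z.2) * k z.1 * k z.2 +
        g (z.1 - z.2) * (f - k) z.1 * f z.2) (volume.prod volume) := a1.add a2
      rw [← integral_add a1 a2, ← integral_add i1 a3]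
      congr 1; ext z
      simp only [Pi.sub_apply]
      ring
    have b1 := posdef_real hg kd kc
    rw [← integral_prod _ a1] at b1
    have b2 := (abs_le.1 (q_bound hgc hM di hf)).1
    have b3 := (abs_le.1 (q_bound hgc hM ki di)).1
    have d0 : 0 ≤ ∫ x, |(f - k) x| := integral_nonneg fun x => abs_nonneg _
    have c2 : g 0 * ((∫ x, |(f - k) x|) * ∫ x, |f x|) ≤ g 0 * (ε * N) := by gcongr
    have c3 : g 0 * ((∫ x, |k x|) * ∫ x, |(f - k) x|) ≤ g 0 * ((N + ε) * ε) := by gcongr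
    rw [e]
    linarith
  have ht : Filter.Tendsto (fun ε : ℝ => -(g 0 * (ε * N) + g 0 * ((N + ε) * ε))) (𝓝[>] 0)
      (𝓝 (-(g 0 * (0 * N) + g 0 * ((N + 0) * 0)))) := by
    apply Filter.Tendsto.mono_left _ nhdsWithin_le_nhds
    apply Continuous.tendsto
    fun_prop
  simp only [zero_mul, mul_zero, add_zero, neg_zero] at ht
  exact le_of_tendsto ht (Filter.eventually_of_mem self_mem_nhdsWithin key)

lemma q_zero {g : EuclideanSpace ℝ (Fin n) → ℝ} (hg : IsPosDefRadialKernel g) {c f : EuclideanSpace ℝ (Fin n) → ℝ} (hc : Integrable c)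
    (h0 : ∫ z : EuclideanSpace ℝ (Fin n) × EuclideanSpace ℝ (Fin n), g (z.1 - z.2) * c z.1 * c z.2 ∂(volume.prod volume) = 0)
    (hf : Integrable f) :
    ∫ z : EuclideanSpace ℝ (Fin n) × EuclideanSpace ℝ (Fin n), g (z.1 - z.2) * f z.1 * c z.2 ∂(volume.prod volume) = 0 := by
  have hM := bounded_of hg
  have hgc := hg.1
  have a1 := integrable_bd hgc hM hc hc
  have a2 := integrable_bd hgc hM hc hf
  have a3 := integrable_bd hgc hM hf hc
  have a4 := integrable_bd hgc hM hf hf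
  have sym : ∫ z : EuclideanSpace ℝ (Fin n) × EuclideanSpace ℝ (Fin n), g (z.1 - z.2) * c z.1 * f z.2 ∂(volume.prod volume)
      = ∫ z : EuclideanSpace ℝ (Fin n) × EuclideanSpace ℝ (Fin n), g (z.1 - z.2) * f z.1 * c z.2 ∂(volume.prod volume) := by
    rw [← integral_prod_swap]
    congr 1; ext z
    simp only [Prod.fst_swap, Prod.snd_swap]
    rw [← neg_sub, even_of hg]
    ring
  set B := ∫ z : EuclideanSpace ℝ (Fin n) × EuclideanSpace ℝ (Fin n), g (z.1 - z.2) * f z.1 * c z.2 ∂(volume.prod volume) with hB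
  set A := ∫ z : EuclideanSpace ℝ (Fin n) × EuclideanSpace ℝ (Fin n), g (z.1 - z.2) * f z.1 * f z.2 ∂(volume.prod volume) with hA
  have key : ∀ t : ℝ, 0 ≤ 2 * t * B + t ^ 2 * A := by
    intro t
    have h := q_nonneg hg (hc.add (hf.const_mul t))
    have e : ∫ z : EuclideanSpace ℝ (Fin n) × EuclideanSpace ℝ (Fin n), g (z.1 - z.2) * (c + fun x => t * f x) z.1 * (c + fun x => t * f x) z.2
          ∂(volume.prod volume) = 0 + t * B + t * B + t ^ 2 * A := by
      rw [← h0]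
      nth_rewrite 1 [← sym]
      rw [hB, hA, ← integral_const_mul, ← integral_const_mul, ← integral_const_mul]
      have i1 : Integrable (fun z : EuclideanSpace ℝ (Fin n) × EuclideanSpace ℝ (Fin n) => g (z.1 - z.2) * c z.1 * c z.2
        + t * (g (z.1 - z.2) * c z.1 * f z.2)) (volume.prod volume) := a1.add (a2.const_mul t)
      have i2 : Integrable (fun z : EuclideanSpace ℝ (Fin n) × EuclideanSpace ℝ (Fin n) => g (z.1 - z.2) * c z.1 * c z.2
        + t * (g (z.1 - z.2) * c z.1 * f z.2) + t * (g (z.1 - z.2) * f z.1 * c z.2))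
          (volume.prod volume) := i1.add (a3.const_mul t)
      rw [← integral_add a1 (a2.const_mul t), ← integral_add i1 (a3.const_mul t),
        ← integral_add i2 (a4.const_mul _)]
      congr 1; ext z
      simp only [Pi.add_apply]
      ring
    rw [e] at h
    linarith
  by_contra hne
  have hA0 : 0 ≤ A := q_nonneg hg hf
  have := key (- B / (A + 1))
  have hb : 0 < B ^ 2 := by positivity
  have e : 2 * (- B / (A + 1)) * B + (- B / (A + 1)) ^ 2 * A = - (B ^ 2 * (A + 2)) / (A + 1) ^ 2 := by
    field_simp
    ring
  rw [e] at this
  have : - (B ^ 2 * (A + 2)) / (A + 1) ^ 2 < 0 := by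
    apply div_neg_of_neg_of_pos
    · have : 0 < B ^ 2 * (A + 2) := by positivity
      linarith
    · positivity
  linarith

lemma integrable_ind {Ω : Set (EuclideanSpace ℝ (Fin n))} (hbdd : Bornology.IsBounded Ω) (hopen : IsOpen Ω) :
    Integrable (Ω.indicator (fun _ => (1 : ℝ))) :=
  (integrable_indicator_iff hopen.measurableSet).2
    (integrableOn_const (hbdd.measure_lt_top.ne))

lemma conv_zero {g : EuclideanSpace ℝ (Fin n) → ℝ} (hg : IsPosDefRadialKernel g) {Ω : Set (EuclideanSpace ℝ (Fin n))}
    (hbdd : Bornology.IsBounded Ω) (hopen : IsOpen Ω)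
    (hF : (∫ x in Ω, ∫ y in Ω, g (x - y)) = 0) {f : EuclideanSpace ℝ (Fin n) → ℝ} (hf : Integrable f) :
    ∫ x, f x * ∫ y in Ω, g (x - y) = 0 := by
  have hc := integrable_ind hbdd hopen
  have ei : ∀ x : EuclideanSpace ℝ (Fin n), ∀ r : ℝ, ∫ y, g (x - y) * r * Ω.indicator (fun _ => (1 : ℝ)) y
      = r * ∫ y in Ω, g (x - y) := by
    intro x r
    rw [← integral_const_mul, ← integral_indicator hopen.measurableSet]
    congr 1; ext y
    by_cases hy : y ∈ Ω <;> simp [hy, mul_comm]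
  have hM := bounded_of hg
  have h0 : ∫ z : EuclideanSpace ℝ (Fin n) × EuclideanSpace ℝ (Fin n), g (z.1 - z.2) * Ω.indicator (fun _ => (1 : ℝ)) z.1 *
      Ω.indicator (fun _ => (1 : ℝ)) z.2 ∂(volume.prod volume) = 0 := by
    rw [integral_prod _ (integrable_bd hg.1 hM hc hc), ← hF,
      ← integral_indicator hopen.measurableSet]
    congr 1; ext x
    refine (ei x (Ω.indicator (fun _ => (1 : ℝ)) x)).trans ?_
    by_cases hx : x ∈ Ω <;> simp [hx]
  have := q_zero hg hc h0 hf
  rw [integral_prod _ (integrable_bd hg.1 hM hf hc)] at this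
  simp only [ei] at this
  exact this

lemma conv_zero_complex {g : EuclideanSpace ℝ (Fin n) → ℝ} (hg : IsPosDefRadialKernel g) {Ω : Set (EuclideanSpace ℝ (Fin n))}
    (hbdd : Bornology.IsBounded Ω) (hopen : IsOpen Ω)
    (hF : (∫ x in Ω, ∫ y in Ω, g (x - y)) = 0) {f : EuclideanSpace ℝ (Fin n) → ℂ} (hf : Integrable f) :
    ∫ x, f x * ((∫ y in Ω, g (x - y) : ℝ) : ℂ) = 0 := by
  by_cases hi : Integrable (fun x => f x * ((∫ y in Ω, g (x - y) : ℝ) : ℂ))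
  · apply Complex.ext
    · rw [← Complex.reCLM_apply, ← Complex.reCLM.integral_comp_comm hi]
      simpa using conv_zero hg hbdd hopen hF (f := fun x => (f x).re) hf.re
    · rw [← Complex.imCLM_apply, ← Complex.imCLM.integral_comp_comm hi]
      simpa using conv_zero hg hbdd hopen hF (f := fun x => (f x).im) hf.im
  · exact integral_undef hi

lemma conv_zero_rot {g : EuclideanSpace ℝ (Fin n) → ℝ} (hg : IsPosDefRadialKernel g) {Ω : Set (EuclideanSpace ℝ (Fin n))}
    (hbdd : Bornology.IsBounded Ω) (hopen : IsOpen Ω)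
    (hF : (∫ x in Ω, ∫ y in Ω, g (x - y)) = 0) (R : EuclideanSpace ℝ (Fin n) ≃ₗᵢ[ℝ] EuclideanSpace ℝ (Fin n)) {f : EuclideanSpace ℝ (Fin n) → ℂ} (hf : Integrable f) :
    ∫ x, f x * ((∫ y in Ω, g (x + R y) : ℝ) : ℂ) = 0 := by
  let S : EuclideanSpace ℝ (Fin n) ≃ₗᵢ[ℝ] EuclideanSpace ℝ (Fin n) := R.symm.trans (LinearIsometryEquiv.neg ℝ)
  have e : ∀ x y, g (x + R y) = g (S x - y) := by
    intro x y
    apply hg.2.1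
    rw [← R.norm_map (S x - y), ← norm_neg (x + R y)]
    congr 1
    simp [S]
    abel
  have hS : Integrable (fun x => f (S.symm x)) :=
    (S.symm.measurePreserving.integrable_comp_emb
      S.symm.toMeasurableEquiv.measurableEmbedding).2 hf
  have h := conv_zero_complex hg hbdd hopen hF hS
  rw [← S.measurePreserving.integral_comp S.toMeasurableEquiv.measurableEmbedding] at h
  simp only [LinearIsometryEquiv.symm_apply_apply] at h
  simp only [e]
  exact h

/-- The Fourier transform of the rotated set. -/
noncomputable def XR (Ω : Set (EuclideanSpace ℝ (Fin n))) (R : EuclideanSpace ℝ (Fin n) ≃ₗᵢ[ℝ] EuclideanSpace ℝ (Fin n)) (η : EuclideanSpace ℝ (Fin n)) : ℂ :=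
  𝓕 (Ω.indicator (fun _ => (1 : ℂ))) (-(R.symm η))

lemma XR_eq {Ω : Set (EuclideanSpace ℝ (Fin n))} (hopen : IsOpen Ω) (R : EuclideanSpace ℝ (Fin n) ≃ₗᵢ[ℝ] EuclideanSpace ℝ (Fin n)) (η : EuclideanSpace ℝ (Fin n)) :
    XR Ω R η = ∫ y in Ω, Complex.exp ((2 * Real.pi * ⟪η, R y⟫ : ℝ) * Complex.I) := by
  rw [XR, Real.fourier_eq', ← integral_indicator hopen.measurableSet]
  congr 1; ext y
  have : ⟪y, -(R.symm η)⟫ = - ⟪η, R y⟫ := by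
    rw [inner_neg_right, real_inner_comm, ← R.inner_map_map]
    simp
  rw [this]
  by_cases hy : y ∈ Ω <;> simp [hy]

lemma XR_contDiff {Ω : Set (EuclideanSpace ℝ (Fin n))} (hbdd : Bornology.IsBounded Ω) (hopen : IsOpen Ω)
    (R : EuclideanSpace ℝ (Fin n) ≃ₗᵢ[ℝ] EuclideanSpace ℝ (Fin n)) : ContDiff ℝ ∞ (XR Ω R) := by
  have h : ContDiff ℝ ∞ (𝓕 (Ω.indicator (fun _ => (1 : ℂ)))) := by
    refine Real.contDiff_fourier (N := ⊤) fun k _ => ?_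
    obtain ⟨C, hC⟩ := hbdd.exists_norm_le
    have e : (fun v : EuclideanSpace ℝ (Fin n) => ‖v‖ ^ k * ‖Ω.indicator (fun _ => (1 : ℂ)) v‖)
        = Ω.indicator (fun v => ‖v‖ ^ k) := by
      ext v
      by_cases hv : v ∈ Ω <;> simp [hv]
    rw [e, integrable_indicator_iff hopen.measurableSet]
    have : Continuous (fun v : EuclideanSpace ℝ (Fin n) => ‖v‖ ^ k) := by fun_prop
    exact (this.continuousOn.integrableOn_compact hbdd.isCompact_closure).mono_set subset_closure
  exact h.comp (R.symm.contDiff.neg)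

lemma fourier_integrable {φ : EuclideanSpace ℝ (Fin n) → ℂ} (hd : ContDiff ℝ ∞ φ) (hc : HasCompactSupport φ) :
    Integrable (𝓕 φ) ∧ Continuous (𝓕 φ) := by
  have h : (𝓕 (hc.toSchwartzMap hd) : SchwartzMap (EuclideanSpace ℝ (Fin n)) ℂ) = 𝓕 φ := by
    rw [SchwartzMap.fourier_coe]; rfl
  rw [← h]
  exact ⟨SchwartzMap.integrable _, SchwartzMap.continuous _⟩

lemma fourier_XR {Ω : Set (EuclideanSpace ℝ (Fin n))} (hbdd : Bornology.IsBounded Ω) (hopen : IsOpen Ω)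
    (R : EuclideanSpace ℝ (Fin n) ≃ₗᵢ[ℝ] EuclideanSpace ℝ (Fin n)) {φ : EuclideanSpace ℝ (Fin n) → ℂ} (hφ : Integrable φ) (x : EuclideanSpace ℝ (Fin n)) :
    𝓕 (fun η => XR Ω R η * φ η) x = ∫ y in Ω, 𝓕 φ (x - R y) := by
  have : IsFiniteMeasure (volume.restrict Ω) := ⟨by simpa using hbdd.measure_lt_top⟩
  simp only [Real.fourier_eq', XR_eq hopen]
  have e1 : ∀ η : EuclideanSpace ℝ (Fin n), Complex.exp ((-2 * Real.pi * ⟪η, x⟫ : ℝ) * Complex.I) •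
      ((∫ y in Ω, Complex.exp ((2 * Real.pi * ⟪η, R y⟫ : ℝ) * Complex.I)) * φ η)
      = ∫ y in Ω, Complex.exp ((-2 * Real.pi * ⟪η, x - R y⟫ : ℝ) * Complex.I) • φ η := by
    intro η
    rw [← integral_mul_const, smul_eq_mul, ← integral_const_mul]
    congr 1; ext y
    rw [← mul_assoc, ← Complex.exp_add, smul_eq_mul]
    congr 2
    rw [inner_sub_right]
    push_cast
    ring
  simp only [e1]
  rw [integral_integral_swap]
  have := (hφ.mul_prod (integrable_const (1 : ℂ) (μ := volume.restrict Ω))).bdd_mul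
    (f := fun z : EuclideanSpace ℝ (Fin n) × EuclideanSpace ℝ (Fin n) => Complex.exp ((-2 * Real.pi * ⟪z.1, x - R z.2⟫ : ℝ) * Complex.I)) (c := 1)
    (by apply Continuous.aestronglyMeasurable; fun_prop)
    (Filter.Eventually.of_forall fun z => by rw [Complex.norm_exp_ofReal_mul_I])
  refine this.congr (Filter.Eventually.of_forall fun z => ?_)
  simp [Function.uncurry]

lemma T_XR {g : EuclideanSpace ℝ (Fin n) → ℝ} (hg : IsPosDefRadialKernel g) {Ω : Set (EuclideanSpace ℝ (Fin n))}
    (hbdd : Bornology.IsBounded Ω) (hopen : IsOpen Ω)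
    (hF : (∫ x in Ω, ∫ y in Ω, g (x - y)) = 0) (R : EuclideanSpace ℝ (Fin n) ≃ₗᵢ[ℝ] EuclideanSpace ℝ (Fin n))
    {φ : EuclideanSpace ℝ (Fin n) → ℂ} (hd : ContDiff ℝ ∞ φ) (hc : HasCompactSupport φ) :
    ∫ x, (g x : ℂ) * 𝓕 (fun η => XR Ω R η * φ η) x = 0 := by
  have : IsFiniteMeasure (volume.restrict Ω) := ⟨by simpa using hbdd.measure_lt_top⟩
  have hφ : Integrable φ := hd.continuous.integrable_of_hasCompactSupport hc
  obtain ⟨hi, hcont⟩ := fourier_integrable hd hc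
  have hgc := hg.1
  have hM := bounded_of hg
  have hM' : ∀ x, ‖(g x : ℂ)‖ ≤ g 0 := fun x => by simpa using hM x
  simp only [fourier_XR hbdd hopen R hφ, ← integral_const_mul]
  rw [integral_integral_swap]
  · have e : ∀ y : EuclideanSpace ℝ (Fin n), ∫ x, (g x : ℂ) * 𝓕 φ (x - R y) = ∫ x, (g (x + R y) : ℂ) * 𝓕 φ x := by
      intro y
      rw [← integral_add_right_eq_self _ (R y)]
      simp
    simp only [e]
    rw [integral_integral_swap]
    · rw [← conv_zero_rot hg hbdd hopen hF R hi]
      congr 1; ext x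
      rw [integral_mul_const, mul_comm]
      congr 1
      exact integral_complex_ofReal
    · have := ((integrable_const (1 : ℂ) (μ := volume.restrict Ω)).mul_prod hi).bdd_mul
        (f := fun z : EuclideanSpace ℝ (Fin n) × EuclideanSpace ℝ (Fin n) => (g (z.2 + R z.1) : ℂ)) (c := g 0)
        (by apply Continuous.aestronglyMeasurable; fun_prop)
        (Filter.Eventually.of_forall fun z => hM' _)
      refine this.congr (Filter.Eventually.of_forall fun z => ?_)
      simp [Function.uncurry]
  · have hm : AEStronglyMeasurable (Function.uncurry fun x y => (g x : ℂ) * 𝓕 φ (x - R y))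
      (volume.prod (volume.restrict Ω)) := by
      apply Continuous.aestronglyMeasurable
      unfold Function.uncurry
      fun_prop
    rw [integrable_prod_iff' hm]
    have hsh : ∀ y : EuclideanSpace ℝ (Fin n), Integrable fun x => 𝓕 φ (x - R y) := fun y => hi.comp_sub_right (R y)
    refine ⟨Filter.Eventually.of_forall fun y => ?_, ?_⟩
    · exact (hsh y).bdd_mul (c := g 0) (by apply Continuous.aestronglyMeasurable; fun_prop)
        (Filter.Eventually.of_forall fun z => hM' _)
    · refine Integrable.mono' (integrable_const (g 0 * ∫ x, ‖𝓕 φ x‖)) ?_ 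
        (Filter.Eventually.of_forall fun y => ?_)
      · exact hm.norm.prod_swap.integral_prod_right'
      · have hs : ∫ x, ‖𝓕 φ x‖ = ∫ x, ‖𝓕 φ (x - R y)‖ :=
          (integral_sub_right_eq_self (fun x => ‖𝓕 φ x‖) (R y)).symm
        rw [Real.norm_of_nonneg (integral_nonneg fun x => norm_nonneg _), hs, ← integral_const_mul]
        refine integral_mono_of_nonneg (Filter.Eventually.of_forall fun x => norm_nonneg _)
          ((hsh y).norm.const_mul _) (Filter.Eventually.of_forall fun x => ?_)
        simp only [Function.uncurry, norm_mul]
        exact mul_le_mul_of_nonneg_right (hM' _) (norm_nonneg _)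

lemma T_zero {g : EuclideanSpace ℝ (Fin n) → ℝ} (hg : IsPosDefRadialKernel g) {Ω : Set (EuclideanSpace ℝ (Fin n))}
    (hbdd : Bornology.IsBounded Ω) (hopen : IsOpen Ω)
    (hF : (∫ x in Ω, ∫ y in Ω, g (x - y)) = 0)
    (hR : ∀ η, ∃ R : EuclideanSpace ℝ (Fin n) ≃ₗᵢ[ℝ] EuclideanSpace ℝ (Fin n), XR Ω R η ≠ 0)
    {ψ : EuclideanSpace ℝ (Fin n) → ℂ} (hd : ContDiff ℝ ∞ ψ) (hc : HasCompactSupport ψ) :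
    ∫ x, (g x : ℂ) * 𝓕 ψ x = 0 := by
  choose R hR using hR
  let X : EuclideanSpace ℝ (Fin n) → EuclideanSpace ℝ (Fin n) → ℂ := fun η => XR Ω (R η)
  have Xd : ∀ η, ContDiff ℝ ∞ (X η) := fun η => XR_contDiff hbdd hopen (R η)
  obtain ⟨t, ht⟩ := hc.isCompact.elim_finite_subcover (fun η => {ζ | X η ζ ≠ 0})
    (fun η => isOpen_ne_fun (Xd η).continuous continuous_const)
    (fun η _ => Set.mem_iUnion.2 ⟨η, hR η⟩)
  let S : EuclideanSpace ℝ (Fin n) → ℂ := fun ζ => ∑ η ∈ t, (starRingEnd ℂ) (X η ζ) * X η ζ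
  have hS : ∀ ζ ∈ tsupport ψ, S ζ ≠ 0 := by
    intro ζ hζ
    obtain ⟨η, hη, hne⟩ := Set.mem_iUnion₂.1 (ht hζ)
    have e : S ζ = ((∑ η ∈ t, Complex.normSq (X η ζ) : ℝ) : ℂ) := by
      simp only [S]
      push_cast
      refine Finset.sum_congr rfl fun i _ => ?_
      rw [mul_comm, Complex.mul_conj]
    rw [e]
    have : 0 < ∑ η ∈ t, Complex.normSq (X η ζ) :=
      Finset.sum_pos' (fun i _ => Complex.normSq_nonneg _) ⟨η, hη, Complex.normSq_pos.2 hne⟩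
    exact_mod_cast this.ne'
  have Xcd : ∀ η, ContDiff ℝ ∞ (fun ζ => (starRingEnd ℂ) (X η ζ)) := fun η =>
    Complex.conjCLE.contDiff.comp (Xd η)
  have Sd : ContDiff ℝ ∞ S := ContDiff.sum fun η _ => (Xcd η).mul (Xd η)
  let φ : EuclideanSpace ℝ (Fin n) → EuclideanSpace ℝ (Fin n) → ℂ := fun η ζ => (starRingEnd ℂ) (X η ζ) * ψ ζ / S ζ
  have φd : ∀ η, ContDiff ℝ ∞ (φ η) := by
    intro η
    rw [contDiff_iff_contDiffAt]
    intro ζ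
    by_cases hζ : ζ ∈ tsupport ψ
    · simp only [φ, div_eq_mul_inv]
      exact ((Xcd η).mul hd).contDiffAt.mul (Sd.contDiffAt.inv (hS ζ hζ))
    · have : φ η =ᶠ[𝓝 ζ] fun _ => 0 := by
        filter_upwards [notMem_tsupport_iff_eventuallyEq.1 hζ] with z hz
        simp [φ, hz]
      exact contDiffAt_const.congr_of_eventuallyEq this
  have φc : ∀ η, HasCompactSupport (φ η) := by
    intro η
    refine HasCompactSupport.intro hc.isCompact fun z hz => ?_
    simp [φ, image_eq_zero_of_notMem_tsupport hz]
  have hsum : ψ = fun ζ => ∑ η ∈ t, X η ζ * φ η ζ := by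
    ext ζ
    by_cases hζ : ζ ∈ tsupport ψ
    · have : ∑ η ∈ t, X η ζ * φ η ζ = S ζ * ψ ζ / S ζ := by
        simp only [φ, S, Finset.sum_mul, Finset.sum_div]
        refine Finset.sum_congr rfl fun i _ => ?_
        ring
      rw [this, mul_div_cancel_left₀ _ (hS ζ hζ)]
    · simp [φ, image_eq_zero_of_notMem_tsupport hζ]
  have pd : ∀ η, ContDiff ℝ ∞ (fun ζ => X η ζ * φ η ζ) := fun η => (Xd η).mul (φd η)
  have pc : ∀ η, HasCompactSupport (fun ζ => X η ζ * φ η ζ) := fun η => (φc η).mul_left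
  have hFs : ∀ x, 𝓕 ψ x = ∑ η ∈ t, 𝓕 (fun ζ => X η ζ * φ η ζ) x := by
    intro x
    rw [hsum]
    simp only [Real.fourier_eq']
    rw [← integral_finsetSum]
    · congr 1; ext v
      rw [Finset.smul_sum]
    · intro η _
      have := (((pd η).continuous.integrable_of_hasCompactSupport (pc η)) : Integrable _ volume)
      refine this.bdd_mul (c := 1) (by apply Continuous.aestronglyMeasurable; fun_prop)
        (Filter.Eventually.of_forall fun z => by rw [Complex.norm_exp_ofReal_mul_I])
  simp only [hFs, Finset.mul_sum]
  have hM := bounded_of hg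
  have hgc := hg.1
  rw [integral_finsetSum]
  · exact Finset.sum_eq_zero fun η _ => T_XR hg hbdd hopen hF (R η) (φd η) (φc η)
  · intro η _
    exact (fourier_integrable (pd η) (pc η)).1.bdd_mul (c := g 0)
      (by apply Continuous.aestronglyMeasurable; fun_prop)
      (Filter.Eventually.of_forall fun z => by simpa using hM z)

lemma g_zero {g : EuclideanSpace ℝ (Fin n) → ℝ} (hgc : Continuous g) {M : ℝ} (hM : ∀ x, |g x| ≤ M)
    (hT : ∀ ψ : EuclideanSpace ℝ (Fin n) → ℂ, ContDiff ℝ ∞ ψ → HasCompactSupport ψ → ∫ x, (g x : ℂ) * 𝓕 ψ x = 0)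
    (a : EuclideanSpace ℝ (Fin n)) : g a = 0 := by
  let b : ContDiffBump (0 : EuclideanSpace ℝ (Fin n)) := ⟨1, 2, by norm_num, by norm_num⟩
  let ψ : EuclideanSpace ℝ (Fin n) → ℂ := fun x => (b x : ℂ)
  have hd : ContDiff ℝ ∞ ψ := Complex.ofRealCLM.contDiff.comp b.contDiff
  have hc : HasCompactSupport ψ :=
    b.hasCompactSupport.comp_left (g := fun r : ℝ => (r : ℂ)) (by simp)
  obtain ⟨Ki, Kc⟩ := fourier_integrable hd hc
  have K1 : ∫ x, 𝓕 ψ x = 1 := by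
    have h := congrFun (hd.continuous.fourierInv_fourier_eq
      (hd.continuous.integrable_of_hasCompactSupport hc) Ki) 0
    rw [Real.fourierInv_eq'] at h
    simp only [inner_zero_right, mul_zero, Complex.ofReal_zero, zero_mul, Complex.exp_zero,
      one_smul] at h
    rw [h]
    simp only [ψ]
    rw [b.one_of_mem_closedBall (by simp [b])]
    simp
  have key : ∀ t : ℝ, 0 < t → ∫ x, (g (t • x + a) : ℂ) * 𝓕 ψ x = 0 := by
    intro t ht
    let ψt : EuclideanSpace ℝ (Fin n) → ℂ := fun v => Complex.exp ((2 * Real.pi * ⟪v, a⟫ : ℝ) * Complex.I) * ψ (t • v)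
    have hdt : ContDiff ℝ ∞ ψt := by
      have h1 : ContDiff ℝ ∞ (fun v : EuclideanSpace ℝ (Fin n) => 
          Complex.exp ((2 * Real.pi * ⟪v, a⟫ : ℝ) * Complex.I)) := by
        refine ContDiff.cexp (ContDiff.mul (Complex.ofRealCLM.contDiff.comp ?_) contDiff_const)
        exact contDiff_const.mul (contDiff_id.inner ℝ contDiff_const)
      exact h1.mul (hd.comp (contDiff_const_smul t))
    have hct : HasCompactSupport ψt := by
      exact (hc.comp_smul ht.ne').mul_left
    have hft : ∀ x, 𝓕 ψt x = ((t ^ n)⁻¹ : ℝ) • 𝓕 ψ (t⁻¹ • (x - a)) := by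
      intro x
      simp only [Real.fourier_eq']
      have := Measure.integral_comp_smul (volume : Measure (EuclideanSpace ℝ (Fin n))) (fun u : EuclideanSpace ℝ (Fin n) =>
        Complex.exp ((-2 * Real.pi * ⟪u, t⁻¹ • (x - a)⟫ : ℝ) * Complex.I) • ψ u) t
      rw [finrank_euclideanSpace_fin, abs_of_pos (by positivity)] at this
      rw [← this]
      congr 1; ext v
      simp only [ψt, smul_eq_mul]
      rw [← mul_assoc, ← Complex.exp_add, real_inner_smul_left, real_inner_smul_right,
        mul_inv_cancel_left₀ ht.ne', inner_sub_right]
      congr 2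
      push_cast
      ring
    have h := hT ψt hdt hct
    simp only [hft] at h
    have h2 : ∫ x, (g x : ℂ) * 𝓕 ψ (t⁻¹ • (x - a)) = 0 := by
      have e : ∀ x, (g x : ℂ) * (((t ^ n)⁻¹ : ℝ) • 𝓕 ψ (t⁻¹ • (x - a)))
        = ((t ^ n)⁻¹ : ℝ) • ((g x : ℂ) * 𝓕 ψ (t⁻¹ • (x - a))) := fun x => by
          rw [mul_smul_comm]
      simp only [e] at h
      rw [integral_smul] at h
      exact (smul_eq_zero.1 h).resolve_left (by positivity)
    rw [← integral_add_right_eq_self _ a] at h2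
    simp only [add_sub_cancel_right] at h2
    have h3 := Measure.integral_comp_smul (volume : Measure (EuclideanSpace ℝ (Fin n)))
      (fun x : EuclideanSpace ℝ (Fin n) => (g (x + a) : ℂ) * 𝓕 ψ (t⁻¹ • x)) t
    rw [h2, smul_zero] at h3
    simpa [smul_smul, inv_mul_cancel₀ ht.ne'] using h3
  have lim : Filter.Tendsto (fun t : ℝ => ∫ x, (g (t • x + a) : ℂ) * 𝓕 ψ x) (𝓝[>] 0)
      (𝓝 (∫ x, (g a : ℂ) * 𝓕 ψ x)) := by
    refine tendsto_integral_filter_of_dominated_convergence (fun x => M * ‖𝓕 ψ x‖) ?_ ?_ 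
      (Ki.norm.const_mul _) ?_
    · refine Filter.Eventually.of_forall fun t => ?_
      apply Continuous.aestronglyMeasurable
      fun_prop
    · refine Filter.Eventually.of_forall fun t => Filter.Eventually.of_forall fun x => ?_
      rw [norm_mul]
      refine mul_le_mul_of_nonneg_right ?_ (norm_nonneg _)
      simpa using hM _
    · refine Filter.Eventually.of_forall fun x => ?_
      apply Filter.Tendsto.mono_left _ nhdsWithin_le_nhds
      have : Continuous fun t : ℝ => (g (t • x + a) : ℂ) * 𝓕 ψ x := by fun_prop
      simpa using this.tendsto 0
  have lim0 : Filter.Tendsto (fun t : ℝ => ∫ x, (g (t • x + a) : ℂ) * 𝓕 ψ x) (𝓝[>] 0) (𝓝 0) :=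
    tendsto_const_nhds.congr' (Filter.eventually_of_mem self_mem_nhdsWithin
      fun t ht => (key t ht).symm)
  have := tendsto_nhds_unique lim lim0
  rw [integral_const_mul, K1, mul_one] at this
  exact_mod_cast this

end PompeiuAux

theorem stmt_4 {n : ℕ} (hn : 2 ≤ n) (g : EuclideanSpace ℝ (Fin n) → ℝ)
    (hg : IsPosDefRadialKernel g) (hg0 : ∃ x, g x ≠ 0)
    (Ω : Set (EuclideanSpace ℝ (Fin n))) (hne : Ω.Nonempty)
    (hbdd : Bornology.IsBounded Ω) (hopen : IsOpen Ω)
    (hF : (∫ x in Ω, ∫ y in Ω, g (x - y)) = 0) :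
    ∃ lam > (0 : ℝ), ∀ ξ : EuclideanSpace ℝ (Fin n), ‖ξ‖ = lam →
      (∫ x in Ω, Complex.exp ((⟪ξ, x⟫ : ℂ) * Complex.I)) = 0 := by
  by_contra! hcon
  obtain ⟨x₀, hx₀⟩ := hg0
  refine hx₀ (PompeiuAux.g_zero hg.1 (PompeiuAux.bounded_of hg) (fun ψ hd hc =>
    PompeiuAux.T_zero hg hbdd hopen hF ?_ hd hc) x₀)
  intro η
  by_cases hη : η = 0
  · refine ⟨LinearIsometryEquiv.refl ℝ _, ?_⟩
    rw [PompeiuAux.XR_eq hopen]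
    have : volume.real Ω ≠ 0 := by
      rw [measureReal_def]
      exact (ENNReal.toReal_pos (hopen.measure_pos _ hne).ne' hbdd.measure_lt_top.ne).ne'
    simpa [hη] using this
  · have hpos : 0 < 2 * Real.pi * ‖η‖ := by positivity
    obtain ⟨ξ, hξ, hne⟩ := hcon _ hpos
    let ζ : EuclideanSpace ℝ (Fin n) := (2 * Real.pi)⁻¹ • ξ
    have hζ : ‖η‖ = ‖ζ‖ := by
      simp only [ζ, norm_smul, hξ, norm_inv]
      rw [Real.norm_of_nonneg (by positivity)]
      field_simp
    refine ⟨Submodule.reflection (ℝ ∙ (η - ζ))ᗮ, ?_⟩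
    rw [PompeiuAux.XR_eq hopen]
    convert hne using 3 with y
    have e : ⟪η, Submodule.reflection (ℝ ∙ (η - ζ))ᗮ y⟫ = ⟪ζ, y⟫ := by
      rw [← LinearIsometryEquiv.inner_map_map (Submodule.reflection (ℝ ∙ (η - ζ))ᗮ),
        Submodule.reflection_reflection, Submodule.reflection_sub hζ]
    rw [e, real_inner_smul_left, mul_inv_cancel_left₀ (by positivity)]
end

section
/- Let n ≥ 2 and let g : ℝⁿ → ℝ be a positive definite radial kernel. Let Ω ⊆ ℝⁿ be a bounded measurable set with ∬_{Ω×Ω} g(x−y) dx dy = 0. Then the function h(x) = ∫_Ω g(x−y) dy vanishes identically: ∫_Ω g(x−y) dy = 0 for every x ∈ ℝⁿ. -/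
open MeasureTheory Metric
open scoped RealInnerProductSpace

section helpers

variable {n : ℕ}

/-- The bilinear form attached to a kernel. -/
noncomputable def bilForm (G : EuclideanSpace ℝ (Fin n) × EuclideanSpace ℝ (Fin n) → ℝ)
    (u v : EuclideanSpace ℝ (Fin n) → ℝ) : ℝ :=
  ∫ p, G p * (u p.1 * v p.2) ∂((volume : Measure (EuclideanSpace ℝ (Fin n))).prod volume)

variable {G : EuclideanSpace ℝ (Fin n) × EuclideanSpace ℝ (Fin n) → ℝ} {M : ℝ}
  (hG : Continuous G) (hM : ∀ p, ‖G p‖ ≤ M)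

theorem bilForm_integrable (hG : Continuous G) (hM : ∀ p, ‖G p‖ ≤ M)
    {u v : EuclideanSpace ℝ (Fin n) → ℝ} (hu : Integrable u) (hv : Integrable v) :
    Integrable (fun p => G p * (u p.1 * v p.2))
      ((volume : Measure (EuclideanSpace ℝ (Fin n))).prod volume) :=
  (hu.mul_prod hv).bdd_mul hG.aestronglyMeasurable (Filter.Eventually.of_forall hM)

theorem bilForm_bound (hM : ∀ p, ‖G p‖ ≤ M)
    {u v : EuclideanSpace ℝ (Fin n) → ℝ} (hu : Integrable u) (hv : Integrable v) :
    |bilForm G u v| ≤ M * ((∫ x, ‖u x‖) * ∫ x, ‖v x‖) := by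
  rw [← integral_prod_mul (μ := volume) (ν := volume) (fun x => ‖u x‖) (fun x => ‖v x‖),
    ← integral_const_mul]
  unfold bilForm
  rw [← Real.norm_eq_abs]
  refine norm_integral_le_of_norm_le (((hu.norm).mul_prod hv.norm).const_mul M) ?_
  refine Filter.Eventually.of_forall fun p => ?_
  rw [norm_mul, norm_mul]
  exact mul_le_mul_of_nonneg_right (hM p) (by positivity)

theorem bilForm_expand (hG : Continuous G) (hM : ∀ p, ‖G p‖ ≤ M)
    (hsymm : ∀ p, G p.swap = G p)
    {u v : EuclideanSpace ℝ (Fin n) → ℝ} (hu : Integrable u) (hv : Integrable v) (t : ℝ) :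
    bilForm G (fun x => u x + t * v x) (fun x => u x + t * v x) =
      bilForm G u u + 2 * t * bilForm G v u + t ^ 2 * bilForm G v v := by
  have hs : bilForm G u v = bilForm G v u := by
    unfold bilForm
    rw [← integral_prod_swap]
    refine integral_congr_ae (Filter.Eventually.of_forall fun p => ?_)
    simp only [hsymm, Prod.fst_swap, Prod.snd_swap]
    ring
  have h1 : bilForm G (fun x => u x + t * v x) (fun x => u x + t * v x) =
      bilForm G u u + t * bilForm G u v + t * bilForm G v u + t ^ 2 * bilForm G v v := by
    unfold bilForm
    have iuu := bilForm_integrable hG hM hu hu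
    have iuv := (bilForm_integrable hG hM hu hv).const_mul t
    have ivu := (bilForm_integrable hG hM hv hu).const_mul t
    have ivv := (bilForm_integrable hG hM hv hv).const_mul (t ^ 2)
    rw [← integral_const_mul, ← integral_const_mul, ← integral_const_mul,
      ← integral_add iuu iuv, ← integral_add (by exact iuu.add iuv) ivu,
      ← integral_add (by exact (iuu.add iuv).add ivu) ivv]
    refine integral_congr_ae (Filter.Eventually.of_forall fun p => ?_)
    ring
  rw [h1, hs]; ring

theorem bilForm_nonneg (hG : Continuous G) (hM : ∀ p, ‖G p‖ ≤ M)
    (hsymm : ∀ p, G p.swap = G p)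
    (hpos : ∀ φ : EuclideanSpace ℝ (Fin n) → ℝ, ContDiff ℝ (⊤ : ℕ∞) φ → HasCompactSupport φ →
      0 ≤ bilForm G φ φ)
    {u : EuclideanSpace ℝ (Fin n) → ℝ} (hu : Integrable u) : 0 ≤ bilForm G u u := by
  have hM0 : 0 ≤ M := (norm_nonneg _).trans (hM 0)
  have key : ∀ ε : ℝ, 0 < ε →
      0 ≤ bilForm G u u + 2 * (M * (ε * ∫ x, ‖u x‖)) + M * (ε * ε) := by
    intro ε hε
    obtain ⟨φ, hφc, hφs, hφ⟩ := MemLp.exist_eLpNorm_sub_le (p := 1) (by simp) le_rfl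
      (memLp_one_iff_integrable.2 hu) hε
    have hφi : Integrable φ := hφs.continuous.integrable_of_hasCompactSupport hφc
    have hd : Integrable (u - φ) := hu.sub hφi
    have hN : ∫ x, ‖(u - φ) x‖ ≤ ε := by
      rw [integral_norm_eq_lintegral_enorm hd.aestronglyMeasurable,
        ← eLpNorm_one_eq_lintegral_enorm]
      exact ENNReal.toReal_le_of_le_ofReal hε.le hφ
    have hN0 : 0 ≤ ∫ x, ‖(u - φ) x‖ := integral_nonneg fun _ => norm_nonneg _
    have hU0 : 0 ≤ ∫ x, ‖u x‖ := integral_nonneg fun _ => norm_nonneg _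
    have hex := bilForm_expand hG hM hsymm hu hd (-1)
    have hfun : (fun x => u x + (-1) * (u - φ) x) = φ := by
      funext x; simp only [Pi.sub_apply]; ring
    rw [hfun] at hex
    have h0 := hpos φ hφs hφc
    have b1 := bilForm_bound hM hd hu
    have b2 := bilForm_bound hM hd hd
    have b1' : M * ((∫ x, ‖(u - φ) x‖) * ∫ x, ‖u x‖) ≤ M * (ε * ∫ x, ‖u x‖) := by gcongr
    have b2' : M * ((∫ x, ‖(u - φ) x‖) * ∫ x, ‖(u - φ) x‖) ≤ M * (ε * ε) := by gcongr
    have := (abs_le.1 b1).1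
    have := (abs_le.1 b2).2
    linarith
  have ht : Filter.Tendsto
      (fun ε : ℝ => bilForm G u u + 2 * (M * (ε * ∫ x, ‖u x‖)) + M * (ε * ε))
      (nhdsWithin 0 (Set.Ioi 0)) (nhds (bilForm G u u)) := by
    have : Continuous
      (fun ε : ℝ => bilForm G u u + 2 * (M * (ε * ∫ x, ‖u x‖)) + M * (ε * ε)) := by fun_prop
    have h := (this.tendsto 0).mono_left (nhdsWithin_le_nhds (s := Set.Ioi 0))
    simpa using h
  exact ge_of_tendsto ht (by filter_upwards [self_mem_nhdsWithin] with ε hε using key ε hε)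

theorem potential_eq_zero (hG : Continuous G) (hGc : HasCompactSupport G)
    (hsymm : ∀ p, G p.swap = G p)
    (hpos : ∀ φ : EuclideanSpace ℝ (Fin n) → ℝ, ContDiff ℝ (⊤ : ℕ∞) φ → HasCompactSupport φ →
      0 ≤ bilForm G φ φ)
    {f : EuclideanSpace ℝ (Fin n) → ℝ} (hf : Integrable f) (hf0 : bilForm G f f = 0)
    (x : EuclideanSpace ℝ (Fin n)) : ∫ y, G (x, y) * f y = 0 := by
  obtain ⟨M, hM⟩ := hG.bounded_above_of_compact_support hGc
  set H : EuclideanSpace ℝ (Fin n) → ℝ := fun x => ∫ y, G (x, y) * f y with hH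
  have hHcont : Continuous H := by
    refine continuous_of_dominated (bound := fun y => M * ‖f y‖) ?_ ?_ ?_ ?_
    · intro x
      exact (Continuous.aestronglyMeasurable (by fun_prop)).mul hf.aestronglyMeasurable
    · intro x
      refine Filter.Eventually.of_forall fun y => ?_
      rw [norm_mul]
      exact mul_le_mul_of_nonneg_right (hM _) (norm_nonneg _)
    · exact hf.norm.const_mul M
    · exact Filter.Eventually.of_forall fun y => by fun_prop
  have hHc : HasCompactSupport H := by
    refine HasCompactSupport.intro (hGc.isCompact.image continuous_fst) fun x hx => ?_
    have : ∀ y, G (x, y) = 0 := fun y => by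
      by_contra h
      exact hx ⟨(x, y), subset_tsupport _ h, rfl⟩
    simp [hH, this]
  have hHi : Integrable H := hHcont.integrable_of_hasCompactSupport hHc
  have hB : bilForm G H f = ∫ x, H x * H x := by
    unfold bilForm
    rw [integral_prod _ (bilForm_integrable hG hM hHi hf)]
    refine integral_congr_ae (Filter.Eventually.of_forall fun x => ?_)
    simp only
    conv_rhs => rw [hH]
    simp only
    rw [mul_comm, ← integral_mul_const]
    refine integral_congr_ae (Filter.Eventually.of_forall fun y => ?_)
    simp only [hH]
    ring
  have hq : ∀ t : ℝ, 0 ≤ bilForm G H H * (t * t) + (2 * bilForm G H f) * t + 0 := by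
    intro t
    have h1 := bilForm_expand hG hM hsymm hf hHi t
    have h2 := bilForm_nonneg hG hM hsymm hpos (hf.add (hHi.const_mul t))
    have h3 : (f + fun x => t * H x) = fun x => f x + t * H x := rfl
    rw [h3, h1, hf0] at h2
    linarith
  have hd := discrim_le_zero hq
  have hz : bilForm G H f = 0 := by
    unfold discrim at hd
    have : (bilForm G H f) ^ 2 ≤ 0 := by nlinarith
    exact pow_eq_zero_iff two_ne_zero |>.1 (le_antisymm this (sq_nonneg _))
  by_contra hne
  have : 0 < ∫ x, H x * H x := (hHcont.mul hHcont).integral_pos_of_hasCompactSupport_nonneg_nonzero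
    (μ := (volume : Measure (EuclideanSpace ℝ (Fin n)))) (x := x) hHc.mul_left
    (fun y => mul_self_nonneg _) (mul_self_ne_zero.2 hne)
  rw [← hB, hz] at this
  exact lt_irrefl _ this

end helpers

theorem stmt_8 {n : ℕ} (hn : 2 ≤ n) (g : EuclideanSpace ℝ (Fin n) → ℝ)
    (hg : IsPosDefRadialKernel g)
    (Ω : Set (EuclideanSpace ℝ (Fin n))) (hmeas : MeasurableSet Ω)
    (hbdd : Bornology.IsBounded Ω)
    (hF : (∫ x in Ω, ∫ y in Ω, g (x - y)) = 0) :
    ∀ x : EuclideanSpace ℝ (Fin n), (∫ y in Ω, g (x - y)) = 0 := by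
  intro x₀
  obtain ⟨hgc, hgr, hgp⟩ := hg
  obtain ⟨R₀, hR₀⟩ := hbdd.subset_closedBall (0 : EuclideanSpace ℝ (Fin n))
  let R : ℝ := max (max R₀ ‖x₀‖) 1
  have hRpos : 0 < R := lt_of_lt_of_le one_pos (le_max_right _ _)
  let χ : ContDiffBump (0 : EuclideanSpace ℝ (Fin n)) := ⟨R, R + 1, hRpos, by linarith⟩
  have hχΩ : ∀ y ∈ Ω, χ y = 1 := fun y hy => χ.one_of_mem_closedBall
    (closedBall_subset_closedBall ((le_max_left _ _).trans (le_max_left _ _)) (hR₀ hy))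
  have hχx : χ x₀ = 1 := χ.one_of_mem_closedBall (by
    rw [mem_closedBall_zero_iff]; exact (le_max_right _ _).trans (le_max_left _ _))
  have hχs : ContDiff ℝ (⊤ : ℕ∞) χ := χ.contDiff
  have hχc : Continuous χ := χ.continuous
  have hχk : HasCompactSupport χ := χ.hasCompactSupport
  set G : EuclideanSpace ℝ (Fin n) × EuclideanSpace ℝ (Fin n) → ℝ :=
    fun p => χ p.1 * χ p.2 * g (p.1 - p.2) with hGdef
  have hG : Continuous G := by fun_prop
  have hGc : HasCompactSupport G := by
    refine HasCompactSupport.intro (hχk.isCompact.prod hχk.isCompact) fun p hp => ?_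
    by_contra h
    refine hp ⟨subset_tsupport _ fun h1 => h ?_, subset_tsupport _ fun h1 => h ?_⟩ <;>
      simp [hGdef, h1]
  have hsymm : ∀ p, G p.swap = G p := by
    intro p
    simp only [hGdef, Prod.fst_swap, Prod.snd_swap]
    rw [hgr (p.2 - p.1) (p.1 - p.2) (norm_sub_rev _ _)]
    ring
  obtain ⟨M, hM⟩ := hG.bounded_above_of_compact_support hGc
  have hpos : ∀ φ : EuclideanSpace ℝ (Fin n) → ℝ, ContDiff ℝ (⊤ : ℕ∞) φ →
      HasCompactSupport φ → 0 ≤ bilForm G φ φ := by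
    intro φ hφs hφc
    have hφi : Integrable φ := hφs.continuous.integrable_of_hasCompactSupport hφc
    have h := (hgp (fun x => ((χ x * φ x : ℝ) : ℂ))
      (Complex.ofRealCLM.contDiff.comp (hχs.mul hφs))
      (HasCompactSupport.comp_left (g := ((↑) : ℝ → ℂ)) hφc.mul_left Complex.ofReal_zero)).2
    have he : (∫ x, ∫ y, (g (x - y) : ℂ) * ((χ x * φ x : ℝ) : ℂ) *
        (starRingEnd ℂ) ((χ y * φ y : ℝ) : ℂ)) = ((bilForm G φ φ : ℝ) : ℂ) := by
      unfold bilForm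
      rw [integral_prod _ (bilForm_integrable hG hM hφi hφi), ← integral_complex_ofReal]
      refine integral_congr_ae (Filter.Eventually.of_forall fun x => ?_)
      simp only
      rw [← integral_complex_ofReal]
      refine integral_congr_ae (Filter.Eventually.of_forall fun y => ?_)
      simp only [hGdef, Complex.conj_ofReal]
      push_cast
      ring
    rw [he, Complex.ofReal_re] at h
    exact h
  set f : EuclideanSpace ℝ (Fin n) → ℝ := Ω.indicator fun _ => 1 with hfdef
  have hf : Integrable f :=
    (integrable_indicator_iff hmeas).2 (integrableOn_const hbdd.measure_lt_top.ne)
  have hin : ∀ x, χ x = 1 → ∫ y, G (x, y) * f y = ∫ y in Ω, g (x - y) := by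
    intro x hx
    rw [← integral_indicator hmeas]
    refine integral_congr_ae (Filter.Eventually.of_forall fun y => ?_)
    by_cases hy : y ∈ Ω
    · simp [hfdef, hGdef, hy, hx, hχΩ y hy]
    · simp [hfdef, hy]
  have hf0 : bilForm G f f = 0 := by
    rw [← hF, ← integral_indicator hmeas]
    unfold bilForm
    rw [integral_prod _ (bilForm_integrable hG hM hf hf)]
    refine integral_congr_ae (Filter.Eventually.of_forall fun x => ?_)
    by_cases hx : x ∈ Ω
    · simp only [Set.indicator_of_mem hx]
      rw [← hin x (hχΩ x hx)]
      simp [hfdef, hx]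
    · simp [hfdef, hx]
  rw [← hin x₀ hχx]
  exact potential_eq_zero hG hGc hsymm hpos hf hf0 x₀
end

section
/- Let n ≥ 2 and let g : ℝⁿ → ℝ be a positive definite radial kernel. Let ∂B = {x ∈ ℝⁿ : ‖x‖ = R} be the sphere of radius R > 0 centered at 0, carrying the (n−1)-dimensional Hausdorff surface measure σ. Then for every continuous function v : ∂B → ℝ, the double surface integral ∬_{∂B×∂B} g(x−y) v(x) v(y) dσ(x) dσ(y) is nonnegative. -/
open MeasureTheory Metric
open scoped RealInnerProductSpace

theorem sphere_meas_lt_top {n : ℕ} (hn : 2 ≤ n) (R : ℝ) :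
    μH[(n : ℝ) - 1] (sphere (0 : EuclideanSpace ℝ (Fin n)) R) < ⊤ := by
  obtain ⟨m, rfl⟩ : ∃ m, n = m + 1 := ⟨n - 1, by omega⟩
  have hcast : ((m + 1 : ℕ) : ℝ) - 1 = (m : ℝ) := by push_cast; ring
  rw [hcast]
  let f : Fin (m + 1) → ℝ → (Fin m → ℝ) → EuclideanSpace ℝ (Fin (m + 1)) :=
    fun i s w => WithLp.toLp 2 (i.insertNth s w : Fin (m+1) → ℝ)
  let h : Fin (m + 1) → ℝ → (Fin m → ℝ) → EuclideanSpace ℝ (Fin (m + 1)) :=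
    fun i s w => (R / ‖f i s w‖) • f i s w
  have hne : ∀ i s w, s ≠ 0 → f i s w ≠ 0 := by
    intro i s w hs h0
    apply hs
    have := congrArg (fun z : EuclideanSpace ℝ (Fin (m + 1)) => z i) h0
    simpa [f] using this
  have hfd : ∀ i s, ContDiff ℝ 1 (f i s) := by
    intro i s
    rw [contDiff_euclidean]
    intro j
    rcases Fin.eq_self_or_eq_succAbove i j with rfl | ⟨k, rfl⟩
    · simp only [f, Fin.insertNth_apply_same]; fun_prop
    · simp only [f, Fin.insertNth_apply_succAbove]; fun_prop
  have hhd : ∀ i s w, s ≠ 0 → ContDiffAt ℝ 1 (h i s) w := by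
    intro i s w hs
    have h1 := (hfd i s).contDiffAt (x := w)
    exact (contDiffAt_const.div (h1.norm ℝ (hne i s w hs)) (norm_ne_zero_iff.2 (hne i s w hs))).smul h1
  have hfin : ∀ i s, s ≠ 0 → μH[(m : ℝ)] (h i s '' closedBall 0 1) < ⊤ := by
    intro i s hs
    have hK : IsCompact (closedBall (0 : Fin m → ℝ) 1) := isCompact_closedBall _ _
    refine hK.induction_on (p := fun t => μH[(m : ℝ)] (h i s '' t) < ⊤) (by simp) ?_ ?_ ?_
    · intro a b hab hb
      exact (measure_mono (Set.image_mono hab)).trans_lt hb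
    · intro a b ha hb
      rw [Set.image_union]
      exact (measure_union_le _ _).trans_lt (ENNReal.add_lt_top.2 ⟨ha, hb⟩)
    · intro w hw
      obtain ⟨K, t, ht, hL⟩ := (hhd i s w hs).exists_lipschitzOnWith
      refine ⟨t ∩ closedBall 0 1, Filter.inter_mem (mem_nhdsWithin_of_mem_nhds ht) self_mem_nhdsWithin, ?_⟩
      refine ((hL.mono Set.inter_subset_left).hausdorffMeasure_image_le (by positivity)).trans_lt ?_
      have : (μH[(m : ℝ)] : Measure (Fin m → ℝ)) = volume := by
        simpa using (hausdorffMeasure_pi_real (ι := Fin m))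
      rw [this]
      refine ENNReal.mul_lt_top (by simp) ?_
      exact (measure_mono Set.inter_subset_right).trans_lt measure_closedBall_lt_top
  rcases le_or_gt R 0 with hR | hR
  · have : sphere (0 : EuclideanSpace ℝ (Fin (m+1))) R ⊆ {0} := by
      intro x hx
      have : ‖x‖ = R := by simpa using hx
      have : ‖x‖ = 0 := le_antisymm (this ▸ hR) (norm_nonneg _)
      simpa using this
    refine (measure_mono this).trans_lt ?_
    have hm : (0:ℝ) < m := by exact_mod_cast (by omega : 0 < m)
    have := Measure.nullSingletonClass_hausdorff (EuclideanSpace ℝ (Fin (m+1))) hm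
    simp
  have hsub : sphere (0 : EuclideanSpace ℝ (Fin (m + 1))) R ⊆
      ⋃ i : Fin (m + 1), (h i 1 '' closedBall 0 1 ∪ h i (-1) '' closedBall 0 1) := by
    intro x hx
    have hx : ‖x‖ = R := by simpa using hx
    obtain ⟨i, -, hi⟩ := Finset.exists_max_image Finset.univ (fun j => |x j|) ⟨0, Finset.mem_univ _⟩
    have hxi : x i ≠ 0 := by
      intro h0
      have : x = 0 := by
        ext j
        have := hi j (Finset.mem_univ _)
        simpa [h0] using this
      rw [this] at hx; simp at hx; linarith
    have key : ∃ s, (s = 1 ∨ s = -1) ∧ s * |x i| = x i := by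
      rcases le_total 0 (x i) with h | h
      · exact ⟨1, Or.inl rfl, by rw [abs_of_nonneg h]; ring⟩
      · exact ⟨-1, Or.inr rfl, by rw [abs_of_nonpos h]; ring⟩
    obtain ⟨s, hs, hsx⟩ := key
    have hpos : 0 < |x i| := abs_pos.2 hxi
    have hmem : x ∈ h i s '' closedBall 0 1 := by
      refine ⟨fun k => x (i.succAbove k) / |x i|, ?_, ?_⟩
      · rw [mem_closedBall_zero_iff, pi_norm_le_iff_of_nonneg zero_le_one]
        intro k
        rw [Real.norm_eq_abs, abs_div, abs_abs, div_le_one hpos]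
        exact hi _ (Finset.mem_univ _)
      · have hf : f i s (fun k => x (i.succAbove k) / |x i|) = |x i|⁻¹ • x := by
          ext j
          rcases Fin.eq_self_or_eq_succAbove i j with rfl | ⟨k, rfl⟩
          · simp only [f, Fin.insertNth_apply_same, PiLp.smul_apply, smul_eq_mul]
            field_simp; linarith
          · simp only [f, Fin.insertNth_apply_succAbove, PiLp.smul_apply, smul_eq_mul]
            field_simp
        simp only [h, hf, norm_smul, hx, smul_smul, norm_inv, Real.norm_eq_abs, abs_abs]
        have : R / (|x i|⁻¹ * R) * |x i|⁻¹ = 1 := by field_simp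
        rw [this, one_smul]
    refine Set.mem_iUnion.2 ⟨i, ?_⟩
    rcases hs with rfl | rfl
    · exact Or.inl hmem
    · exact Or.inr hmem
  refine (measure_mono hsub).trans_lt ?_
  refine (measure_iUnion_le _).trans_lt ?_
  rw [tsum_fintype]
  refine ENNReal.sum_lt_top.2 fun i _ => (measure_union_le _ _).trans_lt ?_
  exact ENNReal.add_lt_top.2 ⟨hfin i 1 one_ne_zero, hfin i (-1) (by norm_num)⟩

theorem posdef_finite_measure {n : ℕ} (g : EuclideanSpace ℝ (Fin n) → ℝ)
    (hg : IsPosDefRadialKernel g) (ν : Measure (EuclideanSpace ℝ (Fin n))) [IsFiniteMeasure ν]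
    (v : EuclideanSpace ℝ (Fin n) → ℝ) (hv : Continuous v) (M : ℝ)
    (hvM : ∀ x, M < ‖x‖ → v x = 0) :
    0 ≤ ∫ x, (∫ y, g (x - y) * v x * v y ∂ν) ∂ν := by
  obtain ⟨hgc, -, hpd⟩ := hg
  -- integrability of continuous functions vanishing outside balls
  have hvs : HasCompactSupport v :=
    HasCompactSupport.intro (isCompact_closedBall (0 : (EuclideanSpace ℝ (Fin n))) M) fun x hx => hvM x (by
      simpa using hx)
  have hvi : Integrable v ν := hv.integrable_of_hasCompactSupport hvs
  have hI : Integrable (fun q : (EuclideanSpace ℝ (Fin n)) × (EuclideanSpace ℝ (Fin n)) => g (q.1 - q.2) * v q.1 * v q.2) (ν.prod ν) := by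
    refine Continuous.integrable_of_hasCompactSupport (by fun_prop) ?_
    refine HasCompactSupport.intro
      ((isCompact_closedBall (0 : (EuclideanSpace ℝ (Fin n))) M).prod (isCompact_closedBall (0 : (EuclideanSpace ℝ (Fin n))) M)) ?_
    intro q hq
    by_contra h0
    apply hq
    constructor
    · rw [mem_closedBall_zero_iff]; by_contra h; exact h0 (by simp [hvM q.1 (not_le.1 h)])
    · rw [mem_closedBall_zero_iff]; by_contra h; exact h0 (by simp [hvM q.2 (not_le.1 h)])
  rw [← integral_prod (fun q : (EuclideanSpace ℝ (Fin n)) × (EuclideanSpace ℝ (Fin n)) => g (q.1 - q.2) * v q.1 * v q.2) hI]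
  set C := ∫ q : (EuclideanSpace ℝ (Fin n)) × (EuclideanSpace ℝ (Fin n)), |v q.1 * v q.2| ∂(ν.prod ν) with hC
  have hvv : Integrable (fun q : (EuclideanSpace ℝ (Fin n)) × (EuclideanSpace ℝ (Fin n)) => v q.1 * v q.2) (ν.prod ν) := hvi.mul_prod hvi
  -- main estimate
  have main : ∀ δ > 0, -(δ * C) ≤ ∫ q : (EuclideanSpace ℝ (Fin n)) × (EuclideanSpace ℝ (Fin n)), g (q.1 - q.2) * v q.1 * v q.2 ∂(ν.prod ν) := by
    intro δ hδ
    have hUC : UniformContinuousOn g (closedBall (0 : (EuclideanSpace ℝ (Fin n))) (2 * |M| + 2)) :=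
      (isCompact_closedBall _ _).uniformContinuousOn_of_continuous hgc.continuousOn
    obtain ⟨η, hη, hgη⟩ := Metric.uniformContinuousOn_iff.1 hUC δ hδ
    let r : ℝ := min 1 (η / 2)
    have hr : 0 < r := lt_min one_pos (by linarith)
    have hr1 : r ≤ 1 := min_le_left _ _
    have hr2 : r ≤ η / 2 := min_le_right _ _
    let φ : ContDiffBump (0 : (EuclideanSpace ℝ (Fin n))) := ⟨r / 2, r, by linarith, by linarith⟩
    let ψ : (EuclideanSpace ℝ (Fin n)) → ℝ := φ.normed volume
    have hψc : Continuous ψ := φ.continuous_normed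
    have hψ0 : ∀ x, 0 ≤ ψ x := fun x => φ.nonneg_normed x
    have hψr : ∀ x, r ≤ ‖x‖ → ψ x = 0 := by
      intro x hx
      by_contra h
      have : x ∈ Function.support ψ := h
      rw [show Function.support ψ = ball 0 r from φ.support_normed_eq, mem_ball_zero_iff] at this
      linarith
    have hψ1 : ∀ z, ∫ x, ψ (x - z) = 1 := by
      intro z
      rw [integral_sub_right_eq_self ψ z]
      exact φ.integral_normed
    have hψi : ∀ z, Integrable (fun x => ψ (x - z)) := fun z =>
      φ.integrable_normed.comp_sub_right z
    have hψψi : ∀ q : (EuclideanSpace ℝ (Fin n)) × (EuclideanSpace ℝ (Fin n)), Integrable (fun p : (EuclideanSpace ℝ (Fin n)) × (EuclideanSpace ℝ (Fin n)) => ψ (p.1 - q.1) * ψ (p.2 - q.2))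
        (volume.prod volume) := fun q => (hψi q.1).mul_prod (hψi q.2)
    have hψψ1 : ∀ q : (EuclideanSpace ℝ (Fin n)) × (EuclideanSpace ℝ (Fin n)), ∫ p : (EuclideanSpace ℝ (Fin n)) × (EuclideanSpace ℝ (Fin n)), ψ (p.1 - q.1) * ψ (p.2 - q.2)
        ∂(volume.prod volume) = 1 := by
      intro q
      rw [integral_prod_mul (fun x => ψ (x - q.1)) (fun x => ψ (x - q.2)), hψ1, hψ1, one_mul]
    let F : ((EuclideanSpace ℝ (Fin n)) × (EuclideanSpace ℝ (Fin n))) → ((EuclideanSpace ℝ (Fin n)) × (EuclideanSpace ℝ (Fin n))) → ℝ := fun p q =>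
      g (p.1 - p.2) * (ψ (p.1 - q.1) * v q.1) * (ψ (p.2 - q.2) * v q.2)
    have hFi : Integrable (Function.uncurry F) ((volume.prod volume).prod (ν.prod ν)) := by
      refine Continuous.integrable_of_hasCompactSupport (by unfold F Function.uncurry; fun_prop) ?_
      have hB := isCompact_closedBall (0 : (EuclideanSpace ℝ (Fin n))) (|M| + 1)
      refine HasCompactSupport.intro ((hB.prod hB).prod (hB.prod hB)) ?_
      rintro ⟨⟨x, y⟩, ⟨z, w⟩⟩ hq
      by_contra h0
      apply hq
      have hz : ‖z‖ ≤ |M| := by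
        by_contra h
        exact h0 (by simp [F, Function.uncurry, hvM z ((le_abs_self M).trans_lt (not_le.1 h))])
      have hw : ‖w‖ ≤ |M| := by
        by_contra h
        exact h0 (by simp [F, Function.uncurry, hvM w ((le_abs_self M).trans_lt (not_le.1 h))])
      have hx : ‖x - z‖ < r := by
        by_contra h
        exact h0 (by simp [F, Function.uncurry, hψr _ (not_lt.1 h)])
      have hy : ‖y - w‖ < r := by
        by_contra h
        exact h0 (by simp [F, Function.uncurry, hψr _ (not_lt.1 h)])
      have hx' := norm_sub_norm_le x z
      have hy' := norm_sub_norm_le y w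
      simp only [Set.mem_prod, mem_closedBall_zero_iff]
      refine ⟨⟨?_, ?_⟩, ?_, ?_⟩ <;> linarith
    let m : (EuclideanSpace ℝ (Fin n)) → ℝ := fun x => ∫ z, ψ (x - z) * v z ∂ν
    have hFm : ∀ p : (EuclideanSpace ℝ (Fin n)) × (EuclideanSpace ℝ (Fin n)), ∫ q, F p q ∂(ν.prod ν) = g (p.1 - p.2) * m p.1 * m p.2 := by
      intro p
      have : ∀ q : (EuclideanSpace ℝ (Fin n)) × (EuclideanSpace ℝ (Fin n)), F p q =
          g (p.1 - p.2) * ((ψ (p.1 - q.1) * v q.1) * (ψ (p.2 - q.2) * v q.2)) := by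
        intro q; simp only [F]; ring
      simp_rw [this]
      rw [integral_const_mul, integral_prod_mul (fun z => ψ (p.1 - z) * v z)
        (fun z => ψ (p.2 - z) * v z)]
      simp only [m]; ring
    have hms : ContDiff ℝ (⊤ : ℕ∞) m := by
      have := HasCompactSupport.contDiff_convolution_right (n := (⊤ : ℕ∞)) (μ := ν)
        (ContinuousLinearMap.mul ℝ ℝ) (f := v) (g := ψ) φ.hasCompactSupport_normed
        hvi.locallyIntegrable φ.contDiff_normed
      convert this using 1
      ext x
      simp only [m, convolution_def, ContinuousLinearMap.mul_apply']
      exact integral_congr_ae (Filter.Eventually.of_forall fun z => mul_comm _ _)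
    have hmz : ∀ x, |M| + 1 < ‖x‖ → m x = 0 := by
      intro x hx
      simp only [m]
      rw [← integral_zero (EuclideanSpace ℝ (Fin n)) ℝ (μ := ν)]
      refine integral_congr_ae (Filter.Eventually.of_forall fun z => ?_)
      rcases lt_or_ge M ‖z‖ with h | h
      · simp [hvM z h]
      · have := norm_sub_norm_le x z
        have hM := le_abs_self M
        simp [hψr (x - z) (by linarith)]
    have hmcs : HasCompactSupport m :=
      HasCompactSupport.intro (isCompact_closedBall (0 : (EuclideanSpace ℝ (Fin n))) (|M| + 1)) fun x hx => hmz x (by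
        simpa using hx)
    have hJ : 0 ≤ ∫ p : (EuclideanSpace ℝ (Fin n)) × (EuclideanSpace ℝ (Fin n)), g (p.1 - p.2) * m p.1 * m p.2 ∂(volume.prod volume) := by
      have hmi : Integrable (fun p : (EuclideanSpace ℝ (Fin n)) × (EuclideanSpace ℝ (Fin n)) => g (p.1 - p.2) * m p.1 * m p.2)
          (volume.prod volume) := by
        have := hFi.integral_prod_left
        refine this.congr (Filter.Eventually.of_forall fun p => ?_)
        exact hFm p
      rw [integral_prod _ hmi]
      have h2 := (hpd (fun x => (m x : ℂ)) (Complex.ofRealCLM.contDiff.comp hms)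
        (hmcs.comp_left (g := fun t : ℝ => (t : ℂ)) Complex.ofReal_zero)).2
      have h3 : (∫ x, ∫ y, (g (x - y) : ℂ) * (m x : ℂ) * (starRingEnd ℂ) (m y : ℂ)) =
          ((∫ x, ∫ y, g (x - y) * m x * m y : ℝ) : ℂ) := by
        have hin : ∀ x y, (g (x - y) : ℂ) * (m x : ℂ) * (starRingEnd ℂ) (m y : ℂ) =
            ((g (x - y) * m x * m y : ℝ) : ℂ) := by
          intro x y
          simp
        simp_rw [hin, integral_complex_ofReal]
      rw [h3, Complex.ofReal_re] at h2
      exact h2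
    have hswap : ∫ p : (EuclideanSpace ℝ (Fin n)) × (EuclideanSpace ℝ (Fin n)), g (p.1 - p.2) * m p.1 * m p.2 ∂(volume.prod volume) =
        ∫ q : (EuclideanSpace ℝ (Fin n)) × (EuclideanSpace ℝ (Fin n)), (∫ p : (EuclideanSpace ℝ (Fin n)) × (EuclideanSpace ℝ (Fin n)), F p q ∂(volume.prod volume)) ∂(ν.prod ν) := by
      rw [← integral_integral_swap hFi]
      simp_rw [hFm]
    have hAi : Integrable (fun q : (EuclideanSpace ℝ (Fin n)) × (EuclideanSpace ℝ (Fin n)) => ∫ p : (EuclideanSpace ℝ (Fin n)) × (EuclideanSpace ℝ (Fin n)), F p q ∂(volume.prod volume))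
        (ν.prod ν) := hFi.integral_prod_right
    have hpt : ∀ q : (EuclideanSpace ℝ (Fin n)) × (EuclideanSpace ℝ (Fin n)), (∫ p : (EuclideanSpace ℝ (Fin n)) × (EuclideanSpace ℝ (Fin n)), F p q ∂(volume.prod volume)) -
        g (q.1 - q.2) * v q.1 * v q.2 ≤ δ * |v q.1 * v q.2| := by
      intro q
      by_cases hq : v q.1 * v q.2 = 0
      · have h1 : ∀ p, F p q = 0 := by
          intro p
          have : F p q = g (p.1 - p.2) * ψ (p.1 - q.1) * ψ (p.2 - q.2) * (v q.1 * v q.2) := by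
            simp only [F]; ring
          rw [this, hq, mul_zero]
        simp [h1, mul_assoc, hq]
      have hq1 : ‖q.1‖ ≤ |M| := by
        by_contra h
        exact hq (by simp [hvM q.1 ((le_abs_self M).trans_lt (not_le.1 h))])
      have hq2 : ‖q.2‖ ≤ |M| := by
        by_contra h
        exact hq (by simp [hvM q.2 ((le_abs_self M).trans_lt (not_le.1 h))])
      -- pointwise bound
      have hb : ∀ p : (EuclideanSpace ℝ (Fin n)) × (EuclideanSpace ℝ (Fin n)),
          ‖(g (p.1 - p.2) - g (q.1 - q.2)) * (ψ (p.1 - q.1) * ψ (p.2 - q.2))‖ ≤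
            δ * (ψ (p.1 - q.1) * ψ (p.2 - q.2)) := by
        intro p
        have h0 : 0 ≤ ψ (p.1 - q.1) * ψ (p.2 - q.2) := mul_nonneg (hψ0 _) (hψ0 _)
        rw [norm_mul, Real.norm_of_nonneg h0]
        by_cases hz : ψ (p.1 - q.1) * ψ (p.2 - q.2) = 0
        · simp [hz]
        refine mul_le_mul_of_nonneg_right ?_ h0
        have hx : ‖p.1 - q.1‖ < r := by
          by_contra h
          exact hz (by simp [hψr _ (not_lt.1 h)])
        have hy : ‖p.2 - q.2‖ < r := by
          by_contra h
          exact hz (by simp [hψr _ (not_lt.1 h)])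
        have hx' := norm_sub_norm_le p.1 q.1
        have hy' := norm_sub_norm_le p.2 q.2
        have h3 := norm_sub_le p.1 p.2
        have h4 := norm_sub_le q.1 q.2
        have h5 : dist (p.1 - p.2) (q.1 - q.2) < η := by
          rw [dist_eq_norm, show p.1 - p.2 - (q.1 - q.2) = (p.1 - q.1) - (p.2 - q.2) by abel]
          have := norm_sub_le (p.1 - q.1) (p.2 - q.2)
          linarith
        have := hgη (p.1 - p.2) (by rw [mem_closedBall_zero_iff]; linarith)
          (q.1 - q.2) (by rw [mem_closedBall_zero_iff]; linarith) h5
        rw [← dist_eq_norm]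
        exact this.le
      have hint : Integrable (fun p : (EuclideanSpace ℝ (Fin n)) × (EuclideanSpace ℝ (Fin n)) =>
          (g (p.1 - p.2) - g (q.1 - q.2)) * (ψ (p.1 - q.1) * ψ (p.2 - q.2)))
          (volume.prod volume) :=
        ((hψψi q).const_mul δ).mono' (by
          have : Continuous (fun p : (EuclideanSpace ℝ (Fin n)) × (EuclideanSpace ℝ (Fin n)) =>
            (g (p.1 - p.2) - g (q.1 - q.2)) * (ψ (p.1 - q.1) * ψ (p.2 - q.2))) := by fun_prop
          exact this.aestronglyMeasurable) (Filter.Eventually.of_forall hb)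
      have hD := norm_integral_le_of_norm_le ((hψψi q).const_mul δ) (Filter.Eventually.of_forall hb)
      rw [integral_const_mul, hψψ1, mul_one] at hD
      have hdec : (∫ p : (EuclideanSpace ℝ (Fin n)) × (EuclideanSpace ℝ (Fin n)), F p q ∂(volume.prod volume)) =
          (∫ p : (EuclideanSpace ℝ (Fin n)) × (EuclideanSpace ℝ (Fin n)), (g (p.1 - p.2) - g (q.1 - q.2)) * (ψ (p.1 - q.1) * ψ (p.2 - q.2))
            ∂(volume.prod volume)) * (v q.1 * v q.2) + g (q.1 - q.2) * v q.1 * v q.2 := by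
        have e : ∀ p : (EuclideanSpace ℝ (Fin n)) × (EuclideanSpace ℝ (Fin n)), F p q =
            ((g (p.1 - p.2) - g (q.1 - q.2)) * (ψ (p.1 - q.1) * ψ (p.2 - q.2))) * (v q.1 * v q.2)
            + (ψ (p.1 - q.1) * ψ (p.2 - q.2)) * (g (q.1 - q.2) * v q.1 * v q.2) := by
          intro p; simp only [F]; ring
        simp_rw [e]
        rw [integral_add (hint.mul_const _) ((hψψi q).mul_const _), integral_mul_const,
          integral_mul_const, hψψ1, one_mul]
      rw [hdec, add_sub_cancel_right]
      refine (le_abs_self _).trans ?_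
      rw [abs_mul]
      exact mul_le_mul_of_nonneg_right hD (abs_nonneg _)
    have hle := integral_mono (hAi.sub hI) (hvv.abs.const_mul δ) hpt
    rw [integral_const_mul] at hle
    have hsub := integral_sub hAi hI
    rw [hswap] at hJ
    simp only [Pi.sub_apply] at hle hsub
    linarith
  have hC0 : 0 ≤ C := integral_nonneg fun q => abs_nonneg _
  refine le_of_forall_pos_le_add fun ε hε => ?_
  have h1 := main (ε / (C + 1)) (by positivity)
  have h2 : ε / (C + 1) * C ≤ ε := by
    rw [div_mul_eq_mul_div, div_le_iff₀ (by positivity)]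
    nlinarith
  linarith

theorem stmt_9 {n : ℕ} (hn : 2 ≤ n) (g : EuclideanSpace ℝ (Fin n) → ℝ)
    (hg : IsPosDefRadialKernel g) (R : ℝ) (hR : 0 < R)
    (v : EuclideanSpace ℝ (Fin n) → ℝ)
    (hv : ContinuousOn v (sphere (0 : EuclideanSpace ℝ (Fin n)) R)) :
    0 ≤ ∫ x in sphere (0 : EuclideanSpace ℝ (Fin n)) R,
      (∫ y in sphere (0 : EuclideanSpace ℝ (Fin n)) R,
        g (x - y) * v x * v y ∂(μH[(n : ℝ) - 1])) ∂(μH[(n : ℝ) - 1]) := by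
  have hS : IsClosed (sphere (0 : EuclideanSpace ℝ (Fin n)) R) := isClosed_sphere
  obtain ⟨u, hu⟩ := ContinuousMap.exists_restrict_eq hS ⟨_, hv.domRestrict⟩
  have hu' : ∀ x ∈ sphere (0 : EuclideanSpace ℝ (Fin n)) R, u x = v x := fun x hx =>
    congrArg (fun f => f ⟨x, hx⟩) hu
  let φ : ContDiffBump (0 : EuclideanSpace ℝ (Fin n)) := ⟨R, R + 1, hR, by linarith⟩
  let w : EuclideanSpace ℝ (Fin n) → ℝ := fun x => φ x * u x
  have hw : ∀ x ∈ sphere (0 : EuclideanSpace ℝ (Fin n)) R, w x = v x := by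
    intro x hx
    have : φ x = 1 := φ.one_of_mem_closedBall (sphere_subset_closedBall hx)
    simp only [w, this, one_mul, hu' x hx]
  have : IsFiniteMeasure ((μH[(n : ℝ) - 1]).restrict
      (sphere (0 : EuclideanSpace ℝ (Fin n)) R)) :=
    isFiniteMeasure_restrict.2 (sphere_meas_lt_top hn R).ne
  have key := posdef_finite_measure g hg ((μH[(n : ℝ) - 1]).restrict
      (sphere (0 : EuclideanSpace ℝ (Fin n)) R)) w (φ.continuous.mul u.continuous) (R + 1) (by
    intro x hx
    have : φ x = 0 := φ.zero_of_le_dist (by simpa using hx.le)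
    simp only [w, this, zero_mul])
  refine key.trans_eq ?_
  refine setIntegral_congr_fun hS.measurableSet fun x hx => ?_
  refine setIntegral_congr_fun hS.measurableSet fun y hy => ?_
  simp only [hw x hx, hw y hy]
end
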